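/- arXiv:1409.8223 — 5 statements merged into one kernel-verified Lean document; each statement's English description precedes it below -/
import Mathlib

section
/- Let f : ℝ² → ℝ be a [1]-regulous function with f(x) ≥ 0 for all x ∈ ℝ². Then there exist m ∈ ℕ and [1]-regulous functions f₁, …, f_m : ℝ² → ℝ such that f = f₁² + ⋯ + f_m² pointwise on ℝ². -/
open MvPolynomial

/-- The polynomial `y ↦ q(a + y)`. -/
noncomputable def shiftPoly (a : Fin 2 → ℝ) (q : MvPolynomial (Fin 2) ℝ) :
    MvPolynomial (Fin 2) ℝ :=
  bind₁ (fun i => C (a i) + X i) q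

/-- The lowest-degree nonzero homogeneous component of `y ↦ q(a + y)` is positive
definite: it takes positive values at every `y ≠ 0`. -/
def LocPosDef (q : MvPolynomial (Fin 2) ℝ) (a : Fin 2 → ℝ) : Prop :=
  ∃ m : ℕ, homogeneousComponent m (shiftPoly a q) ≠ 0 ∧
    (∀ d < m, homogeneousComponent d (shiftPoly a q) = 0) ∧
    ∀ y : Fin 2 → ℝ, y ≠ 0 → 0 < eval y (homogeneousComponent m (shiftPoly a q))

/-- `p, q` is a representation of `f` witnessing that `f` is [1]-regulous:
`p` and `q` are relatively prime, `q ≥ 0` on `ℝ²` with finite zero set, `f = p/q` off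
`Z(q)`, and at every point of `Z(q)` the lowest-degree homogeneous component of `q` is
positive definite. -/
def OneRegulousRep (f : (Fin 2 → ℝ) → ℝ) (p q : MvPolynomial (Fin 2) ℝ) : Prop :=
  IsRelPrime p q ∧ (∀ x : Fin 2 → ℝ, 0 ≤ eval x q) ∧
    {x : Fin 2 → ℝ | eval x q = 0}.Finite ∧
    (∀ x : Fin 2 → ℝ, eval x q ≠ 0 → f x = eval x p / eval x q) ∧
    ∀ a : Fin 2 → ℝ, eval a q = 0 → LocPosDef q a

/-- `f : ℝ² → ℝ` is [1]-regulous: continuous, and a rational function which becomes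
regular after one stage of blowings-up of points. -/
def OneRegulous (f : (Fin 2 → ℝ) → ℝ) : Prop :=
  Continuous f ∧ ∃ p q : MvPolynomial (Fin 2) ℝ, OneRegulousRep f p q



namespace OneReg
open scoped Polynomial

theorem cassels_pfister {F : Type*} [Field F] {n : ℕ}
    (hF : ∀ r : Fin n → F[X], ∑ i, r i ^ 2 = 0 → ∀ i, r i = 0) (P : F[X]) :
    ∀ (N : ℕ) (h : F[X]) (A : Fin n → F[X]), h.natDegree ≤ N → h ≠ 0 →
      h ^ 2 * P = ∑ i, A i ^ 2 → ∃ B : Fin n → F[X], P = ∑ i, B i ^ 2 := by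
  intro N
  induction N using Nat.strong_induction_on with
  | _ N ih =>
    intro h A hN h0 hA
    by_cases hr : ∀ i, A i % h = 0
    · refine ⟨fun i => A i / h, ?_⟩
      have e : ∀ i, A i = h * (A i / h) := fun i => by
        have := EuclideanDomain.div_add_mod (A i) h
        rw [hr i, add_zero] at this; exact this.symm
      have : h ^ 2 * P = h ^ 2 * ∑ i, (A i / h) ^ 2 := by
        rw [hA, Finset.mul_sum]
        refine Finset.sum_congr rfl fun i _ => ?_
        conv_lhs => rw [e i]
        ring
      exact mul_left_cancel₀ (pow_ne_zero 2 h0) this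
    · have hdeg : ∀ i, A i % h = 0 ∨ (A i % h).natDegree < h.natDegree := fun i => by
        by_cases hz : A i % h = 0
        · exact Or.inl hz
        · exact Or.inr (Polynomial.natDegree_lt_natDegree hz (Polynomial.degree_mod_lt _ h0))
      have hpos : 0 < h.natDegree := by
        push Not at hr
        obtain ⟨i, hi⟩ := hr
        rcases hdeg i with h1 | h1
        · exact absurd h1 hi
        · omega
      set Q : Fin n → F[X] := fun i => A i / h with hQ
      set r : Fin n → F[X] := fun i => A i % h with hrdef
      have e : ∀ i, A i = h * Q i + r i := fun i => (EuclideanDomain.div_add_mod (A i) h).symm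
      set QQ := ∑ i, Q i ^ 2 with hQQ
      set AQ := ∑ i, A i * Q i with hAQ
      set m := QQ - P with hm
      set s := 2 * (h * P - AQ) with hs
      set h' := h * m + s with hh'
      have hsum : h * h' = ∑ i, r i ^ 2 := by
        have : ∑ i, r i ^ 2 = (∑ i, A i ^ 2) - 2 * h * AQ + h ^ 2 * QQ := by
          rw [hAQ, hQQ, Finset.mul_sum, Finset.mul_sum, ← Finset.sum_sub_distrib,
            ← Finset.sum_add_distrib]
          refine Finset.sum_congr rfl fun i _ => ?_
          have : r i = A i - h * Q i := by rw [e i]; ring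
          rw [this]; ring
        rw [this, ← hA, hh', hs, hm]; ring
      have h'0 : h' ≠ 0 := by
        intro hz
        rw [hz, mul_zero] at hsum
        exact hr (hF r hsum.symm)
      have hlt : h'.natDegree < h.natDegree := by
        have h1 : (h * h').natDegree = h.natDegree + h'.natDegree := Polynomial.natDegree_mul h0 h'0
        have h2 : (∑ i, r i ^ 2).natDegree ≤ 2 * (h.natDegree - 1) := by
          refine Polynomial.natDegree_sum_le_of_forall_le _ _ fun i _ => ?_
          refine (Polynomial.natDegree_pow_le).trans ?_
          rcases hdeg i with h3 | h3
          · simp only [hrdef, h3, Polynomial.natDegree_zero]; omega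
          · have : (r i).natDegree < h.natDegree := h3
            omega
        rw [← hsum, h1] at h2
        omega
      refine ih h'.natDegree (by omega) h' (fun i => m * A i + s * Q i) le_rfl h'0 ?_
      have : ∑ i, (m * A i + s * Q i) ^ 2 =
          m ^ 2 * (∑ i, A i ^ 2) + 2 * m * s * AQ + s ^ 2 * QQ := by
        rw [hAQ, hQQ, Finset.mul_sum, Finset.mul_sum, Finset.mul_sum, ← Finset.sum_add_distrib,
            ← Finset.sum_add_distrib]
        refine Finset.sum_congr rfl fun i _ => ?_
        ring
      rw [this, ← hA, hh', hs, hm]; ring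

theorem sq_sum_real {n : ℕ} (r : Fin n → ℝ[X]) (h : ∑ i, r i ^ 2 = 0) (i) : r i = 0 := by
  refine Polynomial.funext fun a => ?_
  have := congrArg (Polynomial.eval a) h
  rw [Polynomial.eval_finset_sum, Polynomial.eval_zero,
    Finset.sum_eq_zero_iff_of_nonneg (fun i _ => by rw [Polynomial.eval_pow]; positivity)] at this
  simpa using this i (Finset.mem_univ _)

/-- evaluation at inner variable -/
noncomputable abbrev evIn (a : ℝ) : ℝ[X][X] →+* ℝ[X] :=
  Polynomial.mapRingHom (Polynomial.evalRingHom a)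

theorem evIn_eq_zero_dvd (a : ℝ) (B : ℝ[X][X]) (h : evIn a B = 0) :
    Polynomial.C (Polynomial.X - Polynomial.C a) ∣ B := by
  rw [Polynomial.C_dvd_iff_dvd_coeff]
  intro i
  rw [Polynomial.dvd_iff_isRoot]
  have := congrArg (fun p => Polynomial.coeff p i) h
  simpa [evIn, Polynomial.coeff_map] using this

theorem sq_sum_real2 {n : ℕ} (r : Fin n → ℝ[X][X]) (h : ∑ i, r i ^ 2 = 0) (i) : r i = 0 := by
  ext1 k
  refine Polynomial.funext fun a => ?_
  have := congrArg (evIn a) h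
  rw [map_sum, map_zero] at this
  simp only [map_pow] at this
  have h2 := congrArg (fun p => Polynomial.coeff p k) (sq_sum_real _ this i)
  simpa [evIn, Polynomial.coeff_map] using h2

/-- common denominators for polynomials over the fraction field -/
theorem clear_denoms {n : ℕ} (r : Fin n → (FractionRing ℝ[X])[X]) :
    ∃ (d : ℝ[X]) (R : Fin n → ℝ[X][X]), d ≠ 0 ∧
      ∀ i, Polynomial.map (algebraMap ℝ[X] (FractionRing ℝ[X])) (R i) =
        Polynomial.C (algebraMap ℝ[X] (FractionRing ℝ[X]) d) * r i := by
  choose b hb hb2 using fun i =>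
    IsLocalization.integerNormalization_spec (nonZeroDivisors ℝ[X]) (r i)
  refine ⟨∏ i, b i, fun i => Polynomial.C (∏ j ∈ Finset.univ.erase i, b j) *
    IsLocalization.integerNormalization (nonZeroDivisors ℝ[X]) (r i), ?_, fun i => ?_⟩
  · exact Finset.prod_ne_zero_iff.2 fun i _ => nonZeroDivisors.ne_zero (hb i)
  · rw [Polynomial.map_mul, hb2, Polynomial.map_C, ← Finset.prod_erase_mul _ _ (Finset.mem_univ i),
      map_mul, Polynomial.C_mul, mul_assoc, Algebra.smul_def]
    rfl

theorem map_frac_inj : Function.Injective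
    (Polynomial.map (algebraMap ℝ[X] (FractionRing ℝ[X]))) :=
  Polynomial.map_injective _ (IsFractionRing.injective ℝ[X] (FractionRing ℝ[X]))

theorem sq_sum_frac {n : ℕ} (r : Fin n → (FractionRing ℝ[X])[X]) (h : ∑ i, r i ^ 2 = 0) (i) :
    r i = 0 := by
  obtain ⟨d, R, hd, hR⟩ := clear_denoms r
  have hs : ∑ i, R i ^ 2 = 0 := by
    apply map_frac_inj
    rw [Polynomial.map_sum, Polynomial.map_zero]
    simp only [Polynomial.map_pow, hR, mul_pow]
    rw [← Finset.mul_sum, h, mul_zero]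
  have h1 := hR i
  rw [sq_sum_real2 R hs i, Polynomial.map_zero] at h1
  have hne : Polynomial.C (algebraMap ℝ[X] (FractionRing ℝ[X]) d) ≠ 0 := by
    rw [Ne, Polynomial.C_eq_zero]
    exact fun hz => hd ((IsFractionRing.injective ℝ[X] (FractionRing ℝ[X])) (by rw [hz, map_zero]))
  exact (mul_eq_zero.1 h1.symm).resolve_left hne

theorem clean_denom {n : ℕ} (P : ℝ[X][X]) : ∀ (N : ℕ) (d : ℝ[X]) (B : Fin n → ℝ[X][X]),
    d.natDegree ≤ N → d ≠ 0 → Polynomial.C d ^ 2 * P = ∑ i, B i ^ 2 →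
    ∃ (d : ℝ[X]) (B : Fin n → ℝ[X][X]), (∀ a, d.eval a ≠ 0) ∧
      Polynomial.C d ^ 2 * P = ∑ i, B i ^ 2 := by
  intro N
  induction N using Nat.strong_induction_on with
  | _ N ih =>
    intro d B hN hd hB
    by_cases hr : ∀ a, d.eval a ≠ 0
    · exact ⟨d, B, hr, hB⟩
    · push Not at hr
      obtain ⟨a, ha⟩ := hr
      obtain ⟨e, he⟩ := Polynomial.dvd_iff_isRoot.2 ha
      have h1 := congrArg (evIn a) hB
      have h2 : evIn a (Polynomial.C d) = 0 := by
        simp [evIn, ha]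
      rw [map_mul, map_pow, h2, map_sum] at h1
      simp only [map_pow, ne_eq, OfNat.ofNat_ne_zero, not_false_eq_true, zero_pow, zero_mul] at h1
      choose B' hB' using fun i => evIn_eq_zero_dvd a (B i) (sq_sum_real _ h1.symm i)
      have he0 : e ≠ 0 := by rintro rfl; simp at he; exact hd he
      have hdeg : d.natDegree = 1 + e.natDegree := by
        rw [he, Polynomial.natDegree_mul (Polynomial.X_sub_C_ne_zero a) he0,
          Polynomial.natDegree_X_sub_C]
      refine ih e.natDegree (by omega) e B' le_rfl he0 ?_
      have hne : Polynomial.C (Polynomial.X - Polynomial.C a) ^ 2 ≠ (0 : ℝ[X][X]) :=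
        pow_ne_zero 2 (by rw [Ne, Polynomial.C_eq_zero]; exact Polynomial.X_sub_C_ne_zero a)
      refine mul_left_cancel₀ hne ?_
      rw [Finset.mul_sum, ← mul_assoc, ← mul_pow, ← Polynomial.C_mul, ← he, hB]
      exact Finset.sum_congr rfl fun i _ => by rw [hB' i]; ring

theorem regular_sos {n : ℕ} (P h : ℝ[X][X]) (A : Fin n → ℝ[X][X]) (h0 : h ≠ 0)
    (hA : h ^ 2 * P = ∑ i, A i ^ 2) :
    ∃ (d : ℝ[X]) (B : Fin n → ℝ[X][X]), (∀ a, d.eval a ≠ 0) ∧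
      Polynomial.C d ^ 2 * P = ∑ i, B i ^ 2 := by
  set φ := algebraMap ℝ[X] (FractionRing ℝ[X]) with hφ
  obtain ⟨b, hb⟩ := cassels_pfister (n := n) sq_sum_frac (P.map φ) _ (h.map φ)
    (fun i => (A i).map φ) le_rfl
    (fun hz => h0 (map_frac_inj (by rw [Polynomial.map_zero]; exact hz))) (by
      rw [← Polynomial.map_pow, ← Polynomial.map_mul, hA, Polynomial.map_sum]
      simp only [Polynomial.map_pow])
  obtain ⟨d, R, hd, hR⟩ := clear_denoms b
  refine clean_denom P _ d R le_rfl hd ?_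
  apply map_frac_inj
  rw [Polynomial.map_sum, Polynomial.map_mul, Polynomial.map_pow, Polynomial.map_C]
  simp only [Polynomial.map_pow, hR, mul_pow]
  rw [← Finset.mul_sum, ← hb]

end OneReg


namespace OneReg
open scoped Polynomial

section maxreal
variable {M : Type*} [Field M] [CharZero M]

theorem sumSq_inv {a : M} (h : IsSumSq a) : IsSumSq a⁻¹ := by
  by_cases h0 : a = 0
  · simpa [h0] using h
  · have : a⁻¹ = a * (a⁻¹ * a⁻¹) := by field_simp
    rw [this]
    exact h.mul (IsSumSq.mul_self _)

theorem sumSq_mod_quad (a : M) {s : M[X]} (hs : IsSumSq s) :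
    ∃ σ τ κ : M, IsSumSq σ ∧ IsSumSq τ ∧
      (Polynomial.X ^ 2 - Polynomial.C a) ∣
        s - (Polynomial.C (σ + a * τ) + Polynomial.C κ * Polynomial.X) := by
  induction hs with
  | zero => exact ⟨0, 0, 0, .zero, .zero, by simp⟩
  | sq_add g hs ih =>
    obtain ⟨σ, τ, κ, h1, h2, u, hu⟩ := ih
    have hmonic : (Polynomial.X ^ 2 - Polynomial.C a : M[X]).Monic :=
      Polynomial.monic_X_pow_sub_C a (by norm_num)
    set f := (Polynomial.X ^ 2 - Polynomial.C a : M[X]) with hf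
    have hdeg : (g %ₘ f).natDegree ≤ 1 := by
      have := Polynomial.natDegree_modByMonic_lt g hmonic (by
        intro h
        have := congrArg Polynomial.natDegree h
        rw [hf, Polynomial.natDegree_X_pow_sub_C] at this
        simp at this)
      have hf2 : f.natDegree = 2 := Polynomial.natDegree_X_pow_sub_C
      rw [hf2] at this
      omega
    obtain ⟨c, b, hcb⟩ := Polynomial.exists_eq_X_add_C_of_natDegree_le_one hdeg
    have hg := Polynomial.modByMonic_add_div g f
    set q := g /ₘ f
    refine ⟨b * b + σ, c * c + τ, 2 * b * c + κ, .sq_add _ h1, .sq_add _ h2,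
      Polynomial.C c ^ 2 + 2 * (g %ₘ f) * q + f * q ^ 2 + u, ?_⟩
    rw [sub_eq_iff_eq_add] at hu
    rw [hu]
    conv_lhs => rw [← hg]
    rw [hcb]
    simp only [map_add, map_mul, map_ofNat]
    have : (Polynomial.X ^ 2 : M[X]) = f + Polynomial.C a := by rw [hf]; ring
    linear_combination (Polynomial.C c ^ 2) * this


theorem quad_of_max {P : M} (hmax : ∀ f : M[X], Irreducible f → 1 < f.natDegree →
      ∃ h, IsSumSq (Polynomial.C P + f * h))
    {a : M} (ha : ¬ IsSquare a) : ∃ σ τ : M, IsSumSq σ ∧ IsSumSq τ ∧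
    P = σ + a * τ := by
  have hirr : Irreducible (Polynomial.X ^ 2 - Polynomial.C a : M[X]) := by
    apply X_pow_sub_C_irreducible_of_prime Nat.prime_two
    intro b hb
    exact ha ⟨b, by rw [← hb, sq]⟩
  obtain ⟨h, hh⟩ := hmax _ hirr (by rw [Polynomial.natDegree_X_pow_sub_C]; norm_num)
  obtain ⟨σ, τ, κ, h1, h2, u, hu⟩ := sumSq_mod_quad a hh
  refine ⟨σ, τ, h1, h2, ?_⟩
  set f := (Polynomial.X ^ 2 - Polynomial.C a : M[X]) with hf
  have hdvd : f ∣ Polynomial.C (P - (σ + a * τ)) - Polynomial.C κ * Polynomial.X := by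
    refine ⟨u - h, ?_⟩
    rw [map_sub]
    linear_combination hu
  have hz : Polynomial.C (P - (σ + a * τ)) - Polynomial.C κ * Polynomial.X = 0 := by
    by_contra hne
    have := Polynomial.natDegree_le_of_dvd hdvd hne
    rw [hf, Polynomial.natDegree_X_pow_sub_C] at this
    have h3 : (Polynomial.C (P - (σ + a * τ)) - Polynomial.C κ * Polynomial.X).natDegree ≤ 1 := by
      compute_degree
    omega
  have := congrArg (fun p => Polynomial.coeff p 0) hz
  simp at this
  linear_combination this

theorem neg_isSquare_of_max {P : M} (hP : ¬ IsSumSq P)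
    (hmax : ∀ f : M[X], Irreducible f → 1 < f.natDegree →
      ∃ h, IsSumSq (Polynomial.C P + f * h))
    : IsSquare (-P) := by
  by_contra hn
  obtain ⟨σ, τ, h1, h2, h3⟩ := quad_of_max hmax hn
  have h4 : P * (1 + τ) = σ := by linear_combination h3
  have h5 : IsSumSq (1 + τ) := IsSumSq.one.add h2
  by_cases h6 : 1 + τ = 0
  · apply hP
    have : P = ((P + 1) / 2) * ((P + 1) / 2) + τ * (((P - 1) / 2) * ((P - 1) / 2)) := by
      linear_combination (-(((P - 1) / 2) * ((P - 1) / 2))) * h6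
    rw [this]
    exact (IsSumSq.mul_self _).add (h2.mul (IsSumSq.mul_self _))
  · apply hP
    have : P = σ * (1 + τ)⁻¹ := by field_simp; exact h4
    rw [this]
    exact h1.mul (sumSq_inv h5)

theorem neg_one_of_max {P : M} (hP : ¬ IsSumSq P)
    (hmax : ∀ f : M[X], Irreducible f → 1 < f.natDegree →
      ∃ h, IsSumSq (Polynomial.C P + f * h))
    : ¬ IsSumSq (-1 : M) := by
  intro h
  obtain ⟨p, hp⟩ := neg_isSquare_of_max hP hmax
  apply hP
  have : P = -1 * (p * p) := by linear_combination -hp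
  rw [this]
  exact h.mul (IsSumSq.mul_self p)

theorem neg_sumSq_of_max {P : M} (hP : ¬ IsSumSq P)
    (hmax : ∀ f : M[X], Irreducible f → 1 < f.natDegree →
      ∃ h, IsSumSq (Polynomial.C P + f * h))
    {a : M} (ha : ¬ IsSquare a) : IsSumSq (-a) := by
  obtain ⟨σ, τ, h1, h2, h3⟩ := quad_of_max hmax ha
  obtain ⟨p, hp⟩ := neg_isSquare_of_max hP hmax
  have hτ : τ ≠ 0 := by
    rintro rfl
    apply hP
    rw [h3, mul_zero, add_zero]
    exact h1
  have : -a = (p * p + σ) * τ⁻¹ := by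
    field_simp
    linear_combination hp + h3
  rw [this]
  exact (IsSumSq.sq_add p h1).mul (sumSq_inv h2)

theorem sumSq_isSquare_of_max {P : M} (hP : ¬ IsSumSq P)
    (hmax : ∀ f : M[X], Irreducible f → 1 < f.natDegree →
      ∃ h, IsSumSq (Polynomial.C P + f * h))
    {a : M} (ha : IsSumSq a) : IsSquare a := by
  by_contra hn
  have h1 := neg_sumSq_of_max hP hmax hn
  have h0 : a ≠ 0 := by rintro rfl; exact hn ⟨0, by simp⟩
  apply neg_one_of_max hP hmax
  have : (-1 : M) = -a * a⁻¹ := by field_simp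
  rw [this]
  exact h1.mul (sumSq_inv ha)

theorem exists_order_of_max {P : M} (hP : ¬ IsSumSq P)
    (hmax : ∀ f : M[X], Irreducible f → 1 < f.natDegree →
      ∃ h, IsSumSq (Polynomial.C P + f * h))
    : ∃ (_ : LinearOrder M), IsStrictOrderedRing M ∧
    ∀ a : M, 0 ≤ a → IsSquare a := by
  classical
  let C : RingCone M :=
    { Subsemiring.sumSq M with
      eq_zero_of_mem_of_neg_mem' := by
        intro a h1 h2
        by_contra h0
        have h1' : IsSumSq a := by simpa using h1
        have h2' : IsSumSq (-a) := by simpa using h2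
        apply neg_one_of_max hP hmax
        have : (-1 : M) = -a * a⁻¹ := by field_simp
        rw [this]
        exact h2'.mul (sumSq_inv h1') }
  have memC : ∀ a, a ∈ C ↔ IsSumSq a := fun a => by
    change a ∈ Subsemiring.sumSq M ↔ _
    simp
  haveI : HasMemOrNegMem C := ⟨fun a => by
    rw [memC, memC]
    by_cases h : IsSquare a
    · exact Or.inl h.isSumSq
    · exact Or.inr (neg_sumSq_of_max hP hmax h)⟩
  letI lo : LinearOrder M := LinearOrder.mkOfAddGroupCone C
  haveI : IsOrderedRing M := IsOrderedRing.mkOfCone C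
  refine ⟨lo, IsOrderedRing.toIsStrictOrderedRing M, fun a ha => ?_⟩
  apply sumSq_isSquare_of_max hP hmax
  have : a - 0 ∈ C := ha
  rwa [sub_zero, memC] at this

end maxreal

section odd
variable {M : Type*} [Field M] [LinearOrder M] [IsStrictOrderedRing M]

theorem sumSq_even {s : M[X]} (hs : IsSumSq s) : s = 0 ∨ (Even s.natDegree ∧ 0 < s.leadingCoeff) := by
  induction hs with
  | zero => exact Or.inl rfl
  | @sq_add g s hs ih =>
    by_cases hg : g = 0
    · simpa [hg] using ih
    right
    have hgg : (g * g).natDegree = g.natDegree + g.natDegree := Polynomial.natDegree_mul hg hg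
    have hgl : 0 < (g * g).leadingCoeff := by
      rw [Polynomial.leadingCoeff_mul]
      exact mul_self_pos.2 (Polynomial.leadingCoeff_ne_zero.2 hg)
    rcases ih with rfl | ⟨h1, h2⟩
    · rw [add_zero]
      exact ⟨by rw [hgg]; exact ⟨_, rfl⟩, hgl⟩
    · rcases lt_trichotomy (g * g).natDegree s.natDegree with h | h | h
      · have hd : (g * g).degree < s.degree := Polynomial.degree_lt_degree h
        rw [Polynomial.natDegree_add_eq_right_of_natDegree_lt h,
          Polynomial.leadingCoeff_add_of_degree_lt hd]
        exact ⟨h1, h2⟩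
      · have hne : (g * g).leadingCoeff + s.leadingCoeff ≠ 0 := (add_pos hgl h2).ne'
        have hd : (g * g).degree = s.degree := by
          rw [Polynomial.degree_eq_natDegree (mul_ne_zero hg hg), h,
            Polynomial.degree_eq_natDegree (Polynomial.leadingCoeff_ne_zero.1 h2.ne')]
        rw [Polynomial.leadingCoeff_add_of_degree_eq hd hne]
        refine ⟨?_, add_pos hgl h2⟩
        have := Polynomial.degree_add_eq_of_leadingCoeff_add_ne_zero hne
        rw [hd, max_self] at this
        rw [Polynomial.natDegree_eq_of_degree_eq this]
        exact h1
      · have hd : s.degree < (g * g).degree := Polynomial.degree_lt_degree h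
        rw [Polynomial.natDegree_add_eq_left_of_natDegree_lt h,
          Polynomial.leadingCoeff_add_of_degree_lt' hd, hgg]
        exact ⟨⟨_, rfl⟩, hgl⟩

theorem sumSq_reduce (f : M[X]) (hf : 0 < f.natDegree) {s : M[X]} (hs : IsSumSq s) :
    ∃ s', IsSumSq s' ∧ s'.natDegree ≤ 2 * (f.natDegree - 1) ∧ f ∣ s - s' := by
  have hf0 : f ≠ 0 := by rintro rfl; simp at hf
  induction hs with
  | zero => exact ⟨0, .zero, by simp, by simp⟩
  | sq_add g hs ih =>
    obtain ⟨s', h1, h2, u, hu⟩ := ih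
    refine ⟨(g % f) * (g % f) + s', .sq_add _ h1, ?_, ?_⟩
    · refine (Polynomial.natDegree_add_le _ _).trans (max_le ?_ h2)
      refine Polynomial.natDegree_mul_le.trans ?_
      by_cases h0 : g % f = 0
      · simp [h0]
      have := Polynomial.natDegree_lt_natDegree h0 (Polynomial.degree_mod_lt g hf0)
      omega
    · have hg := EuclideanDomain.div_add_mod g f
      set q := g / f
      set r := g % f
      refine ⟨2 * q * r + f * q ^ 2 + u, ?_⟩
      rw [← hg]
      linear_combination hu


theorem odd_root_of_max {P : M} (hneg : P < 0)
    (hmax : ∀ f : M[X], Irreducible f → 1 < f.natDegree →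
      ∃ h, IsSumSq (Polynomial.C P + f * h))
    (hsq : ∀ a : M, 0 ≤ a → IsSquare a) : ∀ (d : ℕ) (f : M[X]), f.natDegree = d → Odd d → ∃ r, f.eval r = 0 := by
  intro d
  induction d using Nat.strong_induction_on with
  | _ d ih =>
    intro f hfd hd
    have hf0 : f ≠ 0 := by rintro rfl; simp at hfd; subst hfd; simp at hd
    by_cases hd1 : d = 1
    · obtain ⟨a, ha, b, rfl⟩ := Polynomial.natDegree_eq_one.1 (hfd.trans hd1)
      exact ⟨-b / a, by simp; field_simp; ring⟩
    have hd0 : d ≠ 0 := by rintro rfl; simp at hd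
    by_cases hirr : Irreducible f
    · obtain ⟨h, hh⟩ := hmax f hirr (by omega)
      obtain ⟨s', h1, h2, u, hu⟩ := sumSq_reduce f (by omega) hh
      obtain ⟨p, hp⟩ := hsq (-P) (by linarith)
      have e : f * (h - u) = Polynomial.C p * Polynomial.C p + s' := by
        rw [← Polynomial.C_mul, ← hp, Polynomial.C_neg]
        linear_combination hu
      have hSS : IsSumSq (Polynomial.C p * Polynomial.C p + s') := .sq_add _ h1
      have hev : ∀ x, 0 < (Polynomial.C p * Polynomial.C p + s').eval x := by
        intro x
        have h3 : IsSumSq (s'.eval x) := by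
          clear hu h2 e hSS
          induction h1 with
          | zero => simp
          | sq_add g hs ih2 => simpa using IsSumSq.sq_add _ ih2
        have := h3.nonneg
        simp only [Polynomial.eval_add, Polynomial.eval_mul, Polynomial.eval_C]
        have : 0 < p * p := by rw [← hp]; linarith
        linarith
      have hSSdeg : (Polynomial.C p * Polynomial.C p + s').natDegree ≤ 2 * (d - 1) := by
        refine (Polynomial.natDegree_add_le _ _).trans (max_le ?_ (hfd ▸ h2))
        rw [← Polynomial.C_mul, Polynomial.natDegree_C]; omega
      have hne : h - u ≠ 0 := by
        intro hz
        rw [hz, mul_zero] at e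
        have := hev 0
        rw [← e] at this
        simp at this
      have hdeg : f.natDegree + (h - u).natDegree = (Polynomial.C p * Polynomial.C p + s').natDegree := by
        rw [← e, Polynomial.natDegree_mul hf0 hne]
      rcases sumSq_even hSS with h5 | ⟨h5, -⟩
      · have := hev 0
        rw [h5] at this
        simp at this
      rw [← hdeg, hfd] at h5
      have h6 : Odd (h - u).natDegree := by
        rcases Nat.even_or_odd (h - u).natDegree with h7 | h7
        · exact absurd h5 (by rw [Nat.not_even_iff_odd]; exact hd.add_even h7)
        · exact h7
      obtain ⟨r, hr⟩ := ih _ (by omega) (h - u) rfl h6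
      have := hev r
      rw [← e, Polynomial.eval_mul, hr, mul_zero] at this
      exact absurd this (lt_irrefl _)
    · have hnu : ¬ IsUnit f := fun hu => by
        have := Polynomial.natDegree_eq_zero_of_isUnit hu; omega
      rw [irreducible_iff] at hirr
      push Not at hirr
      obtain ⟨a, b, hab, ha, hb⟩ := hirr hnu
      have ha0 : a ≠ 0 := by rintro rfl; simp at hab; exact hf0 hab
      have hb0 : b ≠ 0 := by rintro rfl; simp at hab; exact hf0 hab
      have hda : 0 < a.natDegree := by
        rw [Nat.pos_iff_ne_zero]
        intro h; exact ha (Polynomial.isUnit_iff_degree_eq_zero.2 (by rw [Polynomial.degree_eq_natDegree ha0, h]; rfl))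
      have hdb : 0 < b.natDegree := by
        rw [Nat.pos_iff_ne_zero]
        intro h; exact hb (Polynomial.isUnit_iff_degree_eq_zero.2 (by rw [Polynomial.degree_eq_natDegree hb0, h]; rfl))
      have hsum : d = a.natDegree + b.natDegree := by
        rw [← hfd, hab, Polynomial.natDegree_mul ha0 hb0]
      rcases Nat.even_or_odd a.natDegree with h1 | h1
      · have h2 : Odd b.natDegree := by
          rcases Nat.even_or_odd b.natDegree with h3 | h3
          · exact absurd hd (by rw [Nat.not_odd_iff_even, hsum]; exact h1.add h3)
          · exact h3
        obtain ⟨r, hr⟩ := ih _ (by omega) b rfl h2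
        exact ⟨r, by rw [hab, Polynomial.eval_mul, hr, mul_zero]⟩
      · obtain ⟨r, hr⟩ := ih _ (by omega) a rfl h1
        exact ⟨r, by rw [hab, Polynomial.eval_mul, hr, zero_mul]⟩

end odd
end OneReg


namespace OneReg
open scoped Polynomial

theorem sumSq_map {R S : Type*} [CommRing R] [CommRing S] (φ : R →+* S) {s : R} (hs : IsSumSq s) :
    IsSumSq (φ s) := by
  induction hs with
  | zero => simp
  | sq_add g hs ih => simpa using IsSumSq.sq_add _ ih

theorem sumSq_iSup {K L ι : Type*} [Field K] [Field L] [Algebra K L] [Nonempty ι]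
    (t : ι → IntermediateField K L) (ht : Directed (· ≤ ·) t) (s : (iSup t : IntermediateField K L))
    (hs : IsSumSq s) : ∃ i, ∃ s' : t i, IsSumSq s' ∧ (s' : L) = (s : L) := by
  induction hs with
  | zero => exact ⟨Classical.arbitrary ι, 0, .zero, by simp⟩
  | sq_add g hs ih =>
    obtain ⟨i, s', h1, h2⟩ := ih
    have hg : (g : L) ∈ (iSup t : IntermediateField K L) := g.2
    have hg' : (g : L) ∈ ((iSup t : IntermediateField K L) : Set L) := hg
    rw [IntermediateField.coe_iSup_of_directed ht] at hg'
    obtain ⟨j, hj⟩ := Set.mem_iUnion.1 hg'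
    obtain ⟨k, hik, hjk⟩ := ht i j
    refine ⟨k, ⟨g, hjk hj⟩ * ⟨g, hjk hj⟩ + IntermediateField.inclusion hik s',
      .sq_add _ (sumSq_map (IntermediateField.inclusion hik).toRingHom h1), ?_⟩
    simp [h2]

theorem sumSq_lift {M L : Type*} [Field M] [Field L] [Algebra M L] (w : L) (hw : IsIntegral M w)
    (s : IntermediateField.adjoin M {w}) (hs : IsSumSq s) :
    ∃ h : M[X], IsSumSq h ∧ Polynomial.aeval w h = (s : L) := by
  induction hs with
  | zero => exact ⟨0, .zero, by simp⟩
  | sq_add g hs ih =>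
    obtain ⟨h, h1, h2⟩ := ih
    have hg : (g : L) ∈ (IntermediateField.adjoin M {w}).toSubalgebra := g.2
    rw [IntermediateField.adjoin_simple_toSubalgebra_of_isAlgebraic hw.isAlgebraic,
      Algebra.adjoin_singleton_eq_range_aeval] at hg
    obtain ⟨k, hk⟩ := hg
    refine ⟨k * k + h, .sq_add _ h1, ?_⟩
    have hk' : Polynomial.aeval w k = (g : L) := hk
    simp [h2, hk']

theorem exists_max {K : Type} [Field K] [CharZero K] (P : K) (hP : ¬ IsSumSq P) :
    ∃ (M : Type) (_ : Field M) (φ : K →+* M), ¬ IsSumSq (φ P) ∧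
      ∀ f : M[X], Irreducible f → 1 < f.natDegree →
        ∃ h, IsSumSq (Polynomial.C (φ P) + f * h) := by
  let Ω := AlgebraicClosure K
  obtain ⟨M, -, hM⟩ := zorn_le_nonempty₀ {M : IntermediateField K Ω | ¬ IsSumSq (algebraMap K M P)}
    (by
      intro c hc hch y hy
      haveI : Nonempty c := ⟨⟨y, hy⟩⟩
      have hdir : Directed (· ≤ ·) (fun i : c => (i : IntermediateField K Ω)) := hch.directed
      refine ⟨⨆ i : c, (i : IntermediateField K Ω), ?_, fun z hz => ?_⟩
      · intro hss
        obtain ⟨i, s', h1, h2⟩ := sumSq_iSup _ hdir _ hss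
        apply hc i.2
        have : s' = algebraMap K (i : IntermediateField K Ω) P := by
          apply Subtype.ext
          rw [h2]; rfl
        rwa [this] at h1
      · exact le_iSup (fun i : c => (i : IntermediateField K Ω)) ⟨z, hz⟩)
    ⊥ (by
      intro hss
      have := sumSq_map (IntermediateField.botEquiv K Ω).toRingEquiv.toRingHom hss
      apply hP
      convert this
      simp)
  refine ⟨M, inferInstance, algebraMap K M, hM.1, ?_⟩
  intro f hf hdeg
  obtain ⟨w, hw⟩ := IsAlgClosed.exists_aeval_eq_zero Ω f (by
    rw [Polynomial.degree_eq_natDegree hf.ne_zero]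
    intro h
    have : f.natDegree = 0 := by exact_mod_cast h
    omega)
  have hintg : IsIntegral M w := by
    rw [← isAlgebraic_iff_isIntegral]
    exact ⟨f, hf.ne_zero, hw⟩
  have hmp := minpoly.eq_of_irreducible hf hw
  have hwM : w ∉ M := by
    intro h
    have h1 : f.eval (⟨w, h⟩ : M) = 0 := by
      have h2 : algebraMap M Ω (f.eval (⟨w, h⟩ : M)) = 0 := by
        rw [← hw, ← Polynomial.aeval_algebraMap_apply_eq_algebraMap_eval]
        rfl
      exact (map_eq_zero _).1 h2
    have := Polynomial.degree_eq_one_of_irreducible_of_root hf h1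
    have : f.natDegree = 1 := Polynomial.natDegree_eq_of_degree_eq_some this
    omega
  let M' : IntermediateField K Ω :=
    IntermediateField.restrictScalars K (IntermediateField.adjoin M {w})
  have hle : M ≤ M' := by
    intro z hz
    change z ∈ IntermediateField.restrictScalars K (IntermediateField.adjoin M {w})
    rw [IntermediateField.mem_restrictScalars]
    exact (IntermediateField.adjoin M {w}).algebraMap_mem ⟨z, hz⟩
  have hw' : w ∈ M' := by
    change w ∈ IntermediateField.restrictScalars K (IntermediateField.adjoin M {w})
    rw [IntermediateField.mem_restrictScalars]
    exact IntermediateField.mem_adjoin_simple_self M w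
  have hbad : IsSumSq (algebraMap K M' P) := by
    by_contra hn
    exact hwM (hM.2 hn hle hw')
  obtain ⟨h, h1, h2⟩ := sumSq_lift w hintg (algebraMap K M' P) hbad
  have h3 : Polynomial.aeval w (h - Polynomial.C (algebraMap K M P)) = 0 := by
    rw [map_sub, h2, Polynomial.aeval_C, sub_eq_zero]
    rfl
  have h4 := minpoly.dvd M w h3
  rw [← hmp] at h4
  obtain ⟨u, hu⟩ := h4
  refine ⟨Polynomial.C f.leadingCoeff⁻¹ * u, ?_⟩
  have : Polynomial.C (algebraMap K M P) + f * (Polynomial.C f.leadingCoeff⁻¹ * u) = h := by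
    linear_combination -hu
  rw [this]
  exact h1

theorem exists_real_closed {K : Type} [Field K] [CharZero K] (P : K) (hP : ¬ IsSumSq P) :
    ∃ (M : Type) (_ : Field M) (_ : LinearOrder M) (_ : IsStrictOrderedRing M) (φ : K →+* M),
      φ P < 0 ∧ (∀ a : M, 0 ≤ a → IsSquare a) ∧
      ∀ f : M[X], Odd f.natDegree → ∃ r, f.eval r = 0 := by
  obtain ⟨M, _, φ, h1, h2⟩ := exists_max P hP
  haveI : CharZero M := charZero_of_injective_ringHom φ.injective
  obtain ⟨_, _, h3⟩ := exists_order_of_max h1 h2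
  have hneg : φ P < 0 := by
    by_contra h
    exact h1 (h3 _ (not_lt.1 h)).isSumSq
  exact ⟨M, _, _, ‹_›, φ, hneg, h3, fun f hf => odd_root_of_max hneg h2 h3 _ f rfl hf⟩

end OneReg


namespace OneReg
open scoped Polynomial
open scoped IntermediateField

theorem no_quad {C D : Type*} [Field C] [CharZero C] [Field D] [Algebra C D]
    (hC : ∀ z : C, IsSquare z) (h2 : Module.finrank C D = 2) : False := by
  haveI : FiniteDimensional C D := Module.finite_of_finrank_pos (by omega)
  obtain ⟨α, hα⟩ := Field.exists_primitive_element C D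
  rw [Field.primitive_element_iff_minpoly_natDegree_eq, h2] at hα
  have hintg : IsIntegral C α := Algebra.IsIntegral.isIntegral α
  have hirr := minpoly.irreducible hintg
  have hmon := minpoly.monic hintg
  set m := minpoly C α
  have hm : m = Polynomial.X ^ 2 + Polynomial.C (m.coeff 1) * Polynomial.X +
      Polynomial.C (m.coeff 0) := by
    conv_lhs => rw [Polynomial.as_sum_range_C_mul_X_pow m, hα]
    simp only [Finset.sum_range_succ, Finset.sum_range_zero]
    have : m.coeff 2 = 1 := by rw [← hα]; exact hmon
    rw [this]
    simp
    ring
  set b := m.coeff 1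
  set c := m.coeff 0
  obtain ⟨s, hs⟩ := hC ((b / 2) ^ 2 - c)
  have hroot : m.IsRoot (s - b / 2) := by
    rw [Polynomial.IsRoot, hm]
    simp
    linear_combination -hs
  have := Polynomial.degree_eq_one_of_irreducible_of_root hirr hroot
  have : m.natDegree = 1 := Polynomial.natDegree_eq_of_degree_eq_some this
  omega

theorem two_pow_top {C E : Type*} [Field C] [CharZero C] [Field E] [Algebra C E]
    [FiniteDimensional C E] [IsGalois C E]
    (hC : ∀ z : C, IsSquare z) (j : ℕ) (h : Module.finrank C E = 2 ^ j) : j = 0 := by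
  by_contra hj
  obtain ⟨k, rfl⟩ : ∃ k, j = k + 1 := ⟨j - 1, by omega⟩
  have hcard := IsGalois.card_aut_eq_finrank C E
  rw [h] at hcard
  haveI : Fact (Nat.Prime 2) := ⟨Nat.prime_two⟩
  obtain ⟨H, hH⟩ := Sylow.exists_subgroup_card_pow_prime (G := Gal(E/C)) 2 (n := k)
    (by rw [hcard]; exact ⟨2, by ring⟩)
  have h1 := IntermediateField.finrank_fixedField_eq_card H
  have h2 := Module.finrank_mul_finrank C (IntermediateField.fixedField H) E
  rw [h1, hH, h, pow_succ, mul_comm (2 ^ k)] at h2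
  have h3 := Nat.eq_of_mul_eq_mul_right (by positivity) h2
  exact no_quad hC h3

section
variable {M : Type*} [Field M] [LinearOrder M] [IsStrictOrderedRing M]

theorem odd_ext (hodd : ∀ f : M[X], Odd f.natDegree → ∃ r, f.eval r = 0)
    (L : Type*) [Field L] [Algebra M L] [FiniteDimensional M L]
    (h : Odd (Module.finrank M L)) : Module.finrank M L = 1 := by
  obtain ⟨α, hα⟩ := Field.exists_primitive_element M L
  rw [Field.primitive_element_iff_minpoly_natDegree_eq] at hα
  have hintg : IsIntegral M α := Algebra.IsIntegral.isIntegral α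
  have hirr := minpoly.irreducible hintg
  obtain ⟨r, hr⟩ := hodd (minpoly M α) (by rw [hα]; exact h)
  have := Polynomial.degree_eq_one_of_irreducible_of_root hirr hr
  rw [← hα]
  exact Polynomial.natDegree_eq_of_degree_eq_some this

theorem two_pow_ext (hodd : ∀ f : M[X], Odd f.natDegree → ∃ r, f.eval r = 0)
    (E : Type*) [Field E] [Algebra M E] [FiniteDimensional M E] [IsGalois M E] :
    ∃ k, Module.finrank M E = 2 ^ k := by
  haveI : Fact (Nat.Prime 2) := ⟨Nat.prime_two⟩
  obtain ⟨S⟩ : Nonempty (Sylow 2 Gal(E/M)) := inferInstance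
  have h1 := S.not_dvd_index
  have h2 := IntermediateField.finrank_eq_fixingSubgroup_index E
    (IntermediateField.fixedField (S : Subgroup Gal(E/M)))
  rw [IntermediateField.fixingSubgroup_fixedField] at h2
  have h3 := odd_ext hodd (IntermediateField.fixedField (S : Subgroup Gal(E/M)))
    (by rw [h2, ← Nat.not_even_iff_odd, even_iff_two_dvd]; exact h1)
  have h4 := Module.finrank_mul_finrank M (IntermediateField.fixedField (S : Subgroup Gal(E/M))) E
  rw [h3, one_mul, IntermediateField.finrank_fixedField_eq_card, Sylow.card_eq_multiplicity] at h4
  exact ⟨_, h4.symm⟩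

theorem complex_sqrt (hsq : ∀ a : M, 0 ≤ a → IsSquare a)
    (a b : M) : ∃ x y : M, x ^ 2 - y ^ 2 = a ∧ 2 * x * y = b := by
  obtain ⟨n, hn⟩ := hsq (a ^ 2 + b ^ 2) (by positivity)
  wlog hn0 : 0 ≤ n generalizing n
  · exact this (-n) (by rw [hn]; ring) (by linarith)
  have ha : |a| ≤ n := by
    apply abs_le_of_sq_le_sq _ hn0
    nlinarith [sq_nonneg b]
  obtain ⟨h1, h2⟩ := abs_le.1 ha
  obtain ⟨x, hx⟩ := hsq ((n + a) / 2) (by linarith)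
  obtain ⟨y, hy⟩ := hsq ((n - a) / 2) (by linarith)
  have h3 : (2 * x * y) ^ 2 = b ^ 2 := by
    have : (2 * x * y) ^ 2 = 4 * (x * x) * (y * y) := by ring
    rw [this, ← hx, ← hy]
    linear_combination -hn
  rcases sq_eq_sq_iff_eq_or_eq_neg.1 h3 with h | h
  · exact ⟨x, y, by linear_combination hy - hx, h⟩
  · exact ⟨x, -y, by linear_combination hy - hx, by linear_combination -h⟩

theorem adjoin_i_squares (hsq : ∀ a : M, 0 ≤ a → IsSquare a)
    {E : Type*} [Field E] [Algebra M E] (i : E) (hi : i ^ 2 = -1)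
    (z : IntermediateField.adjoin M {i}) : IsSquare z := by
  have hintg : IsIntegral M i := ⟨Polynomial.X ^ 2 - Polynomial.C (-1),
    Polynomial.monic_X_pow_sub_C _ (by norm_num), by simp [hi]⟩
  have hg : (z : E) ∈ (IntermediateField.adjoin M {i}).toSubalgebra := z.2
  rw [IntermediateField.adjoin_simple_toSubalgebra_of_isAlgebraic hintg.isAlgebraic,
    Algebra.adjoin_singleton_eq_range_aeval] at hg
  obtain ⟨p, hp⟩ := hg
  have hp' : Polynomial.aeval i p = (z : E) := hp
  have hab : ∃ a b : M, (z : E) = algebraMap M E a + algebraMap M E b * i := by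
    rw [← hp']
    clear hp hp'
    induction p using Polynomial.induction_on' with
    | add p q h1 h2 =>
      obtain ⟨a, b, h1⟩ := h1
      obtain ⟨c, d, h2⟩ := h2
      exact ⟨a + c, b + d, by rw [map_add, h1, h2, map_add, map_add]; ring⟩
    | monomial n a =>
      rw [Polynomial.aeval_monomial]
      rcases Nat.even_or_odd' n with ⟨k, rfl | rfl⟩
      · exact ⟨a * (-1) ^ k, 0, by rw [pow_mul, hi]; simp⟩
      · exact ⟨0, a * (-1) ^ k, by rw [pow_succ, pow_mul, hi]; simp; ring⟩
  obtain ⟨a, b, hab⟩ := hab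
  obtain ⟨x, y, h1, h2⟩ := complex_sqrt hsq a b
  let I : IntermediateField.adjoin M {i} := ⟨i, IntermediateField.mem_adjoin_simple_self M i⟩
  refine ⟨algebraMap M _ x + algebraMap M _ y * I, Subtype.ext ?_⟩
  have : ((algebraMap M (IntermediateField.adjoin M {i}) x + algebraMap M _ y * I : IntermediateField.adjoin M {i}) : E)
    = algebraMap M E x + algebraMap M E y * i := rfl
  rw [hab, MulMemClass.coe_mul, this, ← h1, ← h2]
  simp only [map_sub, map_pow, map_mul, map_ofNat]
  linear_combination -(algebraMap M E y) ^ 2 * hi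

theorem irr_deg_le_two (hsq : ∀ a : M, 0 ≤ a → IsSquare a)
    (hodd : ∀ f : M[X], Odd f.natDegree → ∃ r, f.eval r = 0)
    (f : M[X]) (hf : Irreducible f) : f.natDegree ≤ 2 := by
  let g : M[X] := f * (Polynomial.X ^ 2 + 1)
  let E := g.SplittingField
  have hX : (Polynomial.X ^ 2 + 1 : M[X]).natDegree = 2 := by
    have := Polynomial.natDegree_X_pow_add_C (n := 2) (r := (1 : M))
    simpa using this
  have hX0 : (Polynomial.X ^ 2 + 1 : M[X]) ≠ 0 := by
    intro h; rw [h] at hX; simp at hX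
  have hg0 : g ≠ 0 := mul_ne_zero hf.ne_zero hX0
  have hsp : (g.map (algebraMap M E)).Splits := Polynomial.SplittingField.splits g
  haveI : Normal M E := Normal.of_isSplittingField g
  haveI : FiniteDimensional M E := Polynomial.IsSplittingField.finiteDimensional E g
  haveI : IsGalois M E := ⟨⟩
  have hE0 : ∀ h : M[X], h ≠ 0 → h.map (algebraMap M E) ≠ 0 := fun h hh =>
    (Polynomial.map_ne_zero_iff (algebraMap M E).injective).2 hh
  have hroot : ∀ h : M[X], h ∣ g → h.natDegree ≠ 0 → ∃ x : E, Polynomial.aeval x h = 0 := by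
    intro h hh hd
    have h1 : (h.map (algebraMap M E)).Splits :=
      hsp.of_dvd (hE0 _ hg0) (Polynomial.map_dvd _ hh)
    obtain ⟨x, hx⟩ := h1.exists_eval_eq_zero (by
      rw [Polynomial.degree_map]
      intro h3
      exact hd (Polynomial.natDegree_eq_of_degree_eq_some h3))
    exact ⟨x, by rwa [Polynomial.eval_map_algebraMap] at hx⟩
  obtain ⟨i, hi⟩ := hroot (Polynomial.X ^ 2 + 1) ⟨f, by ring⟩ (by omega)
  have hi2 : i ^ 2 = -1 := by
    simp at hi
    linear_combination hi
  obtain ⟨k, hk⟩ := two_pow_ext hodd E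
  have h1 := Module.finrank_mul_finrank M (IntermediateField.adjoin M {i}) E
  have hintg : IsIntegral M i := Algebra.IsIntegral.isIntegral i
  have h2 : Module.finrank M (IntermediateField.adjoin M {i}) ≤ 2 := by
    rw [IntermediateField.adjoin.finrank hintg]
    have := Polynomial.natDegree_le_of_dvd (minpoly.dvd M i hi) hX0
    omega
  have h3 : Module.finrank (IntermediateField.adjoin M {i}) E ∣ 2 ^ k := ⟨_, by rw [← hk, ← h1]; ring⟩
  obtain ⟨j, -, hj⟩ := (Nat.dvd_prime_pow Nat.prime_two).1 h3
  have h4 := two_pow_top (adjoin_i_squares hsq i hi2) j hj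
  rw [h4, pow_zero] at hj
  rw [hj, mul_one] at h1
  rw [h1] at h2
  by_cases hd : f.natDegree = 0
  · omega
  obtain ⟨x, hx⟩ := hroot f ⟨_, rfl⟩ hd
  have h5 := minpoly.eq_of_irreducible hf hx
  have h6 := minpoly.natDegree_le (A := M) x
  rw [← h5, Polynomial.natDegree_mul_C (inv_ne_zero (Polynomial.leadingCoeff_ne_zero.2 hf.ne_zero))] at h6
  omega

end
end OneReg


namespace OneReg
open scoped Polynomial

/-- The product of linear and positive quadratic factors. -/
noncomputable def facProd {K : Type*} [Field K] (c : K) (s : List K) (t : List (K × K)) : K[X] :=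
  Polynomial.C c * (s.map (fun r => Polynomial.X - Polynomial.C r)).prod *
    (t.map (fun p => (Polynomial.X - Polynomial.C p.1) ^ 2 + Polynomial.C p.2 ^ 2)).prod

/-- Real-closedness, in the form that we use. -/
structure RC (K : Type*) [Field K] [LinearOrder K] : Prop where
  sq : ∀ a : K, 0 ≤ a → IsSquare a
  deg : ∀ f : K[X], Irreducible f → f.natDegree ≤ 2

theorem rc_real : RC ℝ where
  sq a ha := ⟨√a, (Real.mul_self_sqrt ha).symm⟩
  deg f hf := Polynomial.natDegree_le_of_degree_le hf.degree_le_two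

theorem fac_exists {K : Type*} [Field K] [LinearOrder K] [IsStrictOrderedRing K] (hK : RC K)
    (f : K[X]) (hf : f ≠ 0) : ∃ (c : K) (s : List K) (t : List (K × K)), c ≠ 0 ∧
      (∀ p ∈ t, p.2 ≠ 0) ∧ f = facProd c s t := by
  induction f using WfDvdMonoid.induction_on_irreducible with
  | zero => exact absurd rfl hf
  | unit u hu =>
    obtain ⟨c, hc, rfl⟩ := Polynomial.isUnit_iff.1 hu
    exact ⟨c, [], [], hc.ne_zero, by simp, by simp [facProd]⟩
  | mul a i ha hi ih =>
    obtain ⟨c, s, t, hc, ht, hfa⟩ := ih ha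
    have hd := hK.deg i hi
    have h0 : i.natDegree ≠ 0 := by
      intro h
      rw [Polynomial.eq_C_of_natDegree_eq_zero h] at hi
      by_cases h1 : i.coeff 0 = 0
      · rw [h1] at hi; simp at hi
      · exact hi.not_isUnit (Polynomial.isUnit_C.2 (isUnit_iff_ne_zero.2 h1))
    by_cases h1 : i.natDegree = 1
    · obtain ⟨α, hα, β, hi'⟩ := Polynomial.natDegree_eq_one.1 h1
      refine ⟨α * c, (-β / α) :: s, t, mul_ne_zero hα hc, ht, ?_⟩
      rw [hfa, ← hi']
      have : Polynomial.C α * Polynomial.X + Polynomial.C β =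
          Polynomial.C α * (Polynomial.X - Polynomial.C (-β / α)) := by
        rw [mul_sub, ← Polynomial.C_mul, mul_div_cancel₀ _ hα]
        simp
      rw [this]
      simp only [facProd, List.map_cons, List.prod_cons, Polynomial.C_mul]
      ring
    · have h2 : i.natDegree = 2 := by omega
      set α := i.coeff 2
      set β := i.coeff 1
      set γ := i.coeff 0
      have hα : α ≠ 0 := by
        have : i.leadingCoeff ≠ 0 := Polynomial.leadingCoeff_ne_zero.2 hi.ne_zero
        rwa [Polynomial.leadingCoeff, h2] at this
      have hi' : i = Polynomial.C α * ((Polynomial.X - Polynomial.C (-β / (2 * α))) ^ 2 +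
          Polynomial.C (γ / α - (β / (2 * α)) ^ 2)) := by
        have e1 : i = Polynomial.C α * Polynomial.X ^ 2 + Polynomial.C β * Polynomial.X +
            Polynomial.C γ := by
          conv_lhs => rw [Polynomial.as_sum_range_C_mul_X_pow i, h2]
          simp only [Finset.sum_range_succ, Finset.sum_range_zero]
          simp only [zero_add, pow_zero, mul_one, pow_one]
          ring
        have e2 : β = α * (2 * (β / (2 * α))) := by field_simp
        have e3 : γ = α * (γ / α) := by field_simp
        rw [e1]
        have e2' := congrArg Polynomial.C e2
        have e3' := congrArg Polynomial.C e3
        simp only [neg_div, Polynomial.C_neg, Polynomial.C_sub, Polynomial.C_mul, Polynomial.C_pow, map_ofNat] at e2' e3' ⊢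
        linear_combination Polynomial.X * e2' + e3'
      have hpos : 0 < γ / α - (β / (2 * α)) ^ 2 := by
        by_contra hn
        obtain ⟨w, hw⟩ := hK.sq (-(γ / α - (β / (2 * α)) ^ 2)) (by linarith)
        have hroot : i.IsRoot (w + -β / (2 * α)) := by
          rw [Polynomial.IsRoot, hi']
          simp only [Polynomial.eval_mul, Polynomial.eval_add, Polynomial.eval_pow,
            Polynomial.eval_sub, Polynomial.eval_X, Polynomial.eval_C]
          rw [add_sub_cancel_right, sq w, ← hw]
          ring
        have := Polynomial.degree_eq_one_of_irreducible_of_root hi hroot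
        exact h1 (Polynomial.natDegree_eq_of_degree_eq_some this)
      obtain ⟨v, hv⟩ := hK.sq _ hpos.le
      refine ⟨α * c, s, (-β / (2 * α), v) :: t, mul_ne_zero hα hc, ?_, ?_⟩
      · intro p hp
        rcases List.mem_cons.1 hp with rfl | hp
        · rintro h
          have h' : v = 0 := h
          rw [hv, h'] at hpos
          simp at hpos
        · exact ht p hp
      · rw [hv, Polynomial.C_mul, ← sq] at hi'
        rw [hfa, hi']
        simp only [facProd, List.map_cons, List.prod_cons, Polynomial.C_mul]
        ring

theorem facProd_natDegree {K : Type*} [Field K] (c : K) (hc : c ≠ 0) (s : List K)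
    (t : List (K × K)) : (facProd c s t).natDegree = s.length + 2 * t.length := by
  have h1 : ((s.map (fun r => Polynomial.X - Polynomial.C r)).prod).Monic ∧
     ((s.map (fun r => Polynomial.X - Polynomial.C r)).prod).natDegree = s.length := by
    induction s with
    | nil => simp
    | cons r s ih =>
      have hm := Polynomial.monic_X_sub_C r
      simp only [List.map_cons, List.prod_cons, List.length_cons]
      refine ⟨hm.mul ih.1, ?_⟩
      rw [hm.natDegree_mul ih.1, ih.2, Polynomial.natDegree_X_sub_C]
      omega
  have h2 : ((t.map (fun p : K × K => (Polynomial.X - Polynomial.C p.1) ^ 2 + Polynomial.C p.2 ^ 2)).prod).Monic ∧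
     ((t.map (fun p : K × K => (Polynomial.X - Polynomial.C p.1) ^ 2 + Polynomial.C p.2 ^ 2)).prod).natDegree = 2 * t.length := by
    clear h1
    induction t with
    | nil => simp
    | cons p t ih =>
      have hm0 : ((Polynomial.X - Polynomial.C p.1) ^ 2).Monic := (Polynomial.monic_X_sub_C p.1).pow 2
      have hd0 : ((Polynomial.X - Polynomial.C p.1) ^ 2).natDegree = 2 := by
        rw [(Polynomial.monic_X_sub_C p.1).natDegree_pow, Polynomial.natDegree_X_sub_C]
      have hlt : (Polynomial.C (p.2 ^ 2)).degree < ((Polynomial.X - Polynomial.C p.1) ^ 2).degree := by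
        refine lt_of_le_of_lt Polynomial.degree_C_le ?_
        rw [Polynomial.degree_eq_natDegree hm0.ne_zero, hd0]
        norm_num
      rw [Polynomial.C_pow] at hlt
      have hm := hm0.add_of_left hlt
      have hd : ((Polynomial.X - Polynomial.C p.1) ^ 2 + Polynomial.C p.2 ^ 2).natDegree = 2 := by
        rw [Polynomial.natDegree_add_eq_left_of_degree_lt hlt, hd0]
      simp only [List.map_cons, List.prod_cons, List.length_cons]
      refine ⟨hm.mul ih.1, ?_⟩
      rw [hm.natDegree_mul ih.1, ih.2, hd]
      omega
  rw [facProd, mul_assoc, Polynomial.natDegree_C_mul hc, h1.1.natDegree_mul h2.1, h1.2, h2.2]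

section bez
variable {A : Type*} [CommRing A]

/-- the numerator of the Bezoutian of `Q` and its derivative -/
noncomputable def bezD (Q : A[X]) : A[X][X] :=
  Q.map Polynomial.C * Polynomial.C (Polynomial.derivative Q) -
    Polynomial.C Q * (Polynomial.derivative Q).map Polynomial.C

/-- `g(Y) g(Z)` -/
noncomputable def dbl (g : A[X]) : A[X][X] := g.map Polynomial.C * Polynomial.C g

theorem dbl_mul (f g : A[X]) : dbl (f * g) = dbl f * dbl g := by
  simp only [dbl, Polynomial.map_mul, Polynomial.C_mul]; ring

theorem bezD_mul (f g : A[X]) : bezD (f * g) = dbl f * bezD g + dbl g * bezD f := by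
  simp only [bezD, dbl, Polynomial.map_mul, Polynomial.C_mul, Polynomial.derivative_mul,
    Polynomial.map_add, Polynomial.C_add]
  ring

theorem bez_exists (Q : A[X]) : ∃ B : A[X][X],
    bezD Q = (Polynomial.X - Polynomial.C Polynomial.X) * B := by
  have : (bezD Q).IsRoot Polynomial.X := by
    simp only [bezD, Polynomial.IsRoot, Polynomial.eval_sub, Polynomial.eval_mul,
      Polynomial.eval_C, Polynomial.eval_map, Polynomial.eval₂_C_X]
    ring
  exact Polynomial.dvd_iff_isRoot.2 this

/-- the diagonal expression of the Bezoutian -/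
noncomputable def bezE (R : List A[X]) (W : List (A[X] × A[X])) : A[X][X] :=
  (R.map dbl).sum + 2 * (W.map (fun p => dbl p.1 - dbl p.2)).sum

theorem bezE_mul (f : A[X]) (R : List A[X]) (W : List (A[X] × A[X])) :
    bezE (R.map (fun g => f * g)) (W.map (fun p => (f * p.1, f * p.2))) = dbl f * bezE R W := by
  simp only [bezE]
  have h1 : ((R.map (fun g => f * g)).map dbl).sum = dbl f * (R.map dbl).sum := by
    induction R with
    | nil => simp
    | cons r R ih => simp only [List.map_cons, List.sum_cons, ih, dbl_mul]; ring
  have h2 : ((W.map (fun p => (f * p.1, f * p.2))).map (fun p => dbl p.1 - dbl p.2)).sum =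
      dbl f * (W.map (fun p => dbl p.1 - dbl p.2)).sum := by
    clear h1
    induction W with
    | nil => simp
    | cons r R ih => simp only [List.map_cons, List.sum_cons, ih, dbl_mul]; ring
  rw [h1, h2]; ring

theorem bezD_facProd {K : Type*} [Field K] (c : K) (s : List K) (t : List (K × K)) :
    ∃ (R : List K[X]) (W : List (K[X] × K[X])), R.length = s.length ∧ W.length = t.length ∧
      bezD (facProd c s t) = (Polynomial.X - Polynomial.C Polynomial.X) * bezE R W := by
  induction s with
  | nil =>
    induction t with
    | nil => exact ⟨[], [], rfl, rfl, by simp [facProd, bezD, bezE]⟩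
    | cons p t ih =>
      obtain ⟨R, W, h1, h2, h3⟩ := ih
      have e : facProd c [] (p :: t) =
          ((Polynomial.X - Polynomial.C p.1) ^ 2 + Polynomial.C p.2 ^ 2) * facProd c [] t := by
        simp only [facProd, List.map_cons, List.prod_cons]; ring
      refine ⟨R.map (fun g => ((Polynomial.X - Polynomial.C p.1) ^ 2 + Polynomial.C p.2 ^ 2) * g),
        ((Polynomial.X - Polynomial.C p.1) * facProd c [] t,
        Polynomial.C p.2 * facProd c [] t) :: W.map
          (fun q => (((Polynomial.X - Polynomial.C p.1) ^ 2 + Polynomial.C p.2 ^ 2) * q.1,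
          ((Polynomial.X - Polynomial.C p.1) ^ 2 + Polynomial.C p.2 ^ 2) * q.2)), ?_, ?_, ?_⟩
      · simpa using h1
      · simpa using h2
      · have e2 : ∀ (a b : K[X]) (R : List K[X]) W, bezE R ((a, b) :: W) = bezE R W + 2 * (dbl a - dbl b) := by
          intros; simp only [bezE, List.map_cons, List.sum_cons]; ring
        rw [e, bezD_mul, h3, e2, bezE_mul, dbl_mul (Polynomial.X - _), dbl_mul (Polynomial.C _)]
        have e3 : bezD ((Polynomial.X - Polynomial.C p.1) ^ 2 + Polynomial.C p.2 ^ 2) =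
          (Polynomial.X - Polynomial.C Polynomial.X) * (2 * (dbl (Polynomial.X - Polynomial.C p.1)
            - dbl (Polynomial.C p.2))) := by
          have hder : Polynomial.derivative ((Polynomial.X - Polynomial.C p.1) ^ 2 +
              Polynomial.C p.2 ^ 2) = 2 * (Polynomial.X - Polynomial.C p.1) := by
            rw [← Polynomial.C_pow, Polynomial.derivative_add, Polynomial.derivative_C, sq,
              Polynomial.derivative_mul, Polynomial.derivative_sub, Polynomial.derivative_X,
              Polynomial.derivative_C]
            ring
          simp only [bezD, dbl, hder, Polynomial.map_mul, Polynomial.map_sub, Polynomial.map_add,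
            Polynomial.map_pow, Polynomial.map_X, Polynomial.map_C, Polynomial.C_mul,
            Polynomial.C_sub, Polynomial.C_add, Polynomial.C_pow, map_ofNat, Polynomial.map_ofNat]
          ring
        rw [e3]
        ring
  | cons r s ih =>
    obtain ⟨R, W, h1, h2, h3⟩ := ih
    have e : facProd c (r :: s) t = (Polynomial.X - Polynomial.C r) * facProd c s t := by
      simp only [facProd, List.map_cons, List.prod_cons]; ring
    refine ⟨facProd c s t :: R.map (fun g => (Polynomial.X - Polynomial.C r) * g), W.map
      (fun p => ((Polynomial.X - Polynomial.C r) * p.1, (Polynomial.X - Polynomial.C r) * p.2)),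
      ?_, ?_, ?_⟩
    · simpa using h1
    · simpa using h2
    · have e2 : ∀ (a : K[X]) (R : List K[X]) W, bezE (a :: R) W = bezE R W + dbl a := by
        intros; simp only [bezE, List.map_cons, List.sum_cons]; ring
      rw [e, bezD_mul, h3, e2, bezE_mul]
      have e3 : bezD (Polynomial.X - Polynomial.C r) =
          (Polynomial.X - Polynomial.C Polynomial.X) := by
        simp [bezD]
      rw [e3]; ring

end bez
end OneReg


namespace OneReg
open scoped Polynomial

section
variable {A : Type*} [CommRing A]

/-- coefficient matrix of a bivariate polynomial -/
noncomputable def bezMat (N : ℕ) (B : A[X][X]) : Matrix (Fin N) (Fin N) A :=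
  Matrix.of fun i j => (B.coeff i).coeff j

theorem coeff_swap (p : A[X][X]) (i j : ℕ) :
    ((Polynomial.Bivariate.swap p).coeff i).coeff j = (p.coeff j).coeff i := by
  induction p using Polynomial.induction_on' with
  | add p q h1 h2 => simp only [map_add, Polynomial.coeff_add, h1, h2]
  | monomial n a =>
    induction a using Polynomial.induction_on' with
    | add p q h1 h2 => simp only [map_add, Polynomial.coeff_add, h1, h2]
    | monomial m a =>
      rw [Polynomial.Bivariate.swap_monomial_monomial]
      simp only [Polynomial.coeff_monomial]
      split_ifs <;> simp_all [Polynomial.coeff_monomial]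

theorem bez_symm (Q : A[X]) (B : A[X][X])
    (h : bezD Q = (Polynomial.X - Polynomial.C Polynomial.X) * B) (i j : ℕ) :
    (B.coeff i).coeff j = (B.coeff j).coeff i := by
  have h1 := congrArg Polynomial.Bivariate.swap h
  have e : Polynomial.Bivariate.swap B = B := by
    have hm : (Polynomial.X - Polynomial.C Polynomial.X : A[X][X]).Monic :=
      Polynomial.monic_X_sub_C _
    have h2 : (Polynomial.X - Polynomial.C Polynomial.X : A[X][X]) *
        (Polynomial.Bivariate.swap B - B) = 0 := by
      simp only [bezD, map_sub, map_mul, Polynomial.Bivariate.swap_C,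
        Polynomial.Bivariate.swap_map_C, Polynomial.Bivariate.swap_Y, Polynomial.map_X] at h1
      rw [mul_sub, ← h, bezD]
      linear_combination h1
    rw [hm.mul_right_eq_zero_iff] at h2
    exact sub_eq_zero.1 h2
  rw [← coeff_swap, e]

theorem bez_coeff_zero [Nontrivial A] (Q : A[X]) (B : A[X][X]) (N : ℕ) (hN : Q.natDegree ≤ N)
    (h : bezD Q = (Polynomial.X - Polynomial.C Polynomial.X) * B) (i : ℕ) (hi : N ≤ i) :
    B.coeff i = 0 := by
  by_cases hB : B = 0
  · simp [hB]
  have hm : (Polynomial.X - Polynomial.C Polynomial.X : A[X][X]).Monic :=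
    Polynomial.monic_X_sub_C _
  have h1 := hm.natDegree_mul' hB
  rw [← h, Polynomial.natDegree_X_sub_C] at h1
  have h2 : (bezD Q).natDegree ≤ N := by
    refine (Polynomial.natDegree_sub_le _ _).trans (max_le ?_ ?_)
    · refine (Polynomial.natDegree_mul_C_le _ _).trans (Polynomial.natDegree_map_le.trans hN)
    · refine (Polynomial.natDegree_C_mul_le _ _).trans (Polynomial.natDegree_map_le.trans ?_)
      exact (Polynomial.natDegree_derivative_le Q).trans (by omega)
  exact Polynomial.coeff_eq_zero_of_natDegree_lt (by omega)

theorem bezMat_map {K : Type*} [CommRing K] (φ : A →+* K) (N : ℕ) (B : A[X][X]) :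
    (bezMat N B).map φ = bezMat N (B.map (Polynomial.mapRingHom φ)) := by
  ext i j
  simp [bezMat]

theorem bezD_map {K : Type*} [CommRing K] (φ : A →+* K) (Q : A[X]) (B : A[X][X])
    (h : bezD Q = (Polynomial.X - Polynomial.C Polynomial.X) * B) :
    bezD (Q.map φ) = (Polynomial.X - Polynomial.C Polynomial.X) *
      B.map (Polynomial.mapRingHom φ) := by
  have h1 := congrArg (Polynomial.map (Polynomial.mapRingHom φ)) h
  have e : ∀ g : A[X], (g.map Polynomial.C).map (Polynomial.mapRingHom φ) =
      (g.map φ).map Polynomial.C := by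
    intro g
    rw [Polynomial.map_map, Polynomial.map_map]
    congr 1
    ext; simp
  simp only [bezD, Polynomial.map_sub, Polynomial.map_mul, Polynomial.map_C, e,
    Polynomial.coe_mapRingHom, Polynomial.map_X] at h1
  rw [← h1, bezD, Polynomial.derivative_map]

/-- the functional attached to a vector -/
noncomputable def fnl {N : ℕ} (l : Fin N → A) (g : A[X]) : A := ∑ j : Fin N, g.coeff j * l j

theorem qf_dbl {N : ℕ} (l : Fin N → A) (g : A[X]) :
    l ⬝ᵥ (bezMat N (dbl g)).mulVec l = fnl l g ^ 2 := by
  have : ∀ i j : Fin N, (bezMat N (dbl g)) i j = g.coeff i * g.coeff j := by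
    intro i j
    simp [bezMat, dbl, Polynomial.coeff_mul_C, Polynomial.coeff_map]
  simp only [dotProduct, Matrix.mulVec, this, fnl, sq, Finset.sum_mul, Finset.mul_sum]
  refine Finset.sum_congr rfl fun i _ => Finset.sum_congr rfl fun j _ => by ring

theorem qf_add {N : ℕ} (l : Fin N → A) (B C : A[X][X]) :
    l ⬝ᵥ (bezMat N (B + C)).mulVec l =
      l ⬝ᵥ (bezMat N B).mulVec l + l ⬝ᵥ (bezMat N C).mulVec l := by
  have : bezMat N (B + C) = bezMat N B + bezMat N C := by ext; simp [bezMat]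
  rw [this, Matrix.add_mulVec, dotProduct_add]

theorem qf_sub {N : ℕ} (l : Fin N → A) (B C : A[X][X]) :
    l ⬝ᵥ (bezMat N (B - C)).mulVec l =
      l ⬝ᵥ (bezMat N B).mulVec l - l ⬝ᵥ (bezMat N C).mulVec l := by
  have : bezMat N (B - C) = bezMat N B - bezMat N C := by ext; simp [bezMat]
  rw [this, Matrix.sub_mulVec, dotProduct_sub]

theorem qf_bezE {N : ℕ} (l : Fin N → A) (R : List A[X]) (W : List (A[X] × A[X])) :
    l ⬝ᵥ (bezMat N (bezE R W)).mulVec l = (R.map (fun g => fnl l g ^ 2)).sum +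
      2 * (W.map (fun p => fnl l p.1 ^ 2 - fnl l p.2 ^ 2)).sum := by
  have h0 : l ⬝ᵥ (bezMat N (0 : A[X][X])).mulVec l = 0 := by
    have : bezMat N (0 : A[X][X]) = 0 := by ext; simp [bezMat]
    rw [this]; simp
  have h1 : l ⬝ᵥ (bezMat N (R.map dbl).sum).mulVec l = (R.map (fun g => fnl l g ^ 2)).sum := by
    induction R with
    | nil => simpa using h0
    | cons r R ih => simp only [List.map_cons, List.sum_cons, qf_add, ih, qf_dbl]
  have h2 : l ⬝ᵥ (bezMat N (W.map (fun p => dbl p.1 - dbl p.2)).sum).mulVec l =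
      (W.map (fun p => fnl l p.1 ^ 2 - fnl l p.2 ^ 2)).sum := by
    clear h1
    induction W with
    | nil => simpa using h0
    | cons r R ih => simp only [List.map_cons, List.sum_cons, qf_add, qf_sub, ih, qf_dbl]
  rw [bezE, two_mul, qf_add, qf_add, h1, h2]
  ring

end

/-- coprimality implies nondegeneracy of the Bezoutian -/
theorem bez_nondeg {K : Type*} [Field K] (Q : K[X]) (hQ0 : Q ≠ 0) (B : K[X][X])
    (h : bezD Q = (Polynomial.X - Polynomial.C Polynomial.X) * B)
    (hc : IsCoprime Q (Polynomial.derivative Q)) :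
    (bezMat Q.natDegree B).det ≠ 0 := by
  intro hdet
  set N := Q.natDegree with hN
  obtain ⟨l, hl0, hl⟩ := Matrix.exists_mulVec_eq_zero_iff.2 hdet
  set q := Q * Polynomial.C Q.leadingCoeff⁻¹ with hq
  have hlc : Q.leadingCoeff ≠ 0 := Polynomial.leadingCoeff_ne_zero.2 hQ0
  have hqm : q.Monic := Polynomial.monic_mul_leadingCoeff_inv hQ0
  have hqd : q.degree = N := by
    rw [hq, Polynomial.degree_mul_leadingCoeff_inv _ hQ0, Polynomial.degree_eq_natDegree hQ0]
  -- the functional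
  let ev : K[X] →ₗ[K] K :=
    { toFun := fun g => fnl l g
      map_add' := fun g h => by simp [fnl, add_mul, Finset.sum_add_distrib]
      map_smul' := fun c g => by simp [fnl, Finset.mul_sum, mul_assoc] }
  let L : K[X] →ₗ[K] K := ev.comp (Polynomial.modByMonicHom q)
  have hLlow : ∀ g : K[X], g.degree < N → L g = fnl l g := by
    intro g hg
    change fnl l (g %ₘ q) = _
    rw [(Polynomial.modByMonic_eq_self_iff hqm).2 (by rw [hqd]; exact hg)]
  have hLQ : ∀ g : K[X], L (g * Q) = 0 := by
    intro g
    change fnl l ((g * Q) %ₘ q) = _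
    have : q ∣ g * Q := by
      refine ⟨g * Polynomial.C Q.leadingCoeff, ?_⟩
      have e : Polynomial.C Q.leadingCoeff⁻¹ * Polynomial.C Q.leadingCoeff = (1 : K[X]) := by
        rw [← Polynomial.C_mul, inv_mul_cancel₀ hlc, Polynomial.C_1]
      rw [hq]
      linear_combination (-g * Q) * e
    rw [(Polynomial.modByMonic_eq_zero_iff_dvd hqm).2 this]
    simp [fnl]
  have hBdeg : ∀ i, (B.coeff i).degree < N := by
    intro i
    rw [Polynomial.degree_lt_iff_coeff_zero]
    intro m hm
    rw [bez_symm Q B h, bez_coeff_zero Q B N le_rfl h m hm, Polynomial.coeff_zero]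
  have hLB : ∀ i, L (B.coeff i) = 0 := by
    intro i
    by_cases hi : i < N
    · rw [hLlow _ (hBdeg i)]
      have := congrFun hl ⟨i, hi⟩
      simpa [Matrix.mulVec, dotProduct, bezMat, fnl] using this
    · rw [bez_coeff_zero Q B N le_rfl h i (by omega), map_zero]
  have hcoef : ∀ i, (if i = 0 then 0 else B.coeff (i - 1)) - Polynomial.X * B.coeff i =
      Polynomial.C (Q.coeff i) * Polynomial.derivative Q -
        Q * Polynomial.C ((Polynomial.derivative Q).coeff i) := by
    intro i
    have h1 := congrArg (fun p => Polynomial.coeff p i) h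
    simp only [bezD, sub_mul, Polynomial.coeff_sub, Polynomial.coeff_mul_C,
      Polynomial.coeff_C_mul, Polynomial.coeff_map] at h1
    rw [h1]
    congr 1
    rcases i with _ | i
    · simp
    · simp
  have key : ∀ g : K[X], (∀ i, L (g * B.coeff i) = 0) →
      L (g * Polynomial.derivative Q) = 0 ∧ ∀ i, L ((g * Polynomial.X) * B.coeff i) = 0 := by
    intro g hg
    have h1 : ∀ i, - L ((g * Polynomial.X) * B.coeff i) =
        Q.coeff i * L (g * Polynomial.derivative Q) := by
      intro i
      have e := congrArg (fun p => L (g * p)) (hcoef i)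
      simp only [mul_sub, map_sub] at e
      have e1 : L (g * (if i = 0 then 0 else B.coeff (i - 1))) = 0 := by
        split_ifs
        · simp
        · exact hg _
      have e2 : L (g * (Q * Polynomial.C ((Polynomial.derivative Q).coeff i))) = 0 := by
        have := hLQ (g * Polynomial.C ((Polynomial.derivative Q).coeff i))
        rw [← this]; congr 1; ring
      have e3 : L (g * (Polynomial.C (Q.coeff i) * Polynomial.derivative Q)) =
          Q.coeff i * L (g * Polynomial.derivative Q) := by
        rw [mul_left_comm, ← Polynomial.smul_eq_C_mul, map_smul, smul_eq_mul]
      rw [e1, e2, e3, zero_sub, sub_zero] at e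
      rw [← e, mul_assoc]
    have h2 : L (g * Polynomial.derivative Q) = 0 := by
      have := h1 N
      rw [bez_coeff_zero Q B N le_rfl h N le_rfl, mul_zero, map_zero, neg_zero] at this
      exact (mul_eq_zero.1 this.symm).resolve_left hlc
    refine ⟨h2, fun i => ?_⟩
    have := h1 i
    rw [h2, mul_zero, neg_eq_zero] at this
    exact this
  have hpow : ∀ n i, L (Polynomial.X ^ n * B.coeff i) = 0 := by
    intro n
    induction n with
    | zero => simpa using hLB
    | succ n ih => simpa [pow_succ] using (key _ ih).2
  have hder : ∀ g : K[X], L (g * Polynomial.derivative Q) = 0 := by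
    intro g
    induction g using Polynomial.induction_on' with
    | add p q h1 h2 => rw [add_mul, map_add, h1, h2, add_zero]
    | monomial n a =>
      rw [← Polynomial.C_mul_X_pow_eq_monomial, mul_assoc, ← Polynomial.smul_eq_C_mul, map_smul,
        (key _ (hpow n)).1, smul_zero]
  have hL0 : ∀ g : K[X], L g = 0 := by
    intro g
    obtain ⟨u, v, huv⟩ := hc
    have : g = g * u * Q + g * v * Polynomial.derivative Q := by linear_combination (-g) * huv
    rw [this, map_add, hLQ, hder, add_zero]
  apply hl0
  ext j
  have := hL0 (Polynomial.X ^ (j : ℕ))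
  rw [hLlow _ (by rw [Polynomial.degree_X_pow]; exact_mod_cast j.2)] at this
  simpa [fnl, Polynomial.coeff_X_pow, Fin.val_inj] using this

theorem card_le_of_fnl {K : Type*} [Field K] [LinearOrder K] [IsStrictOrderedRing K] {N : ℕ}
    (c : Fin N → K) (F : List ((Fin N → K) →ₗ[K] K))
    (h : ∀ v : Fin N → K, (∀ f ∈ F, f v = 0) → 0 ≤ ∑ i, c i * v i ^ 2) :
    (Finset.univ.filter (fun i => c i < 0)).card ≤ F.length := by
  by_contra hlt
  push Not at hlt
  set S := Finset.univ.filter (fun i => c i < 0) with hS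
  let ext : (S → K) →ₗ[K] (Fin N → K) := Function.ExtendByZero.linearMap K Subtype.val
  let G : (S → K) →ₗ[K] (Fin F.length → K) :=
    (LinearMap.pi (fun k : Fin F.length => F.get k)).comp ext
  have hker : LinearMap.ker G ≠ ⊥ := LinearMap.ker_ne_bot_of_finrank_lt (by simpa using hlt)
  obtain ⟨w, hw, hw0⟩ := Submodule.exists_mem_ne_zero_of_ne_bot hker
  have hv : ∀ f ∈ F, f (ext w) = 0 := by
    intro f hf
    obtain ⟨k, rfl⟩ := List.get_of_mem hf
    exact congrFun hw k
  have h1 := h _ hv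
  have hin : ∀ i : S, ext w i = w i := by
    intro i
    exact Subtype.val_injective.extend_apply w (0 : Fin N → K) i
  have hout : ∀ i, i ∉ S → ext w i = 0 := by
    intro i hi
    refine Function.extend_apply' w (0 : Fin N → K) i ?_
    rintro ⟨a, rfl⟩
    exact hi a.2
  have h2 : ∑ i, c i * ext w i ^ 2 = ∑ i : S, c i * w i ^ 2 := by
    rw [← Finset.sum_subset (Finset.subset_univ S) (fun i _ hi => by rw [hout i hi]; simp),
      ← Finset.sum_coe_sort]
    exact Finset.sum_congr rfl fun i _ => by rw [hin]
  rw [h2] at h1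
  obtain ⟨i, hi⟩ := Function.ne_iff.1 hw0
  have hneg : ∀ j : S, c j < 0 := fun j => (Finset.mem_filter.1 j.2).2
  have : ∑ i : S, c i * w i ^ 2 < 0 := by
    apply Finset.sum_neg' (fun j _ => mul_nonpos_of_nonpos_of_nonneg (hneg j).le (sq_nonneg _))
    exact ⟨i, Finset.mem_univ _, mul_neg_of_neg_of_pos (hneg i) (by
      have : w i ≠ 0 := hi
      positivity)⟩
  linarith

theorem list_sum_nonpos {K : Type*} [Field K] [LinearOrder K] [IsStrictOrderedRing K]
    (l : List K) (h : ∀ x ∈ l, x ≤ 0) : l.sum ≤ 0 := by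
  induction l with
  | nil => simp
  | cons a l ih =>
    rw [List.sum_cons]
    have h1 := h a List.mem_cons_self
    have h2 := ih (fun x hx => h x (List.mem_cons_of_mem _ hx))
    linarith

theorem bez_count {K : Type*} [Field K] [LinearOrder K] [IsStrictOrderedRing K] {N : ℕ}
    (c0 : K) (s : List K) (t : List (K × K)) (B : K[X][X])
    (h : bezD (facProd c0 s t) = (Polynomial.X - Polynomial.C Polynomial.X) * B)
    (V : Matrix (Fin N) (Fin N) K) (c : Fin N → K)
    (hV : V.transpose * bezMat N B * V = Matrix.diagonal c) :
    (Finset.univ.filter (fun i => c i < 0)).card ≤ t.length ∧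
    (Finset.univ.filter (fun i => 0 < c i)).card ≤ s.length + t.length := by
  obtain ⟨R, W, hR, hW, hE⟩ := bezD_facProd c0 s t
  have hB : B = bezE R W := by
    have hm : (Polynomial.X - Polynomial.C Polynomial.X : K[X][X]) ≠ 0 :=
      (Polynomial.monic_X_sub_C _).ne_zero
    exact mul_left_cancel₀ hm (h.symm.trans hE)
  have hq : ∀ v : Fin N → K, ∑ i, c i * v i ^ 2 =
      (R.map (fun g => fnl (V.mulVec v) g ^ 2)).sum +
      2 * (W.map (fun p => fnl (V.mulVec v) p.1 ^ 2 - fnl (V.mulVec v) p.2 ^ 2)).sum := by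
    intro v
    rw [← qf_bezE, ← hB]
    have h1 : v ⬝ᵥ (Matrix.diagonal c).mulVec v = ∑ i, c i * v i ^ 2 := by
      simp only [dotProduct, Matrix.mulVec_diagonal]
      exact Finset.sum_congr rfl fun i _ => by ring
    rw [← h1, ← hV, ← Matrix.mulVec_mulVec, ← Matrix.mulVec_mulVec, Matrix.dotProduct_mulVec,
      Matrix.vecMul_transpose]
  let ev : K[X] → ((Fin N → K) →ₗ[K] K) := fun g =>
    { toFun := fun v => fnl (V.mulVec v) g
      map_add' := fun v w => by simp [fnl, Matrix.mulVec_add, mul_add, Finset.sum_add_distrib]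
      map_smul' := fun a v => by
        simp only [fnl, Matrix.mulVec_smul, Finset.mul_sum, Pi.smul_apply, smul_eq_mul,
          RingHom.id_apply]
        exact Finset.sum_congr rfl fun i _ => by ring }
  constructor
  · have := card_le_of_fnl c (W.map (fun p => ev p.2)) (by
      intro v hv
      rw [hq v]
      apply add_nonneg
      · exact List.sum_nonneg (by simp only [List.mem_map]; rintro x ⟨g, -, rfl⟩; positivity)
      · refine mul_nonneg (by norm_num) (List.sum_nonneg ?_)
        simp only [List.mem_map]
        rintro x ⟨p, hp, rfl⟩
        have h1 : fnl (V.mulVec v) p.2 = 0 := hv _ (List.mem_map.2 ⟨p, hp, rfl⟩)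
        rw [h1]
        nlinarith [sq_nonneg (fnl (V.mulVec v) p.1)])
    simpa [hW] using this
  · have := card_le_of_fnl (fun i => - c i) (R.map ev ++ W.map (fun p => ev p.1)) (by
      intro v hv
      simp only [neg_mul, Finset.sum_neg_distrib]
      rw [hq v]
      have h1 : (R.map (fun g => fnl (V.mulVec v) g ^ 2)).sum ≤ 0 := by
        apply list_sum_nonpos
        simp only [List.mem_map]
        rintro x ⟨g, hg, rfl⟩
        have h1 : fnl (V.mulVec v) g = 0 :=
          hv _ (List.mem_append_left _ (List.mem_map.2 ⟨g, hg, rfl⟩))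
        rw [h1]; simp
      have h2 : (W.map (fun p => fnl (V.mulVec v) p.1 ^ 2 - fnl (V.mulVec v) p.2 ^ 2)).sum ≤ 0 := by
        apply list_sum_nonpos
        simp only [List.mem_map]
        rintro x ⟨p, hp, rfl⟩
        have h1 : fnl (V.mulVec v) p.1 = 0 :=
          hv _ (List.mem_append_right _ (List.mem_map.2 ⟨p, hp, rfl⟩))
        rw [h1]
        nlinarith [sq_nonneg (fnl (V.mulVec v) p.2)]
      linarith)
    simpa [hW, hR] using this

theorem diag_exists {A : Type*} [CommRing A] [IsDomain A] [CharZero A] {N : ℕ}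
    (b : Matrix (Fin N) (Fin N) A) (hb : ∀ i j, b i j = b j i) :
    ∃ (V : Matrix (Fin N) (Fin N) A) (c : Fin N → A), V.det ≠ 0 ∧
      V.transpose * b * V = Matrix.diagonal c := by
  classical
  let F := FractionRing A
  haveI : CharZero F := charZero_of_injective_algebraMap (IsFractionRing.injective A F)
  haveI : Invertible (2 : F) := invertibleOfNonzero two_ne_zero
  let ι := algebraMap A F
  have hι : Function.Injective ι := IsFractionRing.injective A F
  let bf : LinearMap.BilinForm F (Fin N → F) := Matrix.toBilin' (b.map ι)
  obtain ⟨v, hv⟩ := LinearMap.BilinForm.exists_orthogonal_basis (B := bf) (by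
    constructor
    intro x y
    simp only [bf, Matrix.toBilin'_apply, RingHom.id_apply]
    rw [Finset.sum_comm]
    refine Finset.sum_congr rfl fun i _ => Finset.sum_congr rfl fun j _ => ?_
    simp only [Matrix.map_apply, hb i j]
    ring)
  have hfr : Module.finrank F (Fin N → F) = N := by simp
  let w := v.reindex (finCongr hfr)
  have hw : ∀ i j, i ≠ j → bf (w i) (w j) = 0 := by
    intro i j hij
    simp only [w, Module.Basis.reindex_apply]
    exact hv (fun h => hij ((finCongr hfr).symm.injective h))
  obtain ⟨d, hd⟩ := IsLocalization.exist_integer_multiples (nonZeroDivisors A)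
    (Finset.univ : Finset (Fin N × Fin N)) (fun p => w p.2 p.1)
  have hd' : ∀ i j, ∃ a : A, ι a = ι (d : A) * w j i := by
    intro i j
    obtain ⟨a, ha⟩ := hd (i, j) (Finset.mem_univ _)
    refine ⟨a, ?_⟩
    rw [ha, Algebra.smul_def]
  choose V hV using hd'
  have hd0 : ι (d : A) ≠ 0 := by
    rw [Ne, map_eq_zero_iff _ hι]
    exact nonZeroDivisors.coe_ne_zero d
  have hmat : (Matrix.of V).map ι = ι (d : A) • ((Pi.basisFun F (Fin N)).toMatrix w) := by
    ext i j
    simp [hV, Module.Basis.toMatrix_apply]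
  have hdet : (Matrix.of V).det ≠ 0 := by
    intro h
    have h1 := congrArg ι h
    rw [RingHom.map_det, map_zero, RingHom.mapMatrix_apply, hmat, Matrix.det_smul, mul_eq_zero] at h1
    rcases h1 with h1 | h1
    · exact pow_ne_zero _ hd0 h1
    · have := (Pi.basisFun F (Fin N)).isUnit_det w
      rw [Module.Basis.det_apply, h1] at this
      simp at this
  refine ⟨Matrix.of V, fun i => ((Matrix.of V).transpose * b * Matrix.of V) i i, hdet, ?_⟩
  ext i j
  by_cases hij : i = j
  · subst hij; simp
  rw [Matrix.diagonal_apply_ne _ hij]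
  apply hι
  have h1 := hw i j hij
  simp only [bf, Matrix.toBilin'_apply] at h1
  rw [map_zero]
  simp only [Matrix.mul_apply, map_sum, map_mul, Matrix.transpose_apply, Matrix.of_apply, hV, Finset.sum_mul]
  rw [Finset.sum_comm]
  have : ∀ x y, ι (d : A) * w i x * ι (b x y) * (ι (d : A) * w j y) =
    ι (d : A) ^ 2 * (w i x * (b.map ι) x y * w j y) := by
    intro x y; simp only [Matrix.map_apply]; ring
  simp only [this, ← Finset.mul_sum]
  rw [h1, mul_zero]

end OneReg


namespace OneReg
open scoped Polynomial

theorem facProd_leadingCoeff {K : Type*} [Field K] (c : K) (s : List K)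
    (t : List (K × K)) : (facProd c s t).leadingCoeff = c := by
  have h1 : (s.map (fun r => Polynomial.X - Polynomial.C r)).prod.Monic := by
    induction s with
    | nil => simp
    | cons r s ih =>
      simp only [List.map_cons, List.prod_cons]
      exact (Polynomial.monic_X_sub_C r).mul ih
  have h2 : (t.map (fun p : K × K => (Polynomial.X - Polynomial.C p.1) ^ 2 +
      Polynomial.C p.2 ^ 2)).prod.Monic := by
    induction t with
    | nil => simp
    | cons p t ih =>
      simp only [List.map_cons, List.prod_cons]
      refine Polynomial.Monic.mul ?_ ih
      rw [← Polynomial.C_pow]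
      refine Polynomial.Monic.add_of_left ((Polynomial.monic_X_sub_C p.1).pow 2) ?_
      refine lt_of_le_of_lt Polynomial.degree_C_le ?_
      simp [Polynomial.degree_pow]
  rw [facProd, Polynomial.leadingCoeff_mul_monic h2, Polynomial.leadingCoeff_mul_monic h1]
  simp

theorem facProd_eval {K : Type*} [Field K] (c : K) (s : List K)
    (t : List (K × K)) (y : K) : (facProd c s t).eval y = c * (s.map (fun r => y - r)).prod *
      (t.map (fun p => (y - p.1) ^ 2 + p.2 ^ 2)).prod := by
  simp only [facProd, Polynomial.eval_mul, Polynomial.eval_C, Polynomial.eval_list_prod,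
    List.map_map]
  congr 2
  · congr 2; ext; simp
  · congr 1; ext; simp

theorem quad_prod_pos {K : Type*} [Field K] [LinearOrder K] [IsStrictOrderedRing K]
    (t : List (K × K)) (ht : ∀ p ∈ t, p.2 ≠ 0) (y : K) :
    0 < (t.map (fun p => (y - p.1) ^ 2 + p.2 ^ 2)).prod := by
  apply List.prod_pos
  intro a ha
  obtain ⟨p, hp, rfl⟩ := List.mem_map.1 ha
  have := ht p hp
  positivity

theorem real_hom_mono {M : Type*} [Field M] [LinearOrder M] [IsStrictOrderedRing M]
    (φ : ℝ →+* M) {x y : ℝ} (h : x < y) : φ x < φ y := by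
  have h1 : y - x = √(y - x) ^ 2 := (Real.sq_sqrt (by linarith)).symm
  have h2 : φ y - φ x = φ (√(y - x)) ^ 2 := by rw [← map_pow, ← h1, map_sub]
  have h3 : φ y ≠ φ x := fun h' => h.ne' (φ.injective h')
  have h4 : 0 < φ y - φ x := lt_of_le_of_ne (h2 ▸ sq_nonneg _) (Ne.symm (sub_ne_zero.2 h3))
  linarith

theorem sign_transfer {M : Type*} [Field M] [LinearOrder M] [IsStrictOrderedRing M]
    (φ : ℝ[X] →+* M) (hφ : Function.Injective φ) (D : ℝ[X]) (hD : D ≠ 0) :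
    ∃ a : ℝ, ∀ c, c ∣ D → (0 < c.eval a ∧ 0 < φ c) ∨ (c.eval a < 0 ∧ φ c < 0) := by
  classical
  set x := φ Polynomial.X with hx
  let ι : ℝ →+* M := φ.comp Polynomial.C
  have hι : ∀ r, φ (Polynomial.C r) = ι r := fun r => rfl
  have hne : ∀ r, x ≠ ι r := by
    intro r h
    have := hφ h
    exact Polynomial.X_ne_C r this
  obtain ⟨a, ha1, ha2⟩ := Order.exists_between_finsets
    (D.roots.toFinset.filter (fun r => ι r < x)) (D.roots.toFinset.filter (fun r => x < ι r))
    (by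
      intro u hu v hv
      simp only [Finset.mem_filter] at hu hv
      by_contra h
      rcases eq_or_lt_of_le (not_lt.1 h) with h | h
      · rw [h] at hv
        exact lt_asymm hu.2 hv.2
      · have := real_hom_mono ι h
        exact lt_asymm (lt_trans hu.2 hv.2) this)
  refine ⟨a, fun c hc => ?_⟩
  have hc0 : c ≠ 0 := fun h => hD (by rw [h] at hc; exact zero_dvd_iff.1 hc)
  obtain ⟨k, s, t, hk, ht, rfl⟩ := fac_exists rc_real c hc0
  have hs : ∀ r ∈ s, r ∈ D.roots := by
    intro r hr
    rw [Polynomial.mem_roots hD]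
    refine Polynomial.IsRoot.dvd ?_ hc
    rw [Polynomial.IsRoot, facProd_eval]
    have : (s.map (fun r' => r - r')).prod = 0 := List.prod_eq_zero (List.mem_map.2 ⟨r, hr, by simp⟩)
    rw [this]; simp
  let S : ℝ → M → Prop := fun u v => (0 < u ∧ 0 < v) ∨ (u < 0 ∧ v < 0)
  have Smul : ∀ {u v u' v'}, S u v → S u' v' → S (u * u') (v * v') := by
    intro u v u' v' h h'
    rcases h with ⟨h1, h2⟩ | ⟨h1, h2⟩ <;> rcases h' with ⟨h3, h4⟩ | ⟨h3, h4⟩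
    · exact Or.inl ⟨mul_pos h1 h3, mul_pos h2 h4⟩
    · exact Or.inr ⟨mul_neg_of_pos_of_neg h1 h3, mul_neg_of_pos_of_neg h2 h4⟩
    · exact Or.inr ⟨mul_neg_of_neg_of_pos h1 h3, mul_neg_of_neg_of_pos h2 h4⟩
    · exact Or.inl ⟨mul_pos_of_neg_of_neg h1 h3, mul_pos_of_neg_of_neg h2 h4⟩
  have e1 : φ (facProd k s t) = ι k * (s.map (fun r => x - ι r)).prod *
      (t.map (fun p => (x - ι p.1) ^ 2 + ι p.2 ^ 2)).prod := by
    simp only [facProd, map_mul, map_list_prod, List.map_map, hι]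
    congr 2
    · congr 2; ext; simp [hι, hx]
    · congr 1; ext; simp [hι, hx]
  change S _ _
  rw [e1, facProd_eval]
  refine Smul (Smul ?_ ?_) (Or.inl ⟨quad_prod_pos t ht a, ?_⟩)
  · rcases lt_or_gt_of_ne hk with h | h
    · exact Or.inr ⟨h, by simpa using real_hom_mono ι h⟩
    · exact Or.inl ⟨h, by simpa using real_hom_mono ι h⟩
  · clear e1 hc hc0
    induction s with
    | nil => exact Or.inl ⟨by simp, by simp⟩
    | cons r s ih =>
      simp only [List.map_cons, List.prod_cons]
      refine Smul ?_ (ih (fun r' hr' => hs r' (List.mem_cons_of_mem _ hr')))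
      have hr := hs r List.mem_cons_self
      rcases lt_or_gt_of_ne (hne r) with h | h
      · refine Or.inr ⟨?_, sub_neg.2 h⟩
        have := ha2 r (by simp only [Finset.mem_filter, Multiset.mem_toFinset]; exact ⟨hr, h⟩)
        linarith
      · refine Or.inl ⟨?_, sub_pos.2 h⟩
        have := ha1 r (by simp only [Finset.mem_filter, Multiset.mem_toFinset]; exact ⟨hr, h⟩)
        linarith
  · have := quad_prod_pos (t.map (fun p => (ι p.1, ι p.2))) (by
      intro p hp
      obtain ⟨p', hp', rfl⟩ := List.mem_map.1 hp
      simpa using ht p' hp') x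
    simpa [List.map_map, Function.comp_def] using this

/-- density: removing zeros of a nonzero polynomial -/
theorem nonneg_of_sq_mul (g q : ℝ[X]) (hg : g ≠ 0) (h : ∀ b, 0 ≤ g.eval b ^ 2 * q.eval b) (b : ℝ) :
    0 ≤ q.eval b := by
  have hfin : {x | g.eval x = 0}.Finite := by
    have := g.roots.toFinset.finite_toSet
    refine this.subset ?_
    intro x hx
    simpa [hg] using hx
  have hd : Dense {x | g.eval x = 0}ᶜ := hfin.countable.dense_compl ℝ
  have hcl : IsClosed {x | 0 ≤ q.eval x} := isClosed_le continuous_const q.continuous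
  have : {x | g.eval x = 0}ᶜ ⊆ {x | 0 ≤ q.eval x} := by
    intro x hx
    have hx' : g.eval x ≠ 0 := hx
    have : 0 < g.eval x ^ 2 := by positivity
    exact nonneg_of_mul_nonneg_right (by simpa using h x) this
  have h2 := hd.closure_eq ▸ hcl.closure_subset_iff.2 this
  exact h2 (Set.mem_univ b)

end OneReg


namespace OneReg
open scoped Polynomial

theorem diag_map {A K : Type*} [CommRing A] [CommRing K] (φ : A →+* K) {N : ℕ}
    (V b : Matrix (Fin N) (Fin N) A) (c : Fin N → A)
    (h : V.transpose * b * V = Matrix.diagonal c) :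
    (V.map φ).transpose * b.map φ * V.map φ = Matrix.diagonal (fun i => φ (c i)) := by
  have := congrArg (fun m => m.map φ) h
  simp only [Matrix.map_mul, Matrix.diagonal_map (map_zero φ)] at this
  rw [← Matrix.transpose_map]
  exact this

theorem psi_eval {A M : Type*} [CommRing A] [CommRing M] (ψ : A[X] →+* M) (P : A[X]) :
    ψ P = (P.map (ψ.comp Polynomial.C)).eval (ψ Polynomial.X) := by
  rw [Polynomial.eval_map]
  have : ψ = Polynomial.eval₂RingHom (ψ.comp Polynomial.C) (ψ Polynomial.X) := by
    ext <;> simp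
  conv_lhs => rw [this]
  rfl

theorem artin_sqf {M : Type*} [Field M] [LinearOrder M] [IsStrictOrderedRing M] (hM : RC M)
    (ψ : ℝ[X][X] →+* M) (hψ : Function.Injective ψ) (P : ℝ[X][X]) (hP : P ≠ 0) (e : ℝ[X])
    (he : e ≠ 0) (hpos : ∀ a, e.eval a ≠ 0 → ∀ b, 0 ≤ Polynomial.evalEval a b P)
    (u v : ℝ[X][X]) (d : ℝ[X]) (hd : d ≠ 0)
    (hb : u * P + v * Polynomial.derivative P = Polynomial.C d) : 0 ≤ ψ P := by
  classical
  set N := P.natDegree with hN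
  obtain ⟨B, hB⟩ := bez_exists P
  obtain ⟨V, c, hV, hVc⟩ := diag_exists (bezMat N B) (fun i j => bez_symm P B hB i j)
  let alg := algebraMap ℝ[X] (FractionRing ℝ[X])
  have halg : Function.Injective alg := IsFractionRing.injective _ _
  have hdet : (bezMat N B).det ≠ 0 := by
    have h1 := bezD_map alg P B hB
    have hc : IsCoprime (P.map alg) (Polynomial.derivative (P.map alg)) := by
      refine ⟨Polynomial.C (alg d)⁻¹ * u.map alg, Polynomial.C (alg d)⁻¹ * v.map alg, ?_⟩
      have h2 := congrArg (Polynomial.map alg) hb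
      simp only [Polynomial.map_add, Polynomial.map_mul, Polynomial.map_C,
        ← Polynomial.derivative_map] at h2
      rw [mul_assoc, mul_assoc, ← mul_add, h2, ← Polynomial.C_mul, inv_mul_cancel₀, Polynomial.C_1]
      exact (map_ne_zero_iff _ halg).2 hd
    have h3 := bez_nondeg (P.map alg) ((Polynomial.map_ne_zero_iff halg).2 hP) _ h1 hc
    rw [Polynomial.natDegree_map_eq_of_injective halg, ← bezMat_map] at h3
    intro h4
    apply h3
    have := RingHom.map_det alg (bezMat N B)
    rw [h4, map_zero] at this
    exact this.symm
  have hprod : ∏ i, c i ≠ 0 := by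
    have := congrArg Matrix.det hVc
    rw [Matrix.det_mul, Matrix.det_mul, Matrix.det_transpose, Matrix.det_diagonal] at this
    rw [← this]
    exact mul_ne_zero (mul_ne_zero hV hdet) hV
  have hlc : P.leadingCoeff ≠ 0 := Polynomial.leadingCoeff_ne_zero.2 hP
  let φ := ψ.comp Polynomial.C
  have hφ : Function.Injective φ := hψ.comp Polynomial.C_injective
  obtain ⟨a, ha⟩ := sign_transfer φ hφ (e * d * P.leadingCoeff * ∏ i, c i)
    (mul_ne_zero (mul_ne_zero (mul_ne_zero he hd) hlc) hprod)
  have hne : ∀ k : ℝ[X], k ∣ (e * d * P.leadingCoeff * ∏ i, c i) → k.eval a ≠ 0 := by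
    intro k hk
    rcases ha k hk with h | h
    · exact h.1.ne'
    · exact h.1.ne
  have hea := hne e ⟨d * P.leadingCoeff * ∏ i, c i, by ring⟩
  have hda := hne d ⟨e * P.leadingCoeff * ∏ i, c i, by ring⟩
  have hla := ha P.leadingCoeff ⟨e * d * ∏ i, c i, by ring⟩
  have hla0 := hne P.leadingCoeff ⟨e * d * ∏ i, c i, by ring⟩
  have hca : ∀ i, _ := fun i => ha (c i) ((Finset.dvd_prod_of_mem c (Finset.mem_univ i)).mul_left _)
  have hposa := hpos a hea
  -- real side
  let ε := Polynomial.evalRingHom a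
  set Pa := P.map ε with hPa
  have hPaN : Pa.natDegree = N := Polynomial.natDegree_map_of_leadingCoeff_ne_zero _ hla0
  have hPalc : Pa.leadingCoeff = P.leadingCoeff.eval a :=
    Polynomial.leadingCoeff_map_of_leadingCoeff_ne_zero _ hla0
  have hPa0 : Pa ≠ 0 := by
    intro h
    rw [h, Polynomial.leadingCoeff_zero] at hPalc
    exact hla0 hPalc.symm
  have hPapos : ∀ b, 0 ≤ Pa.eval b := by
    intro b
    have := hposa b
    rwa [← Polynomial.map_evalRingHom_eval] at this
  have hPaz : ∀ b, Pa.eval b ≠ 0 := by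
    intro b hb0
    have h1 : IsLocalMin (fun x => Pa.eval x) b :=
      Filter.Eventually.of_forall (fun x => by simp only [hb0]; exact hPapos x)
    have h2 := h1.deriv_eq_zero
    rw [Polynomial.deriv] at h2
    have h3 := congrArg (fun q => (Polynomial.map ε q).eval b) hb
    simp only [Polynomial.map_add, Polynomial.map_mul, Polynomial.map_C,
      ← Polynomial.derivative_map, Polynomial.eval_add, Polynomial.eval_mul] at h3
    rw [← hPa, hb0, h2] at h3
    simp at h3
    exact hda h3.symm
  obtain ⟨c0, s, t, hc0, ht, hfac⟩ := fac_exists rc_real Pa hPa0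
  have hs : s = [] := by
    rcases s with _ | ⟨r, s⟩
    · rfl
    · exfalso
      apply hPaz r
      rw [hfac, facProd_eval]
      simp
  subst hs
  have hc0' : c0 = P.leadingCoeff.eval a := by
    rw [← hPalc, hfac, facProd_leadingCoeff]
  have hc0pos : 0 < c0 := by
    have h1 := hPapos 0
    rw [hfac, facProd_eval] at h1
    have h2 := quad_prod_pos t ht 0
    simp only [List.map_nil, List.prod_nil, mul_one] at h1
    exact lt_of_le_of_ne (nonneg_of_mul_nonneg_left h1 h2) hc0.symm
  have hNt : N = 2 * t.length := by
    rw [← hPaN, hfac, facProd_natDegree _ hc0]; simp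
  have hBa := bezD_map ε P B hB
  rw [← hPa, hfac] at hBa
  have hVa := diag_map ε V _ c hVc
  rw [bezMat_map] at hVa
  obtain ⟨hn1, hn2⟩ := bez_count c0 [] t _ hBa _ _ hVa
  -- M side
  have hPM0 : P.map φ ≠ 0 := (Polynomial.map_ne_zero_iff hφ).2 hP
  obtain ⟨c1, s1, t1, hc1, ht1, hfac1⟩ := fac_exists hM (P.map φ) hPM0
  have hNt1 : N = s1.length + 2 * t1.length := by
    rw [← facProd_natDegree c1 hc1, ← hfac1, Polynomial.natDegree_map_eq_of_injective hφ]
  have hBM := bezD_map φ P B hB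
  rw [hfac1] at hBM
  have hVM := diag_map φ V _ c hVc
  rw [bezMat_map] at hVM
  obtain ⟨hm1, -⟩ := bez_count c1 s1 t1 _ hBM _ _ hVM
  have e1 : (Finset.univ.filter (fun i => φ (c i) < 0)) = Finset.univ.filter (fun i => ε (c i) < 0) := by
    ext i
    simp only [Finset.mem_filter, Finset.mem_univ, true_and]
    rcases hca i with ⟨h1, h2⟩ | ⟨h1, h2⟩
    · exact iff_of_false (not_lt.2 h2.le) (not_lt.2 h1.le)
    · exact iff_of_true h2 h1
  have e2 : (Finset.univ.filter (fun i => 0 < ε (c i))) = (Finset.univ.filter (fun i => ε (c i) < 0))ᶜ := by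
    ext i
    simp only [Finset.mem_filter, Finset.mem_univ, true_and, Finset.mem_compl, not_lt]
    rcases hca i with ⟨h1, h2⟩ | ⟨h1, h2⟩
    · exact iff_of_true h1 h1.le
    · exact iff_of_false (not_lt.2 h1.le) (not_le.2 h1)
  rw [e2, Finset.card_compl, Fintype.card_fin] at hn2
  rw [e1] at hm1
  simp only [List.length_nil, zero_add] at hn2
  have hs1 : s1.length = 0 := by omega
  have hs1' : s1 = [] := List.length_eq_zero_iff.1 hs1
  subst hs1'
  rw [psi_eval]
  change 0 ≤ (P.map φ).eval _
  rw [hfac1, facProd_eval]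
  have h2 := quad_prod_pos t1 ht1 (ψ Polynomial.X)
  have hc1' : c1 = φ P.leadingCoeff := by
    rw [← facProd_leadingCoeff c1 [] t1, ← hfac1, Polynomial.leadingCoeff_map_of_injective hφ]
  have : 0 < c1 := by
    rw [hc1']
    rcases hla with h | h
    · exact h.2
    · rw [← hc0'] at h
      exact absurd h.1 (not_lt.2 hc0pos.le)
  simp only [List.map_nil, List.prod_nil, mul_one]
  positivity

end OneReg


namespace OneReg
open scoped Polynomial

theorem artin_pos {M : Type*} [Field M] [LinearOrder M] [IsStrictOrderedRing M] (hM : RC M)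
    (ψ : ℝ[X][X] →+* M) (hψ : Function.Injective ψ) : ∀ (n : ℕ) (P : ℝ[X][X]), P.natDegree = n →
    ∀ (e : ℝ[X]), e ≠ 0 → (∀ a, e.eval a ≠ 0 → ∀ b, 0 ≤ Polynomial.evalEval a b P) → 0 ≤ ψ P := by
  intro n
  induction n using Nat.strong_induction_on with
  | _ n ih =>
  intro P hn e he hpos
  by_cases hP : P = 0
  · rw [hP, map_zero]
  let alg := algebraMap ℝ[X] (FractionRing ℝ[X])
  have halg : Function.Injective alg := IsFractionRing.injective _ _
  have hPF : P.map alg ≠ 0 := (Polynomial.map_ne_zero_iff halg).2 hP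
  by_cases hsf : Squarefree (P.map alg)
  · have hsep : (P.map alg).Separable := PerfectField.separable_iff_squarefree.2 hsf
    obtain ⟨u, v, huv⟩ := hsep
    obtain ⟨d, R, hd, hR⟩ := clear_denoms ![u, v]
    refine artin_sqf hM ψ hψ P hP e he hpos (R 0) (R 1) d hd ?_
    apply map_frac_inj
    have h0 := hR 0
    have h1 := hR 1
    simp only [Matrix.cons_val_zero, Matrix.cons_val_one] at h0 h1
    simp only [Polynomial.map_add, Polynomial.map_mul, Polynomial.map_C, h0, h1,
      ← Polynomial.derivative_map]
    linear_combination Polynomial.C (algebraMap ℝ[X] (FractionRing ℝ[X]) d) * huv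
  · rw [Squarefree] at hsf
    push Not at hsf
    obtain ⟨S, ⟨T, hST⟩, hS⟩ := hsf
    have hS0 : S ≠ 0 := by rintro rfl; simp at hST; exact hPF hST
    have hT0 : T ≠ 0 := by rintro rfl; simp at hST; exact hPF hST
    have hSd : S.natDegree ≠ 0 := fun h => hS
      (Polynomial.isUnit_iff_degree_eq_zero.2 (by rw [Polynomial.degree_eq_natDegree hS0, h]; rfl))
    obtain ⟨d, R, hd, hR⟩ := clear_denoms ![S, T]
    have h0 := hR 0
    have h1 := hR 1
    simp only [Matrix.cons_val_zero, Matrix.cons_val_one] at h0 h1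
    have had : alg d ≠ 0 := (map_ne_zero_iff _ halg).2 hd
    have key : Polynomial.C d ^ 4 * P = R 0 ^ 2 * (Polynomial.C d * R 1) := by
      apply map_frac_inj
      simp only [Polynomial.map_pow, Polynomial.map_mul, Polynomial.map_C, h0, h1]
      change _ * P.map alg = _
      rw [hST]; ring
    have hR0 : R 0 ≠ 0 := by
      intro h
      rw [h, Polynomial.map_zero] at h0
      exact mul_ne_zero (Polynomial.C_ne_zero.2 had) hS0 h0.symm
    have hdegP : P.natDegree = 2 * S.natDegree + T.natDegree := by
      rw [← Polynomial.natDegree_map_eq_of_injective halg, hST,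
        Polynomial.natDegree_mul (mul_ne_zero hS0 hS0) hT0, Polynomial.natDegree_mul hS0 hS0]
      ring
    have hdegR : (Polynomial.C d * R 1).natDegree = T.natDegree := by
      rw [Polynomial.natDegree_C_mul hd, ← Polynomial.natDegree_map_eq_of_injective halg]
      change (Polynomial.map (algebraMap ℝ[X] (FractionRing ℝ[X])) (R 1)).natDegree = _
      rw [h1, Polynomial.natDegree_C_mul had]
    have hQ : 0 ≤ ψ (Polynomial.C d * R 1) := by
      refine ih T.natDegree (by omega) _ hdegR (e * d * (R 0).leadingCoeff)
        (mul_ne_zero (mul_ne_zero he hd) (Polynomial.leadingCoeff_ne_zero.2 hR0)) ?_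
      intro a ha b
      simp only [Polynomial.eval_mul, mul_ne_zero_iff] at ha
      rw [← Polynomial.map_evalRingHom_eval]
      refine nonneg_of_sq_mul ((R 0).map (Polynomial.evalRingHom a)) _ ?_ ?_ b
      · intro h
        apply ha.2
        have := congrArg (fun q => q.coeff (R 0).natDegree) h
        simpa using this
      · intro b
        have h2 := congrArg (fun q => (q.map (Polynomial.evalRingHom a)).eval b) key
        simp only [Polynomial.map_mul, Polynomial.map_pow, Polynomial.eval_mul,
          Polynomial.eval_pow] at h2
        have h3 := hpos a ha.1.1 b
        rw [← Polynomial.map_evalRingHom_eval] at h3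
        rw [Polynomial.map_mul, Polynomial.eval_mul, ← h2]
        refine mul_nonneg ?_ h3
        positivity
    have h4 := congrArg ψ key
    rw [map_mul, map_mul, map_pow, map_pow] at h4
    have h5 : ψ (Polynomial.C d) ≠ 0 := (map_ne_zero_iff _ hψ).2 (Polynomial.C_ne_zero.2 hd)
    have h6 : 0 < ψ (Polynomial.C d) ^ 4 := by positivity
    refine nonneg_of_mul_nonneg_right ?_ h6
    rw [h4]
    positivity

theorem artin_frac (P : ℝ[X][X]) (hpos : ∀ a b, 0 ≤ Polynomial.evalEval a b P) :
    IsSumSq (algebraMap ℝ[X][X] (FractionRing ℝ[X][X]) P) := by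
  by_contra hP
  obtain ⟨M, i1, i2, i3, φ, h1, h2, h3⟩ := exists_real_closed _ hP
  have hM : RC M := ⟨h2, fun f hf => irr_deg_le_two h2 h3 f hf⟩
  have := artin_pos hM (φ.comp (algebraMap ℝ[X][X] (FractionRing ℝ[X][X])))
    (φ.injective.comp (IsFractionRing.injective _ _)) _ P rfl 1 one_ne_zero (fun a _ b => hpos a b)
  exact absurd h1 (not_lt.2 this)

theorem sumSq_clear {A : Type*} [CommRing A] [IsDomain A] {x : FractionRing A} (hx : IsSumSq x) :
    ∃ (n : ℕ) (h : A) (B : Fin n → A), h ≠ 0 ∧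
      algebraMap A (FractionRing A) h ^ 2 * x = ∑ i, algebraMap A (FractionRing A) (B i) ^ 2 := by
  induction hx with
  | zero => exact ⟨0, 1, Fin.elim0, one_ne_zero, by simp⟩
  | sq_add a hs ih =>
    obtain ⟨n, h, B, hh, hB⟩ := ih
    obtain ⟨u, v, hv, rfl⟩ := IsFractionRing.div_surjective (A := A) a
    have hv0 : v ≠ 0 := nonZeroDivisors.ne_zero hv
    have hv1 : algebraMap A (FractionRing A) v ≠ 0 :=
      (map_ne_zero_iff _ (IsFractionRing.injective _ _)).2 hv0
    refine ⟨n + 1, h * v, Fin.cons (h * u) (fun i => v * B i), mul_ne_zero hh hv0, ?_⟩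
    rw [Fin.sum_univ_succ]
    simp only [Fin.cons_zero, Fin.cons_succ, map_mul, mul_pow, ← Finset.mul_sum, ← hB]
    field_simp

theorem artin_two (P : ℝ[X][X]) (hpos : ∀ a b, 0 ≤ Polynomial.evalEval a b P) :
    ∃ (n : ℕ) (d : ℝ[X]) (B : Fin n → ℝ[X][X]), (∀ a, d.eval a ≠ 0) ∧
      Polynomial.C d ^ 2 * P = ∑ i, B i ^ 2 := by
  obtain ⟨n, h, B, hh, hB⟩ := sumSq_clear (artin_frac P hpos)
  obtain ⟨d, B', h1, h2⟩ := regular_sos P h B hh (by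
    apply IsFractionRing.injective ℝ[X][X] (FractionRing ℝ[X][X])
    simp only [map_mul, map_pow, map_sum]
    exact hB)
  exact ⟨n, d, B', h1, h2⟩

theorem theoremA (p : MvPolynomial (Fin 2) ℝ) (hp : ∀ x, 0 ≤ eval x p) :
    ∃ (n : ℕ) (d : MvPolynomial (Fin 2) ℝ) (B : Fin n → MvPolynomial (Fin 2) ℝ),
      (∀ x, 0 < eval x d) ∧ ∀ x, eval x d ^ 2 * eval x p = ∑ i, eval x (B i) ^ 2 := by
  let Φ := Polynomial.Bivariate.equivMvPolynomial ℝ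
  have hev : ∀ (x : Fin 2 → ℝ) (Q : ℝ[X][X]), eval x (Φ Q) = Polynomial.evalEval (x 0) (x 1) Q := by
    intro x Q
    have : (MvPolynomial.eval x).comp (Φ : ℝ[X][X] →+* MvPolynomial (Fin 2) ℝ) =
        Polynomial.evalEvalRingHom (x 0) (x 1) := by
      ext <;> simp [Φ]
    exact congrArg (fun f => f Q) this
  obtain ⟨n, d, B, hd, hB⟩ := artin_two (Φ.symm p) (by
    intro a b
    have := hev ![a, b] (Φ.symm p)
    simp only [AlgEquiv.apply_symm_apply, Matrix.cons_val_zero, Matrix.cons_val_one] at this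
    rw [← this]; exact hp _)
  refine ⟨n, Φ (Polynomial.C d) ^ 2, fun i => Φ (Polynomial.C d) * Φ (B i), ?_, ?_⟩
  · intro x
    rw [map_pow, hev]
    simp only [Polynomial.evalEval_C]
    have := hd (x 0)
    positivity
  · intro x
    have h := congrArg (fun q => eval x (Φ q)) hB
    simp only [map_mul, map_pow, map_sum, AlgEquiv.apply_symm_apply] at h
    simp only [map_pow, map_mul, mul_pow, ← Finset.mul_sum, ← h]
    ring

end OneReg


namespace OneReg
open scoped Polynomial

/-- Restriction of a polynomial to a line through `a`. -/
noncomputable def line (a y : Fin 2 → ℝ) : MvPolynomial (Fin 2) ℝ →ₐ[ℝ] ℝ[X] :=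
  aeval (fun i => Polynomial.C (a i) + Polynomial.C (y i) * Polynomial.X)

theorem line_eval (a y : Fin 2 → ℝ) (q : MvPolynomial (Fin 2) ℝ) (t : ℝ) :
    (line a y q).eval t = eval (a + t • y) q := by
  have : (Polynomial.aeval t).comp (line a y) = MvPolynomial.aeval (a + t • y) := by
    ext i
    simp [line]
    ring
  have h := congrArg (fun f => f q) this
  simpa [Polynomial.aeval_def, MvPolynomial.aeval_eq_eval, Polynomial.eval₂_eq_eval_map] using h

theorem line_zero_coeff (y : Fin 2 → ℝ) (r : MvPolynomial (Fin 2) ℝ) (k : ℕ) :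
    (line 0 y r).coeff k = eval y (homogeneousComponent k r) := by
  induction r using MvPolynomial.induction_on' with
  | add p q hp hq => simp only [map_add, Polynomial.coeff_add, hp, hq]
  | monomial s c =>
    have h1 := homogeneousComponent_of_mem (m := k) (n := s.degree)
      (p := monomial s c) ((mem_homogeneousSubmodule _ _).2 (isHomogeneous_monomial c rfl))
    rw [h1]
    have h2 : line 0 y (monomial s c) =
        Polynomial.C (eval y (monomial s c)) * Polynomial.X ^ s.degree := by
      simp only [line, aeval_monomial, eval_monomial, Finsupp.degree_eq_sum,
        Finsupp.prod_fintype _ _ (fun _ => pow_zero _), Fin.prod_univ_two, Fin.sum_univ_two]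
      simp
      ring
    rw [h2, Polynomial.coeff_C_mul, Polynomial.coeff_X_pow]
    split_ifs <;> simp

theorem line_coeff (a y : Fin 2 → ℝ) (q : MvPolynomial (Fin 2) ℝ) (k : ℕ) :
    (line a y q).coeff k = eval y (homogeneousComponent k (shiftPoly a q)) := by
  rw [← line_zero_coeff]
  congr 1
  have : line a y = (line 0 y).comp (bind₁ (fun i => C (a i) + X i)) := by
    ext i
    simp [line, Polynomial.algebraMap_eq]
  rw [this]
  rfl

/-- Positive definiteness of the initial form at `a`, expressed along lines. -/
def PD (q : MvPolynomial (Fin 2) ℝ) (a : Fin 2 → ℝ) : Prop :=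
  ∃ m : ℕ, ∀ y, y ≠ 0 → (∀ k < m, (line a y q).coeff k = 0) ∧ 0 < (line a y q).coeff m

theorem locPosDef_iff (q : MvPolynomial (Fin 2) ℝ) (a : Fin 2 → ℝ) :
    LocPosDef q a ↔ PD q a := by
  constructor
  · rintro ⟨m, -, h1, h2⟩
    refine ⟨m, fun y hy => ⟨fun k hk => ?_, ?_⟩⟩
    · rw [line_coeff, h1 k hk, map_zero]
    · rw [line_coeff]; exact h2 y hy
  · rintro ⟨m, h⟩
    have h2 : ∀ y : Fin 2 → ℝ, y ≠ 0 → 0 < eval y (homogeneousComponent m (shiftPoly a q)) := by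
      intro y hy
      rw [← line_coeff]; exact (h y hy).2
    refine ⟨m, ?_, ?_, h2⟩
    · intro h0
      have := h2 1 one_ne_zero
      rw [h0, map_zero] at this
      exact lt_irrefl _ this
    · intro d hd
      have : homogeneousComponent d (shiftPoly a q) * X 0 = 0 := by
        apply MvPolynomial.funext
        intro y
        by_cases hy : y = 0
        · simp [hy]
        · rw [map_mul, ← line_coeff, (h y hy).1 d hd]; simp
      exact (mul_eq_zero.1 this).resolve_right (X_ne_zero 0)

theorem coeff_mul_low (p q : ℝ[X]) (m n : ℕ) (hp : ∀ k < m, p.coeff k = 0)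
    (hq : ∀ k < n, q.coeff k = 0) :
    (∀ k < m + n, (p * q).coeff k = 0) ∧ (p * q).coeff (m + n) = p.coeff m * q.coeff n := by
  obtain ⟨p', rfl⟩ := Polynomial.X_pow_dvd_iff.2 hp
  obtain ⟨q', rfl⟩ := Polynomial.X_pow_dvd_iff.2 hq
  have e : Polynomial.X ^ m * p' * (Polynomial.X ^ n * q') = Polynomial.X ^ (m + n) * (p' * q') := by
    ring
  rw [e]
  refine ⟨Polynomial.X_pow_dvd_iff.1 ⟨_, rfl⟩, ?_⟩
  simp [Polynomial.coeff_X_pow_mul', Polynomial.mul_coeff_zero]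

theorem coeff_low_nonneg (p : ℝ[X]) (m : ℕ) (hp : ∀ k < m, p.coeff k = 0)
    (hpos : ∀ t, 0 ≤ p.eval t) : 0 ≤ p.coeff m := by
  obtain ⟨p', rfl⟩ := Polynomial.X_pow_dvd_iff.2 hp
  have h1 : (Polynomial.X ^ m * p').coeff m = p'.eval 0 := by
    simp [Polynomial.coeff_X_pow_mul', Polynomial.coeff_zero_eq_eval_zero]
  rw [h1]
  have h2 : Filter.Tendsto (fun t => p'.eval t) (nhdsWithin 0 (Set.Ioi 0)) (nhds (p'.eval 0)) :=
    (p'.continuous.tendsto 0).mono_left nhdsWithin_le_nhds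
  refine ge_of_tendsto h2 ?_
  filter_upwards [self_mem_nhdsWithin] with t ht
  have ht' : 0 < t := ht
  have := hpos t
  simp only [Polynomial.eval_mul, Polynomial.eval_pow, Polynomial.eval_X] at this
  exact nonneg_of_mul_nonneg_right this (pow_pos ht' m)

theorem coeff_small (G : ℝ → ℝ) (hG : Continuous G) (hG0 : G 0 = 0) : ∀ (m : ℕ) (π : ℝ[X]),
    (∀ t, π.eval t = G t * t ^ m) → ∀ k ≤ m, π.coeff k = 0 := by
  intro m
  induction m with
  | zero =>
    intro π h k hk
    obtain rfl : k = 0 := by omega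
    rw [Polynomial.coeff_zero_eq_eval_zero, h, hG0]; simp
  | succ m ih =>
    intro π h k hk
    have h0 : π.coeff 0 = 0 := by
      rw [Polynomial.coeff_zero_eq_eval_zero, h, hG0]; simp
    obtain ⟨π', rfl⟩ := Polynomial.X_dvd_iff.2 h0
    rcases k with _ | k
    · exact h0
    · rw [Polynomial.coeff_X_mul]
      refine ih π' ?_ k (by omega)
      have hd : Dense ({0}ᶜ : Set ℝ) := dense_compl_singleton 0
      have he : Set.EqOn (fun t => π'.eval t) (fun t => G t * t ^ m) ({0}ᶜ : Set ℝ) := by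
        intro t ht
        have ht' : t ≠ 0 := ht
        have := h t
        simp only [Polynomial.eval_mul, Polynomial.eval_X] at this
        apply mul_left_cancel₀ ht'
        rw [this]; ring
      have := Continuous.ext_on hd π'.continuous (by fun_prop) he
      exact fun t => congrFun this t

/-- Admissible denominators. -/
structure Den (q : MvPolynomial (Fin 2) ℝ) : Prop where
  nonneg : ∀ x, 0 ≤ eval x q
  fin : {x : Fin 2 → ℝ | eval x q = 0}.Finite
  pd : ∀ a, PD q a

theorem PD_of_pos {q : MvPolynomial (Fin 2) ℝ} {a : Fin 2 → ℝ} (h : 0 < eval a q) : PD q a := by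
  refine ⟨0, fun y _ => ⟨by simp, ?_⟩⟩
  rw [Polynomial.coeff_zero_eq_eval_zero, line_eval]
  simpa using h

theorem Den.mul {p q : MvPolynomial (Fin 2) ℝ} (hp : Den p) (hq : Den q) : Den (p * q) where
  nonneg x := by rw [map_mul]; exact mul_nonneg (hp.nonneg x) (hq.nonneg x)
  fin := by
    refine (hp.fin.union hq.fin).subset ?_
    intro x hx
    simpa using hx
  pd a := by
    obtain ⟨m, hm⟩ := hp.pd a
    obtain ⟨n, hn⟩ := hq.pd a
    refine ⟨m + n, fun y hy => ?_⟩
    have := coeff_mul_low _ _ m n (hm y hy).1 (hn y hy).1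
    rw [map_mul]
    refine ⟨this.1, ?_⟩
    rw [this.2]
    exact mul_pos (hm y hy).2 (hn y hy).2

theorem Den.of_pos {d : MvPolynomial (Fin 2) ℝ} (hd : ∀ x, 0 < eval x d) : Den d where
  nonneg x := (hd x).le
  fin := by
    convert Set.finite_empty
    ext x; simpa using (hd x).ne'
  pd a := PD_of_pos (hd a)

theorem Den.dense {q : MvPolynomial (Fin 2) ℝ} (hq : Den q) :
    Dense {x : Fin 2 → ℝ | eval x q = 0}ᶜ := hq.fin.countable.dense_compl ℝ

/-- Weak form of a [1]-regulous function (no coprimality). -/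
def W (f : (Fin 2 → ℝ) → ℝ) : Prop :=
  Continuous f ∧ ∃ p q : MvPolynomial (Fin 2) ℝ, Den q ∧ ∀ x, eval x p = f x * eval x q

theorem W_of_oneRegulous {f : (Fin 2 → ℝ) → ℝ} (h : OneRegulous f) : W f := by
  obtain ⟨hf, p, q, -, h1, h2, h3, h4⟩ := h
  have hD : Den q := ⟨h1, h2, fun a => by
    rcases eq_or_lt_of_le (h1 a) with h | h
    · exact (locPosDef_iff q a).1 (h4 a h.symm)
    · exact PD_of_pos h⟩
  refine ⟨hf, p, q, hD, ?_⟩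
  have := Continuous.ext_on hD.dense (MvPolynomial.continuous_eval p)
    (hf.mul (MvPolynomial.continuous_eval q)) (by
      intro x hx
      have hx' : eval x q ≠ 0 := hx
      change eval x p = f x * eval x q
      rw [h3 x hx']
      field_simp)
  exact fun x => congrFun this x

theorem W.mul {f g : (Fin 2 → ℝ) → ℝ} (hf : W f) (hg : W g) : W (fun x => f x * g x) := by
  obtain ⟨hf, p, q, hq, h⟩ := hf
  obtain ⟨hg, p', q', hq', h'⟩ := hg
  refine ⟨hf.mul hg, p * p', q * q', hq.mul hq', fun x => ?_⟩
  rw [map_mul, map_mul, h, h']; ring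

theorem W.one : W (fun _ => 1) :=
  ⟨continuous_const, 1, 1, Den.of_pos (by simp), by simp⟩

theorem oneRegulous_of_W {f : (Fin 2 → ℝ) → ℝ} (h : W f) : OneRegulous f := by
  obtain ⟨hf, p, q, hq, hpq⟩ := h
  have hq0 : q ≠ 0 := by
    rintro rfl
    obtain ⟨m, hm⟩ := hq.pd 0
    have := (hm 1 one_ne_zero).2
    simp at this
  obtain ⟨q1, p1, c, hrel, hcq, hcp⟩ := UniqueFactorizationMonoid.exists_reduced_factors q hq0 p
  have hconn : IsConnected {x : Fin 2 → ℝ | eval x q = 0}ᶜ :=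
    hq.fin.countable.isConnected_compl_of_one_lt_rank (by simp)
  -- normalise the sign
  obtain ⟨q1, p1, c, hrel, hcq, hcp, hpos⟩ : ∃ q1 p1 c : MvPolynomial (Fin 2) ℝ, IsRelPrime q1 p1 ∧
      c * q1 = q ∧ c * p1 = p ∧ ∀ x, eval x q ≠ 0 → 0 < eval x q1 := by
    have hne : ∀ x, eval x q ≠ 0 → eval x q1 ≠ 0 := by
      intro x hx h
      apply hx
      rw [← hcq, map_mul, h, mul_zero]
    have hpre := hconn.isPreconnected.image (fun x => eval x q1)
      (MvPolynomial.continuous_eval q1).continuousOn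
    obtain ⟨x0, hx0⟩ := hconn.nonempty
    have hx0' : eval x0 q ≠ 0 := hx0
    rcases lt_or_gt_of_ne (hne x0 hx0') with hx | hx
    · refine ⟨-q1, -p1, -c, hrel.neg_neg, by rw [← hcq]; ring, by rw [← hcp]; ring, ?_⟩
      intro x hx1
      rw [map_neg, neg_pos]
      by_contra hcon
      have := hpre.ordConnected.out ⟨x0, hx0, rfl⟩ ⟨x, hx1, rfl⟩ ⟨hx.le, not_lt.1 hcon⟩
      obtain ⟨z, hz, hz'⟩ := this
      exact hne z hz hz'
    · refine ⟨q1, p1, c, hrel, hcq, hcp, ?_⟩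
      intro x hx1
      by_contra hcon
      have := hpre.ordConnected.out ⟨x, hx1, rfl⟩ ⟨x0, hx0, rfl⟩ ⟨not_lt.1 hcon, hx.le⟩
      obtain ⟨z, hz, hz'⟩ := this
      exact hne z hz hz'
  have hnn : ∀ x, 0 ≤ eval x q1 := by
    have hcl : IsClosed {x | 0 ≤ eval x q1} :=
      isClosed_le continuous_const (MvPolynomial.continuous_eval q1)
    have h2 := hq.dense.closure_eq ▸ hcl.closure_subset_iff.2
      (show {x : Fin 2 → ℝ | eval x q = 0}ᶜ ⊆ _ from fun x hx => (hpos x hx).le)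
    exact fun x => h2 (Set.mem_univ x)
  have hfq : ∀ x, eval x p1 = f x * eval x q1 := by
    have := Continuous.ext_on hq.dense (MvPolynomial.continuous_eval p1)
      (hf.mul (MvPolynomial.continuous_eval q1)) (by
        intro x hx
        have hx' : eval x q ≠ 0 := hx
        have hc : eval x c ≠ 0 := by
          intro h; apply hx'; rw [← hcq, map_mul, h, zero_mul]
        apply mul_left_cancel₀ hc
        have := hpq x
        rw [← hcq, ← hcp, map_mul, map_mul] at this
        change eval x c * eval x p1 = eval x c * (f x * eval x q1)
        rw [this]; ring)
    exact fun x => congrFun this x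
  refine ⟨hf, p1, q1, hrel.symm, hnn, ?_, ?_, ?_⟩
  · refine hq.fin.subset ?_
    intro x hx
    by_contra h
    exact (hpos x h).ne' hx
  · intro x hx
    rw [hfq]; field_simp
  · intro a _
    rw [locPosDef_iff]
    classical
    obtain ⟨m, hm⟩ := hq.pd a
    have key : ∀ r s : MvPolynomial (Fin 2) ℝ, r * s = q → ∃ k, (∃ y, (line a y r).coeff k ≠ 0) ∧
        ∀ j < k, ∀ y, (line a y r).coeff j = 0 := by
      intro r s hrs
      have hex : ∃ k, ∃ y, (line a y r).coeff k ≠ 0 := by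
        by_contra hcon
        push Not at hcon
        have h1 : line a 1 r = 0 := by ext k; simpa using hcon k 1
        have h2 := (hm 1 one_ne_zero).2
        rw [← hrs, map_mul, h1] at h2
        simp at h2
      refine ⟨Nat.find hex, Nat.find_spec hex, fun j hj y => ?_⟩
      by_contra h
      exact Nat.find_min hex hj ⟨y, h⟩
    obtain ⟨k1, ⟨y1, hy1⟩, hk1⟩ := key q1 c (by rw [mul_comm, hcq])
    obtain ⟨k2, ⟨y2, hy2⟩, hk2⟩ := key c q1 hcq
    have hmul : ∀ y, _ := fun y => coeff_mul_low (line a y q1) (line a y c) k1 k2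
      (fun j hj => hk1 j hj y) (fun j hj => hk2 j hj y)
    simp only [← map_mul, mul_comm q1 c, hcq] at hmul
    have hmk : m = k1 + k2 := by
      have hg : homogeneousComponent k1 (shiftPoly a q1) * homogeneousComponent k2 (shiftPoly a c) *
          X 0 ≠ 0 := by
        refine mul_ne_zero (mul_ne_zero ?_ ?_) (X_ne_zero 0)
        · intro h; rw [line_coeff, h, map_zero] at hy1; exact hy1 rfl
        · intro h; rw [line_coeff, h, map_zero] at hy2; exact hy2 rfl
      obtain ⟨y, hy⟩ : ∃ y, eval y (homogeneousComponent k1 (shiftPoly a q1) *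
          homogeneousComponent k2 (shiftPoly a c) * X 0) ≠ 0 := by
        by_contra hcon
        push Not at hcon
        exact hg (MvPolynomial.funext (fun y => by rw [hcon, map_zero]))
      rw [map_mul, map_mul, ← line_coeff, ← line_coeff, ← (hmul y).2, eval_X] at hy
      have hy0 : y ≠ 0 := by rintro rfl; simp at hy
      have hyk := left_ne_zero_of_mul hy
      rcases lt_trichotomy m (k1 + k2) with h | h | h
      · exact absurd ((hmul y).1 m h) (hm y hy0).2.ne'
      · exact h
      · exact absurd ((hm y hy0).1 _ h) hyk
    refine ⟨k1, fun y hy => ⟨fun j hj => hk1 j hj y, ?_⟩⟩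
    refine lt_of_le_of_ne (coeff_low_nonneg _ _ (fun j hj => hk1 j hj y) ?_) ?_
    · intro t; rw [line_eval]; exact hnn _
    · intro h
      have h1 := (hm y hy).2
      rw [hmk, (hmul y).2, ← h, zero_mul] at h1
      exact lt_irrefl _ h1

end OneReg


namespace OneReg
open scoped Polynomial

theorem Den.add_C {f : (Fin 2 → ℝ) → ℝ} (hf : Continuous f) (hpos : ∀ x, 0 ≤ f x)
    {p q : MvPolynomial (Fin 2) ℝ} (hq : Den q) (h : ∀ x, eval x p = f x * eval x q)
    (c : ℝ) (hc : 0 < c) : Den (p + C c * q) := by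
  have he : ∀ x, eval x (p + C c * q) = (f x + c) * eval x q := by
    intro x
    rw [map_add, map_mul, h, eval_C]; ring
  refine ⟨fun x => ?_, ?_, fun a => ?_⟩
  · rw [he]
    exact mul_nonneg (by linarith [hpos x]) (hq.nonneg x)
  · refine hq.fin.subset ?_
    intro x hx
    have hx' : eval x (p + C c * q) = 0 := hx
    rw [he] at hx'
    exact (mul_eq_zero.1 hx').resolve_left (by linarith [hpos x])
  · obtain ⟨m, hm⟩ := hq.pd a
    refine ⟨m, fun y hy => ?_⟩
    obtain ⟨h1, h2⟩ := hm y hy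
    obtain ⟨σ, hσ⟩ := Polynomial.X_pow_dvd_iff.2 h1
    have h3 := coeff_small (fun t => (f (a + t • y) - f a) * σ.eval t)
      (by
        have := σ.continuous
        fun_prop) (by simp) m (line a y p - Polynomial.C (f a) * line a y q) (by
        intro t
        have e1 := line_eval a y q t
        rw [Polynomial.eval_sub, Polynomial.eval_mul, Polynomial.eval_C, line_eval, h, ← e1, hσ]
        simp only [Polynomial.eval_mul, Polynomial.eval_pow, Polynomial.eval_X]
        ring)
    have h4 : ∀ k ≤ m, (line a y (p + C c * q)).coeff k = (f a + c) * (line a y q).coeff k := by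
      intro k hk
      have h5 := h3 k hk
      rw [Polynomial.coeff_sub, Polynomial.coeff_C_mul] at h5
      have h6 : line a y (C c) = Polynomial.C c := by
        simp [line, Polynomial.algebraMap_eq]
      rw [map_add, map_mul, h6, Polynomial.coeff_add, Polynomial.coeff_C_mul]
      linear_combination h5
    refine ⟨fun k hk => by rw [h4 k hk.le, h1 k hk, mul_zero], ?_⟩
    rw [h4 m le_rfl]
    exact mul_pos (by linarith [hpos a]) h2

/-- Sum of squares of weak [1]-regulous functions. -/
def SoS (f : (Fin 2 → ℝ) → ℝ) : Prop :=
  ∃ (m : ℕ) (F : Fin m → (Fin 2 → ℝ) → ℝ), (∀ i, W (F i)) ∧ ∀ x, f x = ∑ i, F i x ^ 2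

theorem SoS.add {f g : (Fin 2 → ℝ) → ℝ} (hf : SoS f) (hg : SoS g) : SoS (fun x => f x + g x) := by
  obtain ⟨m, F, hF, h⟩ := hf
  obtain ⟨n, G, hG, h'⟩ := hg
  refine ⟨m + n, Fin.append F G, fun i => ?_, fun x => ?_⟩
  · refine Fin.addCases (fun i => ?_) (fun i => ?_) i
    · rw [Fin.append_left]; exact hF i
    · rw [Fin.append_right]; exact hG i
  · simp only [Fin.sum_univ_add, Fin.append_left, Fin.append_right, h, h']

theorem SoS.sq {f : (Fin 2 → ℝ) → ℝ} (hf : W f) : SoS (fun x => f x ^ 2) :=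
  ⟨1, fun _ => f, fun _ => hf, fun x => by simp⟩

theorem SoS.zero : SoS (fun _ => 0) :=
  ⟨0, Fin.elim0, fun i => i.elim0, fun x => by simp⟩

theorem iterate {f : (Fin 2 → ℝ) → ℝ} (hf : W f) (hpos : ∀ x, 0 ≤ f x) (S : Finset (Fin 2 → ℝ)) :
    ∃ G H : (Fin 2 → ℝ) → ℝ, SoS G ∧ W H ∧ (∀ x, f x = G x + H x ^ 2 * f x) ∧
      ∀ a ∈ S, H a ^ 2 * f a = 0 := by
  classical
  induction S using Finset.induction_on with
  | empty => exact ⟨fun _ => 0, fun _ => 1, SoS.zero, W.one, by simp, by simp⟩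
  | insert a S _ ih =>
    obtain ⟨G, H, hG, hH, h1, h2⟩ := ih
    rcases eq_or_lt_of_le (hpos a) with h0 | h0
    · refine ⟨G, H, hG, hH, h1, ?_⟩
      intro b hb
      rcases Finset.mem_insert.1 hb with rfl | hb
      · rw [← h0, mul_zero]
      · exact h2 b hb
    · obtain ⟨hfc, p, q, hq, hpq⟩ := hf
      set c := f a with hc
      have hne : ∀ x, f x + c ≠ 0 := fun x => by
        have := hpos x
        linarith
      have hD := Den.add_C hfc hpos hq hpq c h0
      have he : ∀ x, eval x (p + C c * q) = (f x + c) * eval x q := by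
        intro x
        rw [map_add, map_mul, hpq, eval_C]; ring
      have hg : W (fun x => 2 * √c * f x / (f x + c)) := by
        refine ⟨Continuous.div (by fun_prop) (by fun_prop) hne, C (2 * √c) * p, _, hD, fun x => ?_⟩
        rw [he, map_mul, hpq, eval_C]
        have := hne x
        field_simp
      have hh : W (fun x => (f x - c) / (f x + c)) := by
        refine ⟨Continuous.div (by fun_prop) (by fun_prop) hne, p - C c * q, _, hD, fun x => ?_⟩
        rw [he, map_sub, map_mul, hpq, eval_C]
        have := hne x
        field_simp
      refine ⟨fun x => G x + (H x * (2 * √c * f x / (f x + c))) ^ 2,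
        fun x => H x * ((f x - c) / (f x + c)), hG.add (SoS.sq (hH.mul hg)), hH.mul hh, ?_, ?_⟩
      · intro x
        have h3 := h1 x
        have h4 := hne x
        have h5 : √c ^ 2 = c := Real.sq_sqrt h0.le
        have h6 : f x = (2 * √c * f x / (f x + c)) ^ 2 + ((f x - c) / (f x + c)) ^ 2 * f x := by
          rw [div_pow, div_pow, mul_pow, mul_pow, h5]
          field_simp
          ring
        linear_combination h3 + H x ^ 2 * h6
      · intro b hb
        rcases Finset.mem_insert.1 hb with rfl | hb
        · simp [hc]
        · have := h2 b hb
          linear_combination ((f b - c) / (f b + c)) ^ 2 * this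

theorem main {f : (Fin 2 → ℝ) → ℝ} (hf : W f) (hpos : ∀ x, 0 ≤ f x) : SoS f := by
  have hf' := hf
  obtain ⟨hfc, p, q, hq, hpq⟩ := hf'
  obtain ⟨G, H, hG, hH, h1, h2⟩ := iterate hf hpos hq.fin.toFinset
  have h2' : ∀ a, eval a q = 0 → H a ^ 2 * f a = 0 := fun a ha => h2 a (by simpa using ha)
  obtain ⟨n, d, B, hd, hB⟩ := theoremA (p * q) (by
    intro x
    rw [map_mul, hpq]
    have := hpos x
    have := hq.nonneg x
    positivity)
  have hB' : ∀ x, ∑ i, eval x (B i) ^ 2 = (eval x d * eval x q) ^ 2 * f x := by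
    intro x
    rw [← hB, map_mul, hpq]; ring
  have hBi : ∀ x i, eval x (B i) ^ 2 ≤ (eval x d * eval x q) ^ 2 * f x := by
    intro x i
    rw [← hB']
    exact Finset.single_le_sum (f := fun i => eval x (B i) ^ 2) (fun j _ => sq_nonneg _)
      (Finset.mem_univ i)
  let F : Fin n → (Fin 2 → ℝ) → ℝ := fun i x => H x * eval x (B i) / (eval x d * eval x q)
  have hF0 : ∀ i x, eval x q = 0 → F i x = 0 := by
    intro i x hx
    simp [F, hx]
  have hFb : ∀ i x, F i x ^ 2 ≤ H x ^ 2 * f x := by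
    intro i x
    by_cases hx : eval x q = 0
    · rw [hF0 i x hx, h2' x hx]; simp
    · have hdq : 0 < (eval x d * eval x q) ^ 2 := by
        have := (hd x).ne'
        positivity
      simp only [F]
      rw [div_pow, div_le_iff₀ hdq, mul_pow]
      have := mul_le_mul_of_nonneg_left (hBi x i) (sq_nonneg (H x))
      linarith
  obtain ⟨hHc, pH, qH, hqH, hpqH⟩ := hH
  have hFW : ∀ i, W (F i) := by
    intro i
    refine ⟨?_, pH * B i, qH * (d * q), hqH.mul ((Den.of_pos hd).mul hq), ?_⟩
    · rw [continuous_iff_continuousAt]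
      intro x
      by_cases hx : eval x q = 0
      · have hlim : Filter.Tendsto (fun z => √(H z ^ 2 * f z)) (nhds x) (nhds 0) := by
          have : Continuous (fun z => √(H z ^ 2 * f z)) := by fun_prop
          have h3 := this.tendsto x
          simpa only [h2' x hx, Real.sqrt_zero] using h3
        rw [ContinuousAt, hF0 i x hx]
        refine squeeze_zero_norm (fun z => ?_) hlim
        rw [Real.norm_eq_abs]
        exact Real.abs_le_sqrt (hFb i z)
      · refine ContinuousAt.div ?_ ?_ (mul_ne_zero (hd x).ne' hx)
        · exact (hHc.mul (MvPolynomial.continuous_eval (B i))).continuousAt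
        · exact ((MvPolynomial.continuous_eval d).mul (MvPolynomial.continuous_eval q)).continuousAt
    · intro x
      rw [map_mul, map_mul, map_mul, hpqH]
      by_cases hx : eval x q = 0
      · have h3 := hBi x i
        rw [hx] at h3
        have h4 : eval x (B i) ^ 2 = 0 := le_antisymm (by simpa using h3) (sq_nonneg _)
        rw [pow_eq_zero_iff two_ne_zero] at h4
        rw [h4, hx]; simp
      · have := (hd x).ne'
        simp only [F]
        field_simp
  have hsum : ∀ x, ∑ i, F i x ^ 2 = H x ^ 2 * f x := by
    intro x
    by_cases hx : eval x q = 0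
    · rw [h2' x hx]
      exact Finset.sum_eq_zero (fun i _ => by rw [hF0 i x hx]; simp)
    · have := (hd x).ne'
      simp only [F, div_pow, mul_pow, ← Finset.sum_div, ← Finset.mul_sum, hB']
      field_simp
  have hS : SoS (fun x => ∑ i, F i x ^ 2) := ⟨n, F, hFW, fun _ => rfl⟩
  obtain ⟨m, K, hK, hK'⟩ := hG.add hS
  exact ⟨m, K, hK, fun x => by
    rw [← hK']
    simp only [hsum]
    exact h1 x⟩

end OneReg

/-- STATEMENT 10: every non-negative [1]-regulous function on `ℝ²` is a sum of squares of
[1]-regulous functions. -/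
theorem nonneg_oneRegulous_is_sum_of_squares_of_oneRegulous
    (f : (Fin 2 → ℝ) → ℝ) (hf : OneRegulous f) (hpos : ∀ x, 0 ≤ f x) :
    ∃ (m : ℕ) (F : Fin m → (Fin 2 → ℝ) → ℝ), (∀ i, OneRegulous (F i)) ∧
      ∀ x, f x = ∑ i, F i x ^ 2 := by
  obtain ⟨m, F, hF, h⟩ := OneReg.main (OneReg.W_of_oneRegulous hf) hpos
  exact ⟨m, F, fun i => OneReg.oneRegulous_of_W (hF i), h⟩
end

section
/- Let n ≥ 1 and let f : ℝ^n → ℝ be a regulous function. Then for every point a ∈ ℝ^n and every vector v ∈ ℝ^n, the function t ↦ f(a + t·v) from ℝ to ℝ is differentiable at t = 0; in other words, f admits a partial derivative in every direction at every point of ℝ^n. -/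
open MvPolynomial

/-- A function `f : ℝ^n → ℝ` is regulous if it is continuous and agrees with a rational
function `p/q` wherever `q` does not vanish. -/
def Regulous (n : ℕ) (f : (Fin n → ℝ) → ℝ) : Prop :=
  Continuous f ∧ ∃ p q : MvPolynomial (Fin n) ℝ, q ≠ 0 ∧
    ∀ x : Fin n → ℝ, eval x q ≠ 0 → f x = eval x p / eval x q

open Polynomial in
/-- Cancel common powers of the variable in an identity `g * Q = P` with `g` continuous. -/
theorem cancel_aux {R T : Type*} [CommRing R] (φ : T → R →+* ℝ)
    (hφ : ∀ r : R, (∀ t, φ t r = 0) → r = 0) (g : T → ℝ → ℝ) (hg : ∀ t, Continuous (g t)) :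
    ∀ (N : ℕ) (P Q : Polynomial R), Q.natDegree ≤ N → Q ≠ 0 →
      (∀ t s, g t s * Q.eval₂ (φ t) s = P.eval₂ (φ t) s) →
      ∃ P' Q' : Polynomial R, Q'.coeff 0 ≠ 0 ∧
        ∀ t s, g t s * Q'.eval₂ (φ t) s = P'.eval₂ (φ t) s := by
  intro N
  induction N with
  | zero =>
    intro P Q hN hQ h
    refine ⟨P, Q, fun h0 => hQ ?_, h⟩
    rw [Polynomial.eq_C_of_natDegree_le_zero hN, h0, Polynomial.C_0]
  | succ N ih =>
    intro P Q hN hQ h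
    by_cases h0 : Q.coeff 0 = 0
    · obtain ⟨Q1, rfl⟩ := Polynomial.X_dvd_iff.2 h0
      have hP : P.coeff 0 = 0 := by
        apply hφ
        intro t
        have := h t 0
        simp only [Polynomial.eval₂_mul, Polynomial.eval₂_X, zero_mul, mul_zero] at this
        rw [Polynomial.eval₂_at_zero] at this
        exact this.symm
      obtain ⟨P1, rfl⟩ := Polynomial.X_dvd_iff.2 hP
      have hQ1 : Q1 ≠ 0 := by rintro rfl; simp at hQ
      have : Nontrivial R := by
        by_contra hh
        rw [not_nontrivial_iff_subsingleton] at hh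
        exact hQ1 (Subsingleton.elim _ _)
      refine ih P1 Q1 ?_ hQ1 ?_
      · rw [Polynomial.natDegree_X_mul hQ1] at hN
        omega
      · intro t
        have c : ∀ A : Polynomial R, Continuous fun s : ℝ => A.eval₂ (φ t) s := fun A => by
          simp only [Polynomial.eval₂_eq_eval_map]
          exact Polynomial.continuous _
        have := Continuous.ext_on (dense_compl_singleton (0 : ℝ)) ((hg t).mul (c Q1)) (c P1)
          (fun s hs => by
            have := h t s
            simp only [Polynomial.eval₂_mul, Polynomial.eval₂_X] at this
            apply mul_left_cancel₀ (show s ≠ 0 from hs)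
            rw [Pi.mul_apply]
            linarith)
        exact fun s => congrFun this s
    · exact ⟨P, Q, h0, h⟩

/-- STATEMENT 11: a regulous function admits a partial derivative in every direction at
every point. -/
theorem regulous_has_directional_derivatives
    (n : ℕ) (hn : 1 ≤ n) (f : (Fin n → ℝ) → ℝ) (hf : Regulous n f)
    (a v : Fin n → ℝ) :
    DifferentiableAt ℝ (fun t : ℝ => f (a + t • v)) 0 := by
  obtain ⟨hc, p, q, hq, h⟩ := hf
  obtain ⟨b, hb⟩ : ∃ b, eval b q ≠ 0 := by
    by_contra hh
    push Not at hh
    exact hq (MvPolynomial.funext fun x => by simpa using hh x)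
  -- the restriction to the plane `a + t v + s (b - a)`
  let θ : MvPolynomial (Fin n) ℝ →+* Polynomial (Polynomial ℝ) :=
    eval₂Hom (Polynomial.C.comp Polynomial.C) fun i =>
      Polynomial.C (Polynomial.C (a i) + Polynomial.X * Polynomial.C (v i)) +
        Polynomial.X * Polynomial.C (Polynomial.C (b i - a i))
  have hθ : ∀ (r : MvPolynomial (Fin n) ℝ) (t s : ℝ),
      (θ r).eval₂ (Polynomial.evalRingHom t) s = eval (a + t • v + s • (b - a)) r := by
    intro r t s
    have : (Polynomial.eval₂RingHom (Polynomial.evalRingHom t) s).comp θ =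
        eval (a + t • v + s • (b - a)) := by
      apply MvPolynomial.ringHom_ext
      · intro x
        simp [θ]
      · intro i
        simp [θ]
        ring
    exact congrArg (fun F => F r) this
  have hq2 : θ (q * q) ≠ 0 := by
    intro h0
    have := hθ (q * q) 0 1
    rw [h0] at this
    simp [hb] at this
  have hfun : ∀ r : Polynomial ℝ, (∀ t, Polynomial.evalRingHom t r = 0) → r = 0 :=
    fun r hr => Polynomial.funext fun t => by simpa using hr t
  obtain ⟨P, Q, hQ, hPQ⟩ := cancel_aux (fun t : ℝ => Polynomial.evalRingHom t) hfun
    (fun t s => f (a + t • v + s • (b - a))) (fun t => hc.comp (by fun_prop)) _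
    (θ (p * q)) (θ (q * q)) le_rfl hq2 (by
      intro t s
      rw [hθ, hθ, map_mul, map_mul]
      by_cases h0 : eval (a + t • v + s • (b - a)) q = 0
      · simp [h0]
      · simp only [h _ h0]
        field_simp)
  obtain ⟨P', Q', hQ', hPQ'⟩ := cancel_aux (fun _ : Unit => RingHom.id ℝ)
    (fun r hr => hr ()) (fun _ t => f (a + t • v)) (fun _ => hc.comp (by fun_prop)) _
    (P.coeff 0) (Q.coeff 0) le_rfl hQ (by
      intro _ t
      have := hPQ t 0
      rw [Polynomial.eval₂_at_zero, Polynomial.eval₂_at_zero] at this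
      simpa [Polynomial.eval₂_id] using this)
  have hne : Q'.eval 0 ≠ 0 := by rwa [← Polynomial.coeff_zero_eq_eval_zero]
  have hd : DifferentiableAt ℝ (fun t : ℝ => P'.eval t / Q'.eval t) 0 :=
    P'.differentiableAt.div Q'.differentiableAt hne
  refine hd.congr_of_eventuallyEq ?_
  filter_upwards [Q'.continuous.continuousAt.eventually_ne hne] with t ht
  rw [eq_div_iff ht]
  simpa [Polynomial.eval₂_id] using hPQ' () t
end

section
/- Let n ≥ 1 and k ≥ 1 be integers, and let f : ℝ^n → ℝ be a regulous function with representation f = p/q on {x : q(x) ≠ 0}, where p, q are real polynomials in n variables and q ≠ 0 as a polynomial. Let g denote the rational function g(x) = p(x)/q(x) defined on the open set U = {x : q(x) ≠ 0}. Then f is of class C^k on ℝ^n if and only if for every j ∈ {1, …, k} the map x ↦ iteratedFDeriv ℝ j g x, defined on U, admits a continuous extension to all of ℝ^n (i.e., all partial derivatives of g of order at most k extend continuously to ℝ^n). -/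
open MvPolynomial

lemma line_zero_finite {n : ℕ} (q : MvPolynomial (Fin n) ℝ) (a b : Fin n → ℝ)
    (hb : eval b q ≠ 0) : {t : ℝ | eval (a + t • (b - a)) q = 0}.Finite := by
  set P : Polynomial ℝ :=
    eval₂ Polynomial.C (fun i => Polynomial.C (a i) + Polynomial.X * Polynomial.C (b i - a i)) q
    with hP
  have key : ∀ t : ℝ, P.eval t = eval (a + t • (b - a)) q := by
    intro t
    rw [hP, polynomial_eval_eval₂]
    have h1 : (Polynomial.evalRingHom t).comp Polynomial.C = RingHom.id ℝ := by
      ext r; simp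
    rw [h1, eval₂_id]
    congr 2
    ext i
    simp
  have hP0 : P ≠ 0 := by
    intro h
    apply hb
    have := key 1
    rw [h] at this
    simpa using this.symm
  refine (P.roots.toFinset.finite_toSet).subset ?_
  intro t ht
  simp only [Set.mem_setOf_eq] at ht
  simp [hP0, key, ht]

lemma nonzero_dense {n : ℕ} (q : MvPolynomial (Fin n) ℝ) (hq : q ≠ 0) :
    Dense {x : Fin n → ℝ | eval x q ≠ 0} := by
  obtain ⟨c, hc⟩ : ∃ c, eval c q ≠ 0 := by
    by_contra! h
    exact hq (MvPolynomial.funext fun x => by simp [h x])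
  intro x
  have hd : Dense ({t : ℝ | eval (x + t • (c - x)) q = 0}ᶜ) :=
    (line_zero_finite q x c hc).countable.dense_compl ℝ
  have hcont : Continuous fun t : ℝ => x + t • (c - x) := by fun_prop
  have := image_closure_subset_closure_image hcont
    (s := {t : ℝ | eval (x + t • (c - x)) q = 0}ᶜ) ⟨0, hd 0, rfl⟩
  simp only [zero_smul, add_zero] at this
  refine closure_mono ?_ this
  rintro _ ⟨t, ht, rfl⟩
  exact ht

lemma eval_contDiff {n : ℕ} (q : MvPolynomial (Fin n) ℝ) (m : WithTop ℕ∞) :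
    ContDiff ℝ m (fun x : Fin n → ℝ => eval x q) := by
  induction q using MvPolynomial.induction_on with
  | C a => simpa using contDiff_const
  | add p q hp hq => simpa using hp.add hq
  | mul_X p i hp => simpa using hp.mul (contDiff_apply ℝ ℝ i)

lemma hasFDerivAt_extend {n : ℕ} {V : Type*} [NormedAddCommGroup V] [NormedSpace ℝ V]
    [CompleteSpace V] (q : MvPolynomial (Fin n) ℝ) (hq : q ≠ 0)
    (F : (Fin n → ℝ) → V) (G : (Fin n → ℝ) → ((Fin n → ℝ) →L[ℝ] V))
    (hF : Continuous F) (hG : Continuous G)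
    (h : ∀ x, eval x q ≠ 0 → HasFDerivAt F (G x) x) (x : Fin n → ℝ) :
    HasFDerivAt F (G x) x := by
  rw [hasFDerivAt_iff_isLittleO, Asymptotics.isLittleO_iff]
  intro ε hε
  obtain ⟨δ, hδ, hball⟩ := Metric.continuous_iff.1 hG x ε hε
  have claim : ∀ b ∈ Metric.ball x δ, eval b q ≠ 0 →
      ‖F b - F x - G x (b - x)‖ ≤ ε * ‖b - x‖ := by
    intro b hb hbq
    have hl : ∀ t : ℝ, HasDerivAt (fun t : ℝ => x + t • (b - x)) (b - x) t := by
      intro t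
      simpa using ((hasDerivAt_id t).smul_const (b - x)).const_add x
    have hlc : Continuous fun t : ℝ => x + t • (b - x) := by fun_prop
    have hc' : Continuous fun t : ℝ => (G (x + t • (b - x)) - G x) (b - x) :=
      ((hG.comp hlc).sub continuous_const).clm_apply continuous_const
    have hint := MeasureTheory.integral_eq_of_hasDerivAt_off_countable
      (fun t : ℝ => F (x + t • (b - x)) - G x (x + t • (b - x)))
      (fun t : ℝ => (G (x + t • (b - x)) - G x) (b - x)) (a := 0) (b := 1)
      (line_zero_finite q x b hbq).countable
      (((hF.comp hlc).sub ((G x).continuous.comp hlc)).continuousOn)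
      (by
        intro t ht
        have h1 := (h _ ht.2).comp_hasDerivAt t (hl t)
        have h2 := (G x).hasFDerivAt.comp_hasDerivAt t (hl t)
        exact h1.sub h2)
      (hc'.intervalIntegrable _ _)
    have hn := intervalIntegral.norm_integral_le_of_norm_le_const (a := (0:ℝ)) (b := 1)
      (C := ε * ‖b - x‖) (f := fun t : ℝ => (G (x + t • (b - x)) - G x) (b - x)) (by
        intro t ht
        rw [Set.uIoc_of_le zero_le_one] at ht
        refine (ContinuousLinearMap.le_opNorm _ _).trans ?_
        gcongr
        rw [← dist_eq_norm]
        refine (hball _ ?_).le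
        rw [Metric.mem_ball, dist_eq_norm] at hb
        rw [dist_eq_norm, add_sub_cancel_left, norm_smul, Real.norm_of_nonneg ht.1.le]
        nlinarith [ht.2, norm_nonneg (b - x)])
    rw [hint] at hn
    have e : F b - F x - G x (b - x) = F (x + (1:ℝ) • (b - x)) - G x (x + (1:ℝ) • (b - x))
        - (F (x + (0:ℝ) • (b - x)) - G x (x + (0:ℝ) • (b - x))) := by
      simp only [one_smul, zero_smul, add_sub_cancel, add_zero, map_sub]
      abel
    rw [e]
    simpa using hn
  filter_upwards [Metric.ball_mem_nhds x hδ] with b hb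
  have hcl : IsClosed {b | ‖F b - F x - G x (b - x)‖ ≤ ε * ‖b - x‖} :=
    isClosed_le (by fun_prop) (by fun_prop)
  have hb' := (nonzero_dense q hq).open_subset_closure_inter Metric.isOpen_ball hb
  exact closure_minimal (fun y hy => claim y hy.1 hy.2) hcl hb'

/-- STATEMENT 12: a regulous function `f` with representation `p/q` is of class `C^k` on
`ℝ^n` if and only if all partial derivatives of the rational function `p/q` of order
`1,…,k`, defined on `{q ≠ 0}`, extend continuously to `ℝ^n`. -/
theorem regulous_Ck_iff_derivatives_extend_continuously
    (n k : ℕ) (hn : 1 ≤ n) (hk : 1 ≤ k)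
    (f : (Fin n → ℝ) → ℝ) (hfc : Continuous f)
    (p q : MvPolynomial (Fin n) ℝ) (hq : q ≠ 0)
    (hrep : ∀ x : Fin n → ℝ, eval x q ≠ 0 → f x = eval x p / eval x q)
    (g : (Fin n → ℝ) → ℝ) (hg : g = fun x => eval x p / eval x q) :
    ContDiff ℝ k f ↔ ∀ j : ℕ, 1 ≤ j → j ≤ k →
      ∃ G : (Fin n → ℝ) → ContinuousMultilinearMap ℝ (fun _ : Fin j => Fin n → ℝ) ℝ,
        Continuous G ∧ ∀ x : Fin n → ℝ, eval x q ≠ 0 → G x = iteratedFDeriv ℝ j g x := by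
  have hopen : IsOpen {x : Fin n → ℝ | eval x q ≠ 0} :=
    isOpen_ne_fun (eval_contDiff q 0).continuous continuous_const
  have hfg : ∀ x, eval x q ≠ 0 → f =ᶠ[nhds x] g := by
    intro x hx
    filter_upwards [hopen.mem_nhds hx] with y hy
    rw [hg]
    exact hrep y hy
  constructor
  · intro hf j _ hj
    exact ⟨iteratedFDeriv ℝ j f, hf.continuous_iteratedFDeriv (by exact_mod_cast hj),
      fun x hx => ((hfg x hx).iteratedFDeriv ℝ j).eq_of_nhds⟩
  · intro H
    have H' : ∀ j : ℕ,
      ∃ G : (Fin n → ℝ) → ContinuousMultilinearMap ℝ (fun _ : Fin j => Fin n → ℝ) ℝ,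
        j ≤ k → (Continuous G ∧ ∀ x : Fin n → ℝ, eval x q ≠ 0 → G x = iteratedFDeriv ℝ j f x) := by
      intro j
      by_cases hj : j ≤ k
      · rcases Nat.eq_zero_or_pos j with rfl | hj0
        · exact ⟨iteratedFDeriv ℝ 0 f, fun _ =>
            ⟨(contDiff_zero.2 hfc).continuous_iteratedFDeriv (by simp), fun _ _ => rfl⟩⟩
        · obtain ⟨G, hG, hG'⟩ := H j hj0 hj
          exact ⟨G, fun _ => ⟨hG, fun x hx =>
            (hG' x hx).trans ((hfg x hx).iteratedFDeriv ℝ j).eq_of_nhds.symm⟩⟩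
      · exact ⟨0, fun h => absurd h hj⟩
    choose P hP using H'
    have hT : HasFTaylorSeriesUpTo ((k : ℕ∞) : WithTop ℕ∞) f (fun x j => P j x) := by
      refine ⟨?_, ?_, ?_⟩
      · intro x
        have h0 := hP 0 (Nat.zero_le _)
        have : P 0 = iteratedFDeriv ℝ 0 f :=
          Continuous.ext_on (nonzero_dense q hq) h0.1
            ((contDiff_zero.2 hfc).continuous_iteratedFDeriv (by simp)) fun x hx => h0.2 x hx
        simp [this]
      · intro m hm x
        have hm' : m < k := by exact_mod_cast hm
        refine hasFDerivAt_extend q hq (P m) (fun x => (P (m + 1) x).curryLeft)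
          (hP m hm'.le).1 ?_ ?_ x
        · exact (continuousMultilinearCurryLeftEquiv ℝ
            (fun _ : Fin (m + 1) => Fin n → ℝ) ℝ).continuous.comp (hP (m + 1) hm').1
        · intro y hy
          have hfy : ContDiffAt ℝ ((m + 1 : ℕ) : WithTop ℕ∞) f y := by
            refine ContDiffAt.congr_of_eventuallyEq ?_ (hfg y hy)
            rw [hg]
            exact (eval_contDiff p _).contDiffAt.div (eval_contDiff q _).contDiffAt hy
          have hd := (hfy.differentiableAt_iteratedFDeriv
            (m := m) (by exact_mod_cast Nat.lt_succ_self m)).hasFDerivAt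
          rw [fderiv_iteratedFDeriv] at hd
          have e : P m =ᶠ[nhds y] iteratedFDeriv ℝ m f := by
            filter_upwards [hopen.mem_nhds hy] with z hz
            exact (hP m hm'.le).2 z hz
          have := hd.congr_of_eventuallyEq e
          rw [(hP (m + 1) hm').2 y hy]
          exact this
      · intro m hm
        exact (hP m (by exact_mod_cast hm)).1
    exact hT.contDiff
end

section
/- Let f : ℝ² → ℝ be continuous and let p, q ∈ ℝ[x,y] be nonzero polynomials such that the zero set Z(q) = q⁻¹(0) is finite, f(x) = p(x)/q(x) for every x with q(x) ≠ 0, and q(0,0) = 0. Let n be the least degree of a nonzero homogeneous component of p, and m the least degree of a nonzero homogeneous component of q. Then: m is even, n ≥ m, and f(0,0) = 0 if and only if n > m. -/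
open MvPolynomial

theorem aux_order_expand (r : MvPolynomial (Fin 2) ℝ) (k : ℕ)
    (h : ∀ d < k, homogeneousComponent d r = 0) (v : Fin 2 → ℝ) :
    ∃ g : ℝ → ℝ, Continuous g ∧ g 0 = eval v (homogeneousComponent k r) ∧
      ∀ t : ℝ, eval (t • v) r = t ^ k * g t := by
  have hom : ∀ i (t : ℝ), eval (t • v) (homogeneousComponent i r)
      = t ^ i * eval v (homogeneousComponent i r) := by
    intro i t
    rw [eval_eq', eval_eq', Finset.mul_sum]
    refine Finset.sum_congr rfl fun d hd => ?_
    have hdeg := (homogeneousComponent_isHomogeneous i r) (mem_support_iff.mp hd)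
    have hsum : t ^ i = t ^ d 0 * t ^ d 1 := by
      rw [← pow_add, ← hdeg]; simp [Finsupp.weight_apply, Finsupp.sum_fintype]
    simp only [Fin.prod_univ_two, Pi.smul_apply, smul_eq_mul, mul_pow, hsum]
    ring
  have hbig : ∀ t : ℝ, eval (t • v) r = ∑ i ∈ Finset.range (r.totalDegree + 1 + k),
      t ^ i * eval v (homogeneousComponent i r) := by
    intro t
    conv_lhs => rw [← sum_homogeneousComponent r]
    rw [map_sum, Finset.sum_congr rfl (fun i _ => hom i t)]
    refine Finset.sum_subset (by intro i; simp; omega) fun i _ hi => ?_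
    rw [homogeneousComponent_eq_zero i r (by simp at hi; omega)]
    simp
  refine ⟨fun t => ∑ i ∈ Finset.range (r.totalDegree + 1),
    t ^ i * eval v (homogeneousComponent (k + i) r), by fun_prop, ?_, ?_⟩
  · simp [Finset.sum_range_succ']
  · intro t
    rw [hbig, add_comm, Finset.sum_range_add, Finset.sum_eq_zero, zero_add, Finset.mul_sum]
    · exact Finset.sum_congr rfl fun i _ => by ring
    · intro i hi
      rw [h i (by simpa using hi)]
      simp

/-- STATEMENT 15: for a continuous rational function `f = p/q` on `ℝ²` with finite `Z(q)`
and `q(0,0) = 0`, if `n` (resp. `m`) is the order at the origin of `p` (resp. `q`), then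
`m` is even, `n ≥ m`, and `f(0,0) = 0` if and only if `n > m`. -/
theorem order_of_num_and_denom_of_regulous_at_pole
    (f : (Fin 2 → ℝ) → ℝ) (hf : Continuous f)
    (p q : MvPolynomial (Fin 2) ℝ) (hp : p ≠ 0) (hq : q ≠ 0)
    (hfin : {x : Fin 2 → ℝ | eval x q = 0}.Finite)
    (hrep : ∀ x : Fin 2 → ℝ, eval x q ≠ 0 → f x = eval x p / eval x q)
    (h0 : eval (0 : Fin 2 → ℝ) q = 0)
    (n m : ℕ)
    (hn : homogeneousComponent n p ≠ 0 ∧ ∀ d < n, homogeneousComponent d p = 0)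
    (hm : homogeneousComponent m q ≠ 0 ∧ ∀ d < m, homogeneousComponent d q = 0) :
    Even m ∧ m ≤ n ∧ (f 0 = 0 ↔ m < n) := by
  obtain ⟨v, hv⟩ : ∃ v : Fin 2 → ℝ,
      eval v (homogeneousComponent n p * homogeneousComponent m q) ≠ 0 := by
    by_contra! hcon
    exact mul_ne_zero hn.1 hm.1 (MvPolynomial.funext fun x => by rw [hcon x, map_zero])
  rw [map_mul] at hv
  have hpv := left_ne_zero_of_mul hv
  have hqv := right_ne_zero_of_mul hv
  obtain ⟨a, ha, ha0, hae⟩ := aux_order_expand p n hn.2 v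
  obtain ⟨b, hb, hb0, hbe⟩ := aux_order_expand q m hm.2 v
  rw [← ha0] at hpv
  rw [← hb0] at hqv
  have hbne : ∀ᶠ t in nhds (0 : ℝ), b t ≠ 0 := hb.continuousAt.eventually_ne hqv
  have hF : Continuous fun t : ℝ => f (t • v) := by fun_prop
  have key : ∀ᶠ t in nhdsWithin (0 : ℝ) {0}ᶜ, t ^ n * a t = f (t • v) * (t ^ m * b t) := by
    filter_upwards [self_mem_nhdsWithin, hbne.filter_mono nhdsWithin_le_nhds] with t ht hbt
    have hne : eval (t • v) q ≠ 0 := by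
      rw [hbe]; exact mul_ne_zero (pow_ne_zero _ ht) hbt
    rw [← hae, ← hbe, hrep _ hne, div_mul_cancel₀ _ hne]
  have lim : ∀ F G : ℝ → ℝ, Continuous F → Continuous G →
      (∀ᶠ t in nhdsWithin (0 : ℝ) {0}ᶜ, F t = G t) → F 0 = G 0 := by
    intro F G hF hG hFG
    exact tendsto_nhds_unique_of_eventuallyEq
      (hF.continuousAt.tendsto.mono_left nhdsWithin_le_nhds)
      (hG.continuousAt.tendsto.mono_left nhdsWithin_le_nhds) hFG
  have hmn : m ≤ n := by
    by_contra! hlt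
    obtain ⟨c, rfl⟩ := Nat.exists_eq_add_of_lt hlt
    have := lim a (fun t => f (t • v) * (t ^ (c + 1) * b t)) ha (by fun_prop) (by
      filter_upwards [key, self_mem_nhdsWithin] with t h ht
      apply mul_left_cancel₀ (pow_ne_zero n ht)
      rw [h]; ring)
    simp at this
    exact hpv this
  refine ⟨?_, hmn, ?_⟩
  · by_contra hodd
    rw [Nat.not_even_iff_odd] at hodd
    have hev : ∀ᶠ t in nhds (0 : ℝ), 0 < b t * b (-t) := by
      have : Continuous fun t => b t * b (-t) := by fun_prop
      refine this.continuousAt.eventually (lt_mem_nhds ?_)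
      simpa using mul_self_pos.mpr hqv
    obtain ⟨t, ht, htpos⟩ := ((hev.filter_mono nhdsWithin_le_nhds).and
      (self_mem_nhdsWithin (s := Set.Ioi (0 : ℝ)))).exists
    have hneg : eval (t • v) q * eval ((-t) • v) q < 0 := by
      rw [hbe, hbe, hodd.neg_pow]
      have : 0 < t ^ m := pow_pos htpos m
      nlinarith [mul_pos (mul_pos this this) ht]
    have hconn : IsPreconnected {x : Fin 2 → ℝ | eval x q = 0}ᶜ :=
      (hfin.countable.isPathConnected_compl_of_one_lt_rank
        (by simp)).isConnected.isPreconnected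
    have hx : t • v ∈ {x : Fin 2 → ℝ | eval x q = 0}ᶜ := fun h => by
      simp only [Set.mem_ofPred_eq] at h; rw [h] at hneg; simp at hneg
    have hy : (-t) • v ∈ {x : Fin 2 → ℝ | eval x q = 0}ᶜ := fun h => by
      simp only [Set.mem_ofPred_eq] at h; rw [h] at hneg; simp at hneg
    have hc : ContinuousOn (fun x : Fin 2 → ℝ => eval x q) {x : Fin 2 → ℝ | eval x q = 0}ᶜ :=
      (MvPolynomial.continuous_eval q).continuousOn
    have : ∃ x ∈ {x : Fin 2 → ℝ | eval x q = 0}ᶜ, eval x q = 0 := by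
      rcases mul_neg_iff.mp hneg with ⟨h1, h2⟩ | ⟨h1, h2⟩
      · exact hconn.intermediate_value hy hx hc ⟨h2.le, h1.le⟩
      · exact hconn.intermediate_value hx hy hc ⟨h1.le, h2.le⟩
    obtain ⟨x, hx1, hx2⟩ := this
    exact hx1 hx2
  · obtain ⟨c, rfl⟩ := Nat.exists_eq_add_of_le hmn
    have := lim (fun t => t ^ c * a t) (fun t => f (t • v) * b t) (by fun_prop) (by fun_prop) (by
      filter_upwards [key, self_mem_nhdsWithin] with t h ht
      apply mul_left_cancel₀ (pow_ne_zero m ht)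
      linear_combination h)
    simp only [zero_smul] at this
    rcases Nat.eq_zero_or_pos c with rfl | hc
    · simp only [pow_zero, one_mul] at this
      simp only [add_zero, lt_irrefl, iff_false]
      intro h
      rw [h, zero_mul] at this
      exact hpv this
    · rw [zero_pow hc.ne', zero_mul] at this
      exact ⟨fun _ => by omega, fun _ => (mul_eq_zero.mp this.symm).resolve_right hqv⟩
end

section
/- Let f : ℝ² → ℝ be a [1]-regulous function with relatively prime representation f = p/q as in the definition. Then the first partial derivatives of f are locally bounded at every point of Z(q): for every a ∈ Z(q) there exist a neighbourhood U of a in ℝ² and a constant C > 0 such that for every x ∈ U with q(x) ≠ 0 one has ‖fderiv ℝ f x‖ ≤ C (f being differentiable on the open set {x : q(x) ≠ 0}, where it coincides with p/q). -/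
open MvPolynomial

/-- All coefficients of degree less than `k` vanish. -/
def OrdGE (k : ℕ) (P : MvPolynomial (Fin 2) ℝ) : Prop :=
  ∀ d : Fin 2 →₀ ℕ, d.degree < k → coeff d P = 0

theorem ordGE_of_comp {k : ℕ} {P : MvPolynomial (Fin 2) ℝ}
    (h : ∀ d < k, homogeneousComponent d P = 0) : OrdGE k P := by
  intro d hd
  have := congrArg (coeff d) (h _ hd)
  simpa [coeff_homogeneousComponent] using this

theorem OrdGE.pderiv {k : ℕ} {P : MvPolynomial (Fin 2) ℝ} (h : OrdGE (k + 1) P) (i : Fin 2) :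
    OrdGE k (MvPolynomial.pderiv i P) := by
  intro d hd
  rw [coeff_pderiv, h, zero_mul]
  rw [map_add, Finsupp.degree_single]
  omega

theorem OrdGE.sub_comp {k : ℕ} {P : MvPolynomial (Fin 2) ℝ} (h : OrdGE k P) :
    OrdGE (k + 1) (P - homogeneousComponent k P) := by
  intro d hd
  rw [coeff_sub, coeff_homogeneousComponent]
  split_ifs with h1
  · simp
  · rw [h d (by omega)]; simp

theorem OrdGE.succ {k : ℕ} {P : MvPolynomial (Fin 2) ℝ} (h : OrdGE k P)
    (h0 : homogeneousComponent k P = 0) : OrdGE (k + 1) P := by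
  have := h.sub_comp
  rwa [h0, sub_zero] at this

theorem OrdGE.bound {k : ℕ} {P : MvPolynomial (Fin 2) ℝ} (h : OrdGE k P) :
    ∃ K : ℝ, 0 < K ∧ ∀ y : Fin 2 → ℝ, ‖y‖ ≤ 1 → |eval y P| ≤ K * ‖y‖ ^ k := by
  refine ⟨∑ d ∈ P.support, |coeff d P| + 1, by positivity, fun y hy => ?_⟩
  have : |eval y P| ≤ (∑ d ∈ P.support, |coeff d P|) * ‖y‖ ^ k := by
    rw [eval_eq', Finset.sum_mul]
    refine (Finset.abs_sum_le_sum_abs _ _).trans (Finset.sum_le_sum fun d hd => ?_)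
    rw [abs_mul]
    refine mul_le_mul_of_nonneg_left ?_ (abs_nonneg _)
    rw [Finset.abs_prod]
    have h1 : ∏ i, |y i ^ d i| ≤ ∏ i, ‖y‖ ^ d i := by
      refine Finset.prod_le_prod (fun _ _ => abs_nonneg _) fun i _ => ?_
      rw [abs_pow]
      exact pow_le_pow_left₀ (abs_nonneg _) (norm_le_pi_norm y i) _
    refine h1.trans ?_
    rw [Finset.prod_pow_eq_pow_sum]
    refine pow_le_pow_of_le_one (norm_nonneg _) hy ?_
    by_contra hc
    refine (mem_support_iff.mp hd) (h d ?_)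
    rw [Finsupp.degree_eq_sum]
    omega
  nlinarith [pow_nonneg (norm_nonneg y) k]

theorem eval_smul_comp (k : ℕ) (P : MvPolynomial (Fin 2) ℝ) (t : ℝ) (y : Fin 2 → ℝ) :
    eval (t • y) (homogeneousComponent k P) = t ^ k * eval y (homogeneousComponent k P) := by
  rw [eval_eq', eval_eq', Finset.mul_sum]
  refine Finset.sum_congr rfl fun d hd => ?_
  have hdeg : d.degree = k := by
    by_contra hc
    refine (mem_support_iff.mp hd) ?_
    rw [coeff_homogeneousComponent, if_neg hc]
  simp only [Pi.smul_apply, smul_eq_mul, mul_pow, Finset.prod_mul_distrib,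
    Finset.prod_pow_eq_pow_sum]
  rw [← Finsupp.degree_eq_sum, hdeg]
  ring

theorem poly_hasFDerivAt (P : MvPolynomial (Fin 2) ℝ) (x : Fin 2 → ℝ) :
    HasFDerivAt (fun x => eval x P)
      (∑ i, eval x (MvPolynomial.pderiv i P) •
        ContinuousLinearMap.proj (R := ℝ) (φ := fun _ : Fin 2 => ℝ) i) x := by
  induction P using MvPolynomial.induction_on with
  | C a => simpa using hasFDerivAt_const a x
  | add p q hp hq =>
    have := hp.add hq
    simp only [map_add, add_smul, Finset.sum_add_distrib]
    exact this
  | mul_X p j hp =>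
    have h2 : HasFDerivAt (fun x : Fin 2 → ℝ => x j)
      (ContinuousLinearMap.proj (R := ℝ) (φ := fun _ : Fin 2 => ℝ) j) x := hasFDerivAt_apply j x
    have := hp.mul h2
    simp only [map_mul, eval_X]
    refine this.congr_fderiv ?_
    ext v
    fin_cases j <;> simp [Derivation.leibniz, pderiv_X, Pi.single_apply] <;> ring

theorem grad_norm_le {k : ℕ} {P : MvPolynomial (Fin 2) ℝ} (h : OrdGE (k + 1) P) :
    ∃ K : ℝ, 0 < K ∧ ∀ y : Fin 2 → ℝ, ‖y‖ ≤ 1 →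
      ‖∑ i, eval y (MvPolynomial.pderiv i P) •
        ContinuousLinearMap.proj (R := ℝ) (φ := fun _ : Fin 2 => ℝ) i‖ ≤ K * ‖y‖ ^ k := by
  obtain ⟨K0, h0, H0⟩ := (h.pderiv 0).bound
  obtain ⟨K1, h1, H1⟩ := (h.pderiv 1).bound
  refine ⟨K0 + K1, by positivity, fun y hy => ?_⟩
  refine ContinuousLinearMap.opNorm_le_bound _ (by positivity) fun v => ?_
  have e0 := norm_le_pi_norm v 0
  have e1 := norm_le_pi_norm v 1
  simp only [Fin.sum_univ_two, add_apply, smul_apply,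
    ContinuousLinearMap.proj_apply, smul_eq_mul]
  refine (norm_add_le _ _).trans ?_
  rw [norm_mul, norm_mul]
  have a0 := mul_le_mul (H0 y hy) e0 (norm_nonneg _) (by positivity)
  have a1 := mul_le_mul (H1 y hy) e1 (norm_nonneg _) (by positivity)
  rw [Real.norm_eq_abs (eval y _), Real.norm_eq_abs (eval y _)]
  linarith

theorem lower_bound {m : ℕ} {Q : MvPolynomial (Fin 2) ℝ} (h : OrdGE m Q)
    (hpos : ∀ y : Fin 2 → ℝ, y ≠ 0 → 0 < eval y (homogeneousComponent m Q)) :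
    ∃ c : ℝ, 0 < c ∧ ∃ δ : ℝ, 0 < δ ∧ δ ≤ 1 ∧
      ∀ y : Fin 2 → ℝ, ‖y‖ < δ → c * ‖y‖ ^ m ≤ eval y Q := by
  obtain ⟨K, hK, H⟩ := h.sub_comp.bound
  have hcont : Continuous fun y : Fin 2 → ℝ => eval y (homogeneousComponent m Q) :=
    MvPolynomial.continuous_eval _
  obtain ⟨z, hz, hmin⟩ := (isCompact_sphere (0 : Fin 2 → ℝ) 1).exists_isMinOn
    (NormedSpace.sphere_nonempty.mpr zero_le_one) hcont.continuousOn
  have hz0 : z ≠ 0 := by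
    rintro rfl
    simp at hz
  set c := eval z (homogeneousComponent m Q) with hc
  have hcpos : 0 < c := hpos z hz0
  have hlow : ∀ y : Fin 2 → ℝ, y ≠ 0 → c * ‖y‖ ^ m ≤ eval y (homogeneousComponent m Q) := by
    intro y hy
    have hn : 0 < ‖y‖ := norm_pos_iff.mpr hy
    have hs : (‖y‖⁻¹ • y) ∈ Metric.sphere (0 : Fin 2 → ℝ) 1 := by
      simp [norm_smul, hn.ne']
    have h1 : c ≤ eval (‖y‖⁻¹ • y) (homogeneousComponent m Q) := hmin hs
    have h2 : eval y (homogeneousComponent m Q) =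
        ‖y‖ ^ m * eval (‖y‖⁻¹ • y) (homogeneousComponent m Q) := by
      rw [← eval_smul_comp, smul_smul, mul_inv_cancel₀ hn.ne', one_smul]
    rw [h2, mul_comm]
    exact mul_le_mul_of_nonneg_left h1 (by positivity)
  refine ⟨c / 2, by positivity, min 1 (c / (2 * K)), by positivity, min_le_left _ _,
    fun y hy => ?_⟩
  have hy1 : ‖y‖ < 1 := lt_of_lt_of_le hy (min_le_left _ _)
  have hy2 : ‖y‖ < c / (2 * K) := lt_of_lt_of_le hy (min_le_right _ _)
  have hb := H y hy1.le
  rw [map_sub] at hb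
  have hb' := (abs_le.mp hb).1
  rw [lt_div_iff₀ (by positivity)] at hy2
  have h3 : c * ‖y‖ ^ m ≤ eval y (homogeneousComponent m Q) := by
    by_cases hy0 : y = 0
    · subst hy0
      have hlim : Filter.Tendsto (fun t : ℝ => eval (t • z) (homogeneousComponent m Q))
          (nhdsWithin 0 (Set.Ioi 0)) (nhds (eval ((0:ℝ) • z) (homogeneousComponent m Q))) :=
        ((hcont.comp (continuous_id.smul continuous_const)).tendsto 0).mono_left
          nhdsWithin_le_nhds
      have hz1 : ‖z‖ = 1 := by simpa using hz
      rw [eval_smul_comp, ← hc] at hlim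
      have : eval (0 : Fin 2 → ℝ) (homogeneousComponent m Q) = 0 ^ m * c := by
        rw [hc, ← eval_smul_comp, zero_smul]
      rw [this, norm_zero, mul_comm]
    · exact hlow y hy0
  have h4 : K * ‖y‖ ^ (m + 1) ≤ c / 2 * ‖y‖ ^ m := by
    rw [pow_succ]
    nlinarith [mul_nonneg (pow_nonneg (norm_nonneg y) m) (sub_nonneg.mpr hy2.le)]
  linarith

theorem ord_of_little {m : ℕ} {P Q : MvPolynomial (Fin 2) ℝ} (hQ : OrdGE m Q)
    (hlit : ∀ ε : ℝ, 0 < ε → ∃ δ : ℝ, 0 < δ ∧ ∀ y : Fin 2 → ℝ, ‖y‖ < δ →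
      |eval y P| ≤ ε * |eval y Q|) : OrdGE (m + 1) P := by
  suffices H : ∀ k ≤ m + 1, OrdGE k P from H _ le_rfl
  intro k
  induction k with
  | zero => intro _ d hd; omega
  | succ k ih =>
    intro hk
    have hP := ih (by omega)
    refine hP.succ ?_
    obtain ⟨K, hK, H⟩ := hP.sub_comp.bound
    obtain ⟨L, hL, HL⟩ := hQ.bound
    -- bound on vectors of norm at most one
    have key : ∀ y : Fin 2 → ℝ, ‖y‖ ≤ 1 → eval y (homogeneousComponent k P) = 0 := by
      intro y hy
      by_contra hne
      have hpos : 0 < |eval y (homogeneousComponent k P)| := abs_pos.mpr hne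
      set s := |eval y (homogeneousComponent k P)| with hs
      obtain ⟨δ, hδ, hd⟩ := hlit (s / (4 * L)) (by positivity)
      set t := min 1 (min (δ / 2) (s / (4 * K))) with ht
      have ht0 : 0 < t := by positivity
      have ht1 : t ≤ 1 := min_le_left _ _
      have ht2 : t ≤ δ / 2 := (min_le_right _ _).trans (min_le_left _ _)
      have ht3 : t ≤ s / (4 * K) := (min_le_right _ _).trans (min_le_right _ _)
      have hn : ‖t • y‖ ≤ t := by
        rw [norm_smul, Real.norm_of_nonneg ht0.le]
        nlinarith
      have b1 := hd (t • y) (by linarith)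
      have b2 := HL (t • y) (hn.trans ht1)
      have b3 := H (t • y) (hn.trans ht1)
      rw [map_sub, eval_smul_comp] at b3
      have c2 : ‖t • y‖ ^ m ≤ t ^ k :=
        (pow_le_pow_left₀ (norm_nonneg _) hn m).trans
          (pow_le_pow_of_le_one ht0.le ht1 (by omega))
      have c3 : ‖t • y‖ ^ (k + 1) ≤ t ^ k * t := by
        rw [← pow_succ]
        exact pow_le_pow_left₀ (norm_nonneg _) hn _
      have d1 : |eval (t • y) P| ≤ s / 4 * t ^ k := by
        calc _ ≤ s / (4 * L) * |eval (t • y) Q| := b1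
          _ ≤ s / (4 * L) * (L * t ^ k) := by
            refine mul_le_mul_of_nonneg_left (b2.trans ?_) (by positivity)
            exact mul_le_mul_of_nonneg_left c2 hL.le
          _ = _ := by field_simp
      have d2 : |eval (t • y) P - t ^ k * eval y (homogeneousComponent k P)| ≤
          s / 4 * t ^ k := by
        calc _ ≤ K * ‖t • y‖ ^ (k + 1) := b3
          _ ≤ K * (t ^ k * t) := mul_le_mul_of_nonneg_left c3 hK.le
          _ ≤ K * (t ^ k * (s / (4 * K))) := by gcongr
          _ = _ := by field_simp
      have d3 : |t ^ k * eval y (homogeneousComponent k P)| = t ^ k * s := by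
        rw [abs_mul, abs_of_pos (pow_pos ht0 k)]
      have d4 := abs_sub_abs_le_abs_sub (t ^ k * eval y (homogeneousComponent k P))
        (eval (t • y) P)
      rw [abs_sub_comm, d3] at d4
      have : 0 < t ^ k * s := by positivity
      rw [abs_sub_comm] at d4
      rw [abs_sub_comm] at d2
      nlinarith
    refine MvPolynomial.funext fun y => ?_
    rw [map_zero]
    have hy1 : 0 < ‖y‖ + 1 := by positivity
    have h1 : y = (‖y‖ + 1) • ((‖y‖ + 1)⁻¹ • y) := by
      rw [smul_smul, mul_inv_cancel₀ hy1.ne', one_smul]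
    rw [h1, eval_smul_comp, key, mul_zero]
    rw [norm_smul, norm_inv, Real.norm_of_nonneg hy1.le, inv_mul_le_iff₀ hy1]
    linarith

theorem eval_shiftPoly (a y : Fin 2 → ℝ) (q : MvPolynomial (Fin 2) ℝ) :
    eval y (shiftPoly a q) = eval (a + y) q := by
  unfold shiftPoly
  rw [← MvPolynomial.coe_aeval_eq_eval, ← MvPolynomial.coe_aeval_eq_eval]
  simp only [RingHom.coe_coe]
  rw [aeval_bind₁]
  congr 1
  congr 1
  funext i
  simp

/-- STATEMENT 17: the first partial derivatives of a [1]-regulous function are locally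
bounded at every point of `Z(q)`. -/
theorem oneRegulous_fderiv_locally_bounded_at_poles
    (f : (Fin 2 → ℝ) → ℝ) (hfc : Continuous f)
    (p q : MvPolynomial (Fin 2) ℝ) (hrep : OneRegulousRep f p q) :
    ∀ a : Fin 2 → ℝ, eval a q = 0 →
      ∃ U ∈ nhds a, ∃ C : ℝ, 0 < C ∧
        ∀ x ∈ U, eval x q ≠ 0 → ‖fderiv ℝ f x‖ ≤ C := by
  intro a ha
  obtain ⟨-, -, -, hf, hloc⟩ := hrep
  obtain ⟨m, hm0, hmlt, hpos⟩ := hloc a ha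
  set Q := shiftPoly a q with hQdef
  set c := f a with hcdef
  set P := shiftPoly a p - MvPolynomial.C c * Q with hPdef
  have hQe : ∀ x, eval (x - a) Q = eval x q := fun x => by
    rw [hQdef, eval_shiftPoly]; simp
  have hPe : ∀ x, eval x q ≠ 0 → eval (x - a) P = (f x - c) * eval (x - a) Q := fun x hx => by
    rw [hPdef, map_sub, map_mul, eval_C, eval_shiftPoly, hQe, hf x hx, add_sub_cancel]
    field_simp
  have hm : m ≠ 0 := by
    rintro rfl
    apply hm0
    rw [homogeneousComponent_zero, ← constantCoeff_eq, ← eval_zero, eval_shiftPoly]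
    simpa using ha
  obtain ⟨n, rfl⟩ := Nat.exists_eq_succ_of_ne_zero hm
  simp only [Nat.succ_eq_add_one] at *
  have hQo : OrdGE (n + 1) Q := ordGE_of_comp hmlt
  obtain ⟨b, hb, δ, hδ, hδ1, hlow⟩ := lower_bound hQo hpos
  have hQpos : ∀ y : Fin 2 → ℝ, ‖y‖ < δ → y ≠ 0 → 0 < eval y Q := fun y hy hy0 =>
    lt_of_lt_of_le (mul_pos hb (pow_pos (norm_pos_iff.mpr hy0) _)) (hlow y hy)
  have hPo : OrdGE (n + 1 + 1) P := by
    refine ord_of_little hQo fun ε hε => ?_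
    obtain ⟨η, hη, hcont⟩ := Metric.continuousAt_iff.mp (hfc.continuousAt (x := a)) ε hε
    have main : ∀ y : Fin 2 → ℝ, ‖y‖ < min η δ → y ≠ 0 → |eval y P| ≤ ε * |eval y Q| := by
      intro y hy hy0
      have hq := hQpos y (hy.trans_le (min_le_right _ _)) hy0
      have hy' := hPe (a + y) (by rw [← hQe, add_sub_cancel_left]; exact hq.ne')
      rw [add_sub_cancel_left] at hy'
      rw [hy', abs_mul]
      refine mul_le_mul_of_nonneg_right ?_ (abs_nonneg _)
      have := @hcont (a + y) (by simpa [dist_eq_norm] using hy.trans_le (min_le_left _ _))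
      rw [Real.dist_eq] at this
      exact this.le
    refine ⟨min η δ, by positivity, fun y hy => ?_⟩
    by_cases hy0 : y = 0
    · have hd : Dense ({0}ᶜ : Set (Fin 2 → ℝ)) := dense_compl_singleton 0
      have hmem : (0 : Fin 2 → ℝ) ∈ closure (Metric.ball 0 (min η δ) ∩ {0}ᶜ) :=
        hd.open_subset_closure_inter Metric.isOpen_ball (by simp [hη, hδ])
      have hcl : IsClosed {y : Fin 2 → ℝ | |eval y P| ≤ ε * |eval y Q|} :=
        isClosed_le (MvPolynomial.continuous_eval P).abs
          (continuous_const.mul (MvPolynomial.continuous_eval Q).abs)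
      rw [hy0]
      refine closure_minimal ?_ hcl hmem
      rintro z ⟨hz, hz0⟩
      exact main z (by simpa using hz) hz0
    · exact main y hy hy0
  obtain ⟨K, hK, HK⟩ := hPo.bound
  obtain ⟨M, hM, HM⟩ := grad_norm_le hPo
  obtain ⟨N, hN, HN⟩ := grad_norm_le hQo
  refine ⟨Metric.ball a δ, Metric.ball_mem_nhds a hδ, (M + K / b * N) / b, by positivity, ?_⟩
  intro x hx hqx
  have hyδ : ‖x - a‖ < δ := by rwa [← dist_eq_norm]
  have hy1 : ‖x - a‖ ≤ 1 := hyδ.le.trans hδ1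
  have hxa : x - a ≠ 0 := by
    intro h
    rw [sub_eq_zero.mp h] at hqx
    exact hqx ha
  have hr : 0 < ‖x - a‖ := norm_pos_iff.mpr hxa
  have hopen : ∀ᶠ z in nhds x, eval z q ≠ 0 :=
    (MvPolynomial.continuous_eval q).continuousAt.eventually_ne hqx
  have hdiff : DifferentiableAt ℝ f x := by
    have h1 : DifferentiableAt ℝ (fun z => eval z p / eval z q) x := by
      have e1 := (poly_hasFDerivAt p x).differentiableAt
      have e2 := (poly_hasFDerivAt q x).differentiableAt
      simp only [div_eq_mul_inv]
      exact e1.fun_mul (e2.fun_inv hqx)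
    refine h1.congr_of_eventuallyEq ?_
    filter_upwards [hopen] with z hz using hf z hz
  have hsub : HasFDerivAt (fun z : Fin 2 → ℝ => z - a)
      (ContinuousLinearMap.id ℝ (Fin 2 → ℝ)) x := (hasFDerivAt_id x).sub_const a
  have hDP := (poly_hasFDerivAt P (x - a)).comp x hsub
  have hDQ := (poly_hasFDerivAt Q (x - a)).comp x hsub
  rw [ContinuousLinearMap.comp_id] at hDP hDQ
  have hprod := (hdiff.hasFDerivAt.sub_const c).mul hDQ
  have heq := hprod.unique (hDP.congr_of_eventuallyEq (by
    filter_upwards [hopen] with z hz using (hPe z hz).symm))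
  have hGP := HM (x - a) hy1
  have hGQ := HN (x - a) hy1
  simp only [Function.comp_apply] at heq
  set GP := ∑ i, eval (x - a) (MvPolynomial.pderiv i P) •
        ContinuousLinearMap.proj (R := ℝ) (φ := fun _ : Fin 2 => ℝ) i
  set GQ := ∑ i, eval (x - a) (MvPolynomial.pderiv i Q) •
        ContinuousLinearMap.proj (R := ℝ) (φ := fun _ : Fin 2 => ℝ) i
  have hQp := hQpos _ hyδ hxa
  have hQl := hlow _ hyδ
  have hPK := HK _ hy1
  rw [hPe x hqx, abs_mul, abs_of_pos hQp] at hPK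
  set r := ‖x - a‖
  -- bound on `|f x - c|`
  have hfb : |f x - c| ≤ K / b * r := by
    have h1 : |f x - c| * (b * r ^ (n + 1)) ≤ K * r ^ (n + 1 + 1) :=
      (mul_le_mul_of_nonneg_left hQl (abs_nonneg _)).trans hPK
    have h2 : (|f x - c| * b) * r ^ (n + 1) ≤ (K * r) * r ^ (n + 1) := by
      calc _ = |f x - c| * (b * r ^ (n + 1)) := by ring
        _ ≤ _ := h1
        _ = _ := by ring
    have h3 := le_of_mul_le_mul_right h2 (pow_pos hr _)
    rw [div_mul_eq_mul_div, le_div_iff₀ hb]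
    exact h3
  have hsm : eval (x - a) Q • fderiv ℝ f x = GP - (f x - c) • GQ := by
    rw [← heq]; abel
  have hnorm : eval (x - a) Q * ‖fderiv ℝ f x‖ ≤ (M + K / b * N) * r ^ (n + 1) := by
    calc _ = ‖eval (x - a) Q • fderiv ℝ f x‖ := by
          rw [norm_smul, Real.norm_of_nonneg hQp.le]
      _ ≤ ‖GP‖ + |f x - c| * ‖GQ‖ := by
          rw [hsm]
          refine (norm_sub_le _ _).trans ?_
          rw [norm_smul, Real.norm_eq_abs]
      _ ≤ M * r ^ (n + 1) + (K / b * r) * (N * r ^ n) := by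
          gcongr
      _ = _ := by ring
  rw [le_div_iff₀ hb]
  have h5 : (‖fderiv ℝ f x‖ * b) * r ^ (n + 1) ≤ (M + K / b * N) * r ^ (n + 1) := by
    refine le_trans ?_ hnorm
    have := mul_le_mul_of_nonneg_right hQl (norm_nonneg (fderiv ℝ f x))
    linarith
  exact le_of_mul_le_mul_right h5 (pow_pos hr _)
end
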